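/- arXiv:1301.1512 — 2 statements merged into one kernel-verified Lean document; each statement's English description precedes it below -/
import Mathlib

section
/- Let G be a 2-connected graph which is not a cycle. If G is both K_{1,3}-f_1-heavy and P_4-f_1-heavy, then G is pancyclic. -/
open SimpleGraph

/-- `G` contains a cycle of length `k`. -/
def HasCycleLength {V : Type} (G : SimpleGraph V) (k : ℕ) : Prop :=
  ∃ (v : V) (c : G.Walk v v), c.IsCycle ∧ c.length = k

/-- A graph on `n` vertices is pancyclic if it contains cycles of every length from 3 to `n`. -/
def IsPancyclic {V : Type} [Fintype V] (G : SimpleGraph V) : Prop :=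
  ∀ k : ℕ, 3 ≤ k → k ≤ Fintype.card V → HasCycleLength G k

/-- A graph is Hamiltonian if it contains a spanning cycle. -/
def IsHamiltonianGraph {V : Type} (G : SimpleGraph V) : Prop :=
  ∃ (v : V) (c : G.Walk v v), c.IsCycle ∧ ∀ u : V, u ∈ c.support

/-- A graph is 2-connected if it has at least 3 vertices and deleting any single
vertex leaves a connected graph. -/
def TwoConnected {V : Type} [Fintype V] (G : SimpleGraph V) : Prop :=
  3 ≤ Fintype.card V ∧ ∀ v : V, (G.induce {u : V | u ≠ v}).Connected

/-- A (finite) graph is a cycle iff it is connected and 2-regular. -/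
def IsCycleGraph {V : Type} [Fintype V] (G : SimpleGraph V) [DecidableRel G.Adj] : Prop :=
  G.Connected ∧ ∀ v : V, G.degree v = 2

/-- `G` is `R`-f₁-heavy: for every induced copy of `R` in `G` (given by a graph
embedding `f : R ↪g G`) and every pair of vertices at distance 2 in that copy,
one of them has degree at least `(n+1)/2` in `G`. -/
def F1Heavy {V W : Type} [Fintype V] (G : SimpleGraph V) [DecidableRel G.Adj]
    (R : SimpleGraph W) : Prop :=
  ∀ (f : R ↪g G) (a b : W), R.dist a b = 2 →
    Fintype.card V + 1 ≤ 2 * max (G.degree (f a)) (G.degree (f b))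

/-- `G` is `R`-f-heavy: as above but with degree at least `n/2`. -/
def FHeavy {V W : Type} [Fintype V] (G : SimpleGraph V) [DecidableRel G.Adj]
    (R : SimpleGraph W) : Prop :=
  ∀ (f : R ↪g G) (a b : W), R.dist a b = 2 →
    Fintype.card V ≤ 2 * max (G.degree (f a)) (G.degree (f b))

/-- `G` is `R`-free: no induced subgraph of `G` is isomorphic to `R`. -/
def RFree {V W : Type} (G : SimpleGraph V) (R : SimpleGraph W) : Prop :=
  IsEmpty (R ↪g G)

/-- The claw `K_{1,3}`: vertex `0` is the center, adjacent to `1`, `2`, `3`. -/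
def claw : SimpleGraph (Fin 4) := SimpleGraph.fromRel (fun a _ => a = 0)

/-- `Z_i`: the path `0 1 2 ... (i+2)` together with the chord `{0,2}`,
i.e. a triangle `0 1 2` with a path of `i` edges attached at vertex `2`. -/
def Zgraph (i : ℕ) : SimpleGraph (Fin (i + 3)) :=
  SimpleGraph.fromRel (fun a b => b.val = a.val + 1 ∨ (a.val = 0 ∧ b.val = 2))

/-- The net `N`: triangle `0 1 2` with pendant edges `0-3`, `1-4`, `2-5`. -/
def netGraph : SimpleGraph (Fin 6) :=
  SimpleGraph.fromRel (fun a b =>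
    (a.val = 0 ∧ b.val = 1) ∨ (a.val = 1 ∧ b.val = 2) ∨ (a.val = 0 ∧ b.val = 2) ∨
    (a.val = 0 ∧ b.val = 3) ∨ (a.val = 1 ∧ b.val = 4) ∨ (a.val = 2 ∧ b.val = 5))

/-- The wounded `W`: triangle `0 1 2` with a pendant edge `0-3` and a pendant
path `1-4-5` of two edges. -/
def woundedGraph : SimpleGraph (Fin 6) :=
  SimpleGraph.fromRel (fun a b =>
    (a.val = 0 ∧ b.val = 1) ∨ (a.val = 1 ∧ b.val = 2) ∨ (a.val = 0 ∧ b.val = 2) ∨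
    (a.val = 0 ∧ b.val = 3) ∨ (a.val = 1 ∧ b.val = 4) ∨ (a.val = 4 ∧ b.val = 5))


namespace PanP4

open SimpleGraph

/-- `Pk A S a b l k`: `l` lists a path from `a` to `b`, steps in `A` or `S`, with `k` steps in `S`. -/
inductive Pk {V : Type} (A S : V → V → Prop) : V → V → List V → ℕ → Prop
  | single (a : V) : Pk A S a a [a] 0
  | real {a b c : V} {l : List V} {k : ℕ} : A a b → Pk A S b c l k → Pk A S a c (a :: l) k
  | star {a b c : V} {l : List V} {k : ℕ} : S a b → Pk A S b c l k → Pk A S a c (a :: l) (k + 1)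

section PkBasics
variable {V : Type} {A S : V → V → Prop}

theorem Pk.head_eq {a b : V} {l : List V} {k : ℕ} (h : Pk A S a b l k) : ∃ t, l = a :: t := by
  cases h <;> exact ⟨_, rfl⟩

theorem Pk.last_eq {a b : V} {l : List V} {k : ℕ} (h : Pk A S a b l k) : ∃ t, l = t ++ [b] := by
  induction h with
  | single a => exact ⟨[], rfl⟩
  | real _ _ ih => obtain ⟨t, rfl⟩ := ih; exact ⟨_ :: t, rfl⟩
  | star _ _ ih => obtain ⟨t, rfl⟩ := ih; exact ⟨_ :: t, rfl⟩

theorem Pk.ne_nil {a b : V} {l : List V} {k : ℕ} (h : Pk A S a b l k) : l ≠ [] := by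
  obtain ⟨t, rfl⟩ := h.head_eq; simp

theorem Pk.left_mem {a b : V} {l : List V} {k : ℕ} (h : Pk A S a b l k) : a ∈ l := by
  obtain ⟨t, rfl⟩ := h.head_eq; simp

theorem Pk.right_mem {a b : V} {l : List V} {k : ℕ} (h : Pk A S a b l k) : b ∈ l := by
  obtain ⟨t, rfl⟩ := h.last_eq; simp

theorem Pk.append_real {a b c d : V} {l m : List V} {k j : ℕ} (h : Pk A S a b l k) (e : A b c)
    (h' : Pk A S c d m j) : Pk A S a d (l ++ m) (k + j) := by
  induction h with
  | single a => simpa using Pk.real e h'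
  | real e1 _ ih => exact Pk.real e1 (ih e)
  | star e1 _ ih => rw [Nat.add_right_comm]; exact Pk.star e1 (ih e)

theorem Pk.append_star {a b c d : V} {l m : List V} {k j : ℕ} (h : Pk A S a b l k) (e : S b c)
    (h' : Pk A S c d m j) : Pk A S a d (l ++ m) (k + j + 1) := by
  induction h with
  | single a => simpa using Pk.star e h'
  | real e1 _ ih => exact Pk.real e1 (ih e)
  | star e1 _ ih => rw [Nat.add_right_comm _ 1]; exact Pk.star e1 (ih e)

theorem Pk.rev (hA : ∀ a b, A a b → A b a) (hS : ∀ a b, S a b → S b a)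
    {a b : V} {l : List V} {k : ℕ} (h : Pk A S a b l k) : Pk A S b a l.reverse k := by
  induction h with
  | single a => exact Pk.single a
  | real e1 _ ih =>
    rw [List.reverse_cons]; simpa using ih.append_real (hA _ _ e1) (Pk.single _)
  | star e1 _ ih =>
    rw [List.reverse_cons]; simpa using ih.append_star (hS _ _ e1) (Pk.single _)

theorem Pk.split {l m : List V} (hl : l ≠ []) (hm : m ≠ []) :
    ∀ {a b : V} {k : ℕ}, Pk A S a b (l ++ m) k →
    ∃ p q i j, Pk A S a p l i ∧ Pk A S q b m j ∧
      ((A p q ∧ k = i + j) ∨ (S p q ∧ k = i + j + 1)) := by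
  induction l with
  | nil => exact absurd rfl hl
  | cons x l ih =>
    intro a b k h
    by_cases hl' : l = []
    · subst hl'
      cases h with
      | single => exact absurd rfl hm
      | real e h => exact ⟨_, _, 0, _, Pk.single _, h, Or.inl ⟨e, by simp⟩⟩
      | star e h => exact ⟨_, _, 0, _, Pk.single _, h, Or.inr ⟨e, by simp⟩⟩
    · generalize hz : x :: l ++ m = z at h
      cases h with
      | single => simp at hz; exact absurd hz.2.1 hl'
      | real e h =>
        simp only [List.cons_append, List.cons.injEq] at hz
        obtain ⟨rfl, rfl⟩ := hz
        obtain ⟨p, q, i, j, h1, h2, h3⟩ := ih hl' h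
        exact ⟨p, q, i, j, Pk.real e h1, h2, h3⟩
      | star e h =>
        simp only [List.cons_append, List.cons.injEq] at hz
        obtain ⟨rfl, rfl⟩ := hz
        obtain ⟨p, q, i, j, h1, h2, h3⟩ := ih hl' h
        refine ⟨p, q, i + 1, j, Pk.star e h1, h2, ?_⟩
        rcases h3 with ⟨h3, h4⟩ | ⟨h3, h4⟩
        · exact Or.inl ⟨h3, by omega⟩
        · exact Or.inr ⟨h3, by omega⟩

/-- a path with a star step can be cut there -/
theorem Pk.cut_star {a b : V} {l : List V} {k : ℕ} (h : Pk A S a b l (k + 1)) :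
    ∃ p q l1 l2 i j, l = l1 ++ l2 ∧ Pk A S a p l1 i ∧ Pk A S q b l2 j ∧ S p q ∧ k = i + j := by
  generalize hk : k + 1 = k' at h
  induction h generalizing k with
  | single => omega
  | real e h ih =>
    obtain ⟨p, q, l1, l2, i, j, rfl, h1, h2, h3, h4⟩ := ih hk
    exact ⟨p, q, _ :: l1, l2, i, j, rfl, Pk.real e h1, h2, h3, h4⟩
  | @star a0 b0 c0 l0 k0 e h _ =>
    exact ⟨a0, b0, [a0], l0, 0, k0, rfl, Pk.single _, h, e, by omega⟩

theorem exists_first {p : V → Prop} {l : List V} (h : ∃ a ∈ l, p a) :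
    ∃ l1 a l2, l = l1 ++ a :: l2 ∧ p a ∧ ∀ b ∈ l1, ¬ p b := by
  induction l with
  | nil => simp at h
  | cons x l ih =>
    by_cases hx : p x
    · exact ⟨[], x, l, rfl, hx, by simp⟩
    · obtain ⟨a, ha, hp⟩ := h
      have : a ∈ l := by
        rcases List.mem_cons.1 ha with rfl | h
        · exact absurd hp hx
        · exact h
      obtain ⟨l1, b, l2, rfl, h1, h2⟩ := ih ⟨a, this, hp⟩
      refine ⟨x :: l1, b, l2, rfl, h1, ?_⟩
      intro c hc
      rcases List.mem_cons.1 hc with rfl | hc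
      · exact hx
      · exact h2 c hc

end PkBasics

section Gr
variable {V : Type} [Fintype V] (G : SimpleGraph V) [DecidableRel G.Adj]

/-- heavy vertex -/
def Hv (v : V) : Prop := Fintype.card V + 1 ≤ 2 * G.degree v

/-- star step: two distinct heavy vertices -/
def St (a b : V) : Prop := a ≠ b ∧ Hv G a ∧ Hv G b

/-- real path -/
def RP (a b : V) (l : List V) : Prop := Pk G.Adj (St G) a b l 0

/-- path in the heavy closure -/
def SP (a b : V) (l : List V) : Prop := ∃ k, Pk G.Adj (St G) a b l k

/-- adjacency in the heavy closure -/
def AS (a b : V) : Prop := G.Adj a b ∨ St G a b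

variable {G}

theorem St.symm {a b : V} (h : St G a b) : St G b a := ⟨h.1.symm, h.2.2, h.2.1⟩
theorem AS.symm {a b : V} (h : AS G a b) : AS G b a :=
  h.imp (fun e => SimpleGraph.Adj.symm e) St.symm

theorem RP.single (a : V) : RP G a a [a] := Pk.single a
theorem RP.cons {a b c : V} {l : List V} (e : G.Adj a b) (h : RP G b c l) : RP G a c (a :: l) :=
  Pk.real e h
theorem RP.append {a b c d : V} {l m : List V} (h : RP G a b l) (e : G.Adj b c)
    (h' : RP G c d m) : RP G a d (l ++ m) := Pk.append_real h e h'
theorem RP.rev {a b : V} {l : List V} (h : RP G a b l) : RP G b a l.reverse :=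
  Pk.rev (fun _ _ h => SimpleGraph.Adj.symm h) (fun _ _ h => h.symm) h
theorem RP.snoc {a b c : V} {l : List V} (h : RP G a b l) (e : G.Adj b c) :
    RP G a c (l ++ [c]) := h.append e (RP.single c)
theorem RP.sp {a b : V} {l : List V} (h : RP G a b l) : SP G a b l := ⟨0, h⟩
theorem RP.left_mem {a b : V} {l : List V} (h : RP G a b l) : a ∈ l := Pk.left_mem h
theorem RP.right_mem {a b : V} {l : List V} (h : RP G a b l) : b ∈ l := Pk.right_mem h
theorem RP.ne_nil {a b : V} {l : List V} (h : RP G a b l) : l ≠ [] := Pk.ne_nil h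
theorem RP.head_eq {a b : V} {l : List V} (h : RP G a b l) : ∃ t, l = a :: t := Pk.head_eq h
theorem RP.last_eq {a b : V} {l : List V} (h : RP G a b l) : ∃ t, l = t ++ [b] := Pk.last_eq h

theorem RP.split {a b : V} {l m : List V} (h : RP G a b (l ++ m)) (hl : l ≠ []) (hm : m ≠ []) :
    ∃ p q, RP G a p l ∧ RP G q b m ∧ G.Adj p q := by
  obtain ⟨p, q, i, j, h1, h2, h3⟩ := Pk.split hl hm h
  have hi : i = 0 := by omega
  have hj : j = 0 := by omega
  subst hi; subst hj
  refine ⟨p, q, h1, h2, ?_⟩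
  rcases h3 with h3 | h3
  · exact h3.1
  · omega

/-- split at an inner vertex -/
theorem RP.split_cons {a b x : V} {l m : List V} (h : RP G a b (l ++ x :: m)) (hl : l ≠ []) :
    ∃ p, RP G a p l ∧ RP G x b (x :: m) ∧ G.Adj p x := by
  obtain ⟨p, q, h1, h2, h3⟩ := h.split hl (by simp)
  obtain ⟨t, ht⟩ := h2.head_eq
  simp only [List.cons.injEq] at ht
  obtain ⟨rfl, rfl⟩ := ht
  exact ⟨p, h1, h2, h3⟩

theorem RP.tail {a b x : V} {m : List V} (h : RP G a b (x :: m)) (hm : m ≠ []) :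
    ∃ q, a = x ∧ RP G q b m ∧ G.Adj x q := by
  obtain ⟨p, q, h1, h2, h3⟩ := RP.split (l := [x]) h (by simp) hm
  obtain ⟨t, ht⟩ := h1.head_eq
  obtain ⟨t', ht'⟩ := h1.last_eq
  have : x = p := by
    cases t' <;> simp_all
  simp only [List.cons.injEq] at ht
  exact ⟨q, ht.1.symm, h2, this ▸ h3⟩

theorem RP.head {a b x : V} {m : List V} (h : RP G a b (x :: m)) : a = x := by
  obtain ⟨t, ht⟩ := h.head_eq
  simp only [List.cons.injEq] at ht
  exact ht.1.symm

theorem RP.last {a b x : V} {m : List V} (h : RP G a b (m ++ [x])) : b = x := by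
  obtain ⟨t, ht⟩ := h.last_eq
  have := congrArg List.getLast? ht
  simpa using this.symm

theorem SP.append {a b c d : V} {l m : List V} (h : SP G a b l) (e : AS G b c)
    (h' : SP G c d m) : SP G a d (l ++ m) := by
  obtain ⟨k, h⟩ := h
  obtain ⟨j, h'⟩ := h'
  rcases e with e | e
  · exact ⟨_, h.append_real e h'⟩
  · exact ⟨_, h.append_star e h'⟩
theorem SP.cons {a b c : V} {l : List V} (e : AS G a b) (h : SP G b c l) : SP G a c (a :: l) :=
  SP.append (l := [a]) (RP.single a).sp e h
theorem SP.snoc {a b c : V} {l : List V} (h : SP G a b l) (e : AS G b c) :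
    SP G a c (l ++ [c]) := h.append e (RP.single c).sp

theorem RP.exists_walk {a b : V} {l : List V} (h : RP G a b l) :
    ∃ p : G.Walk a b, p.support = l := by
  unfold RP at h
  generalize hk : 0 = k at h
  induction h with
  | single a => exact ⟨Walk.nil, rfl⟩
  | real e _ ih =>
    obtain ⟨p, hp⟩ := ih hk
    exact ⟨Walk.cons e p, by simp [hp]⟩
  | star => omega

theorem RP.of_walk {a b : V} (p : G.Walk a b) : RP G a b p.support := by
  induction p with
  | nil => exact RP.single _
  | cons e p ih => simpa using RP.cons e ih

theorem RP.hasCycle {a b : V} {l : List V} {k : ℕ} (h : RP G a b l) (hn : l.Nodup)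
    (hk : 3 ≤ k) (hl : l.length = k) (e : G.Adj b a) : HasCycleLength G k := by
  obtain ⟨p, hp⟩ := h.exists_walk
  have hpp : p.IsPath := by rw [Walk.isPath_def, hp]; exact hn
  have hlen : p.length + 1 = k := by rw [← Walk.length_support, hp, hl]
  refine ⟨b, Walk.cons e p, ?_, by simp [hlen]⟩
  rw [Walk.cons_isCycle_iff]
  refine ⟨hpp, fun hmem => ?_⟩
  cases p with
  | nil => simp at hlen; omega
  | @cons _ w _ e' q =>
    rw [Walk.edges_cons, List.mem_cons] at hmem
    rw [Walk.cons_isPath_iff] at hpp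
    rcases hmem with hmem | hmem
    · rw [Sym2.eq_iff] at hmem
      have : b = w := by
        rcases hmem with ⟨h1, h2⟩ | ⟨h1, h2⟩
        · exact absurd h1 e.ne
        · exact h1
      subst this
      have := Walk.length_eq_zero_iff.2 (Walk.isPath_iff_nil.1 hpp.1)
      simp [this] at hlen
      omega
    · exact hpp.2 (Walk.snd_mem_support_of_mem_edges _ hmem)

end Gr

theorem adj_claw {a b : Fin 4} : claw.Adj a b ↔ a ≠ b ∧ (a = 0 ∨ b = 0) := by
  simp [claw]

theorem adj_p4 {a b : Fin 4} :
    (pathGraph 4).Adj a b ↔ (a.val + 1 = b.val ∨ b.val + 1 = a.val) := by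
  rw [pathGraph_adj]

theorem dist_two {W : Type} {R : SimpleGraph W} {a b c : W} (h1 : R.Adj a c) (h2 : R.Adj c b)
    (h3 : ¬ R.Adj a b) (h4 : a ≠ b) : R.dist a b = 2 := by
  have hr : R.Reachable a b := (h1.reachable).trans h2.reachable
  have hle : R.dist a b ≤ 2 := by
    simpa using SimpleGraph.dist_le (Walk.cons h1 (Walk.cons h2 Walk.nil))
  have h0 : R.dist a b ≠ 0 := fun h => h4 (hr.dist_eq_zero_iff.1 h)
  have h1' : R.dist a b ≠ 1 := fun h => h3 (SimpleGraph.dist_eq_one_iff_adj.1 h)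
  omega

/-- claw condition -/
def ClawC {V : Type} [Fintype V] (G : SimpleGraph V) [DecidableRel G.Adj] : Prop :=
  ∀ c x y z : V, G.Adj c x → G.Adj c y → G.Adj c z → x ≠ y → x ≠ z → y ≠ z →
    ¬ G.Adj x y → ¬ G.Adj x z → ¬ G.Adj y z → Hv G x ∨ Hv G y

/-- path condition -/
def PathC {V : Type} [Fintype V] (G : SimpleGraph V) [DecidableRel G.Adj] : Prop :=
  ∀ a b c d : V, G.Adj a b → G.Adj b c → G.Adj c d → ¬ G.Adj a c → ¬ G.Adj a d → ¬ G.Adj b d →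
    (Hv G a ∨ Hv G c) ∧ (Hv G b ∨ Hv G d)

theorem max_hv {V : Type} [Fintype V] {G : SimpleGraph V} [DecidableRel G.Adj] {a b : V}
    (h : Fintype.card V + 1 ≤ 2 * max (G.degree a) (G.degree b)) : Hv G a ∨ Hv G b := by
  unfold Hv
  rcases le_total (G.degree a) (G.degree b) with h' | h'
  · rw [max_eq_right h'] at h; exact Or.inr h
  · rw [max_eq_left h'] at h; exact Or.inl h

theorem clawC_of {V : Type} [Fintype V] {G : SimpleGraph V} [DecidableRel G.Adj]
    (h : F1Heavy G claw) : ClawC G := by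
  intro c x y z hx hy hz hxy hxz hyz nxy nxz nyz
  have hx' := hx.ne
  have hy' := hy.ne
  have hz' := hz.ne
  let f : Fin 4 → V := ![c, x, y, z]
  have hf : Function.Injective f := by
    intro a b hab
    fin_cases a <;> fin_cases b <;> simp_all [f]
  have hadj : ∀ a b, G.Adj (f a) (f b) ↔ claw.Adj a b := by
    intro a b
    rw [adj_claw]
    fin_cases a <;> fin_cases b <;> simp_all [f, SimpleGraph.adj_comm]
  let e : claw ↪g G := ⟨⟨f, hf⟩, fun {a b} => hadj a b⟩
  have := h e 1 2 (dist_two (c := 0) (adj_claw.2 (by simp)) (adj_claw.2 (by simp))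
    (by rw [adj_claw]; simp) (by decide))
  exact max_hv this

theorem pathC_of {V : Type} [Fintype V] {G : SimpleGraph V} [DecidableRel G.Adj]
    (h : F1Heavy G (pathGraph 4)) : PathC G := by
  intro a b c d hab hbc hcd nac nad nbd
  have h1 := hab.ne
  have h2 := hbc.ne
  have h3 := hcd.ne
  have h4 : a ≠ c := by rintro rfl; exact nad hcd
  have h5 : a ≠ d := by rintro rfl; exact nbd hab.symm
  have h6 : b ≠ d := by rintro rfl; exact nad hab
  let f : Fin 4 → V := ![a, b, c, d]
  have hf : Function.Injective f := by
    intro a b hab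
    fin_cases a <;> fin_cases b <;> simp_all [f]
  have hadj : ∀ a b, G.Adj (f a) (f b) ↔ (pathGraph 4).Adj a b := by
    intro a b
    rw [adj_p4]
    fin_cases a <;> fin_cases b <;> simp_all [f, SimpleGraph.adj_comm]
  let e : pathGraph 4 ↪g G := ⟨⟨f, hf⟩, fun {a b} => hadj a b⟩
  exact ⟨max_hv (h e 0 2 (dist_two (c := 1) (adj_p4.2 (by simp)) (adj_p4.2 (by simp))
    (by rw [adj_p4]; simp) (by decide))), max_hv (h e 1 3 (dist_two (c := 2) (adj_p4.2 (by simp)) (adj_p4.2 (by simp))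
    (by rw [adj_p4]; simp) (by decide)))⟩

section LemB

theorem not_chain {V : Type} {R : V → V → Prop} {l : List V} (h : ¬ l.IsChain R) :
    ∃ l1 p q l2, l = l1 ++ p :: q :: l2 ∧ ¬ R p q := by
  induction l with
  | nil => simp at h
  | cons a l ih =>
    cases l with
    | nil => simp at h
    | cons b l =>
      by_cases hab : R a b
      · have : ¬ (b :: l).IsChain R := fun h' => h (List.isChain_cons_cons.2 ⟨hab, h'⟩)
        obtain ⟨l1, p, q, l2, e, hr⟩ := ih this
        exact ⟨a :: l1, p, q, l2, by simp [e], hr⟩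
      · exact ⟨[], a, b, l, rfl, hab⟩

theorem chain_count {V : Type} {P Q : V → Bool} {l : List V}
    (h : l.IsChain (fun p q => ¬ (P p = true ∧ Q q = true))) (hl : l ≠ []) :
    l.tail.countP Q + l.dropLast.countP P + 1 ≤ l.length := by
  induction l with
  | nil => exact absurd rfl hl
  | cons a l ih =>
    cases l with
    | nil => simp
    | cons b l =>
      rw [List.isChain_cons_cons] at h
      have := ih h.2 (by simp)
      simp only [List.tail_cons, List.dropLast_cons_cons, List.countP_cons, List.length_cons] at *
      have h1 := h.1
      split_ifs <;> simp_all <;> omega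

variable {V : Type} [Fintype V] {G : SimpleGraph V} [DecidableRel G.Adj]

theorem deg_out {l : List V} (hn : l.Nodup) {x y : V}
    (h : ∀ v, v ∉ l → ¬ (G.Adj x v ∧ G.Adj y v)) :
    G.degree x + G.degree y + l.length ≤ Fintype.card V +
      l.countP (fun v => decide (G.Adj x v)) + l.countP (fun v => decide (G.Adj y v)) := by
  classical
  have key : ∀ x : V, G.degree x = l.countP (fun v => decide (G.Adj x v)) +
      (G.neighborFinset x \ l.toFinset).card := by
    intro x
    rw [← G.card_neighborFinset_eq_degree, ← Finset.card_inter_add_card_sdiff (G.neighborFinset x) l.toFinset]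
    congr 1
    rw [List.countP_eq_length_filter, ← List.toFinset_card_of_nodup (hn.filter _)]
    congr 1
    ext v
    simp [and_comm]
  have hd : Disjoint (G.neighborFinset x \ l.toFinset) (G.neighborFinset y \ l.toFinset) := by
    rw [Finset.disjoint_left]
    intro v hv hv'
    simp only [Finset.mem_sdiff, mem_neighborFinset, List.mem_toFinset] at hv hv'
    exact h v hv.2 ⟨hv.1, hv'.1⟩
  have hd2 : Disjoint ((G.neighborFinset x \ l.toFinset) ∪ (G.neighborFinset y \ l.toFinset))
      l.toFinset := by
    rw [Finset.disjoint_left]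
    intro v hv hv'
    simp only [Finset.mem_union, Finset.mem_sdiff] at hv
    tauto
  have := Finset.card_le_univ (((G.neighborFinset x \ l.toFinset) ∪
    (G.neighborFinset y \ l.toFinset)) ∪ l.toFinset)
  rw [Finset.card_union_of_disjoint hd2, Finset.card_union_of_disjoint hd,
    List.toFinset_card_of_nodup hn] at this
  rw [key x, key y]
  omega

theorem cross {x y : V} {l : List V} {k : ℕ} (h : Pk G.Adj (St G) x y l k) (hn : l.Nodup)
    (hxy : St G x y) : ∃ a b l' k', k' ≤ k ∧ Pk G.Adj (St G) a b l' k' ∧ G.Adj b a ∧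
      l ⊆ l' ∧ l'.Nodup := by
  classical
  by_cases hadj : G.Adj y x
  · exact ⟨x, y, l, k, le_rfl, h, hadj, fun _ h => h, hn⟩
  by_cases hz : ∃ z, z ∉ l ∧ G.Adj x z ∧ G.Adj y z
  · obtain ⟨z, hzl, hxz, hyz⟩ := hz
    refine ⟨x, z, l ++ [z], k, le_rfl, h.append_real hyz (Pk.single z), hxz.symm, by simp, ?_⟩
    rw [List.nodup_append]
    refine ⟨hn, by simp, ?_⟩
    rintro a ha b hb rfl
    simp at hb
    exact hzl (hb ▸ ha)
  have hout := deg_out hn (x := x) (y := y) (fun v hv hh => hz ⟨v, hv, hh⟩)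
  by_cases hc : l.IsChain (fun p q => ¬ (decide (G.Adj y p) = true ∧ decide (G.Adj x q) = true))
  · exfalso
    have := chain_count hc h.ne_nil
    have e1 : l.countP (fun v => decide (G.Adj x v)) = l.tail.countP (fun v => decide (G.Adj x v)) := by
      obtain ⟨t, rfl⟩ := h.head_eq
      simp
    have e2 : l.countP (fun v => decide (G.Adj y v)) =
        l.dropLast.countP (fun v => decide (G.Adj y v)) := by
      obtain ⟨t, rfl⟩ := h.last_eq
      simp
    obtain ⟨_, h1, h2⟩ := hxy
    unfold Hv at h1 h2
    omega
  · obtain ⟨l1, p, q, l2, rfl, hpq⟩ := not_chain hc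
    simp only [decide_eq_true_eq, not_not] at hpq
    have e : l1 ++ p :: q :: l2 = (l1 ++ [p]) ++ (q :: l2) := by simp
    rw [e] at h
    obtain ⟨p', q', i, j, h1, h2, h3⟩ := Pk.split (by simp) (by simp) h
    have ep : p' = p := by
      obtain ⟨t, ht⟩ := h1.last_eq
      have := congrArg List.getLast? ht
      simpa using this.symm
    have eq : q' = q := by
      obtain ⟨t, ht⟩ := h2.head_eq
      simp at ht
      exact ht.1.symm
    subst ep; subst eq
    refine ⟨x, q', _, _, ?_, h1.append_real hpq.1.symm
      (h2.rev (fun _ _ h => SimpleGraph.Adj.symm h) (fun _ _ h => h.symm)), hpq.2.symm, ?_, ?_⟩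
    · omega
    · intro v hv; simp at hv ⊢; tauto
    · refine (List.Perm.nodup_iff ?_).1 hn
      rw [e]
      exact List.Perm.append_left _ (List.reverse_perm _).symm

theorem closureA (k : ℕ) : ∀ {a b : V} {l : List V}, Pk G.Adj (St G) a b l k → l.Nodup →
    G.Adj b a → ∃ a' b' l', RP G a' b' l' ∧ G.Adj b' a' ∧ l'.Nodup ∧ l ⊆ l' := by
  induction k using Nat.strong_induction_on with
  | _ k ih =>
    intro a b l h hn e
    cases k with
    | zero => exact ⟨a, b, l, h, e, hn, fun _ h => h⟩
    | succ k =>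
      obtain ⟨p, q, l1, l2, i, j, rfl, h1, h2, h3, h4⟩ := h.cut_star
      obtain ⟨a', b', l', k', hk, hP, he, hs, hn'⟩ := cross (h2.append_real e h1)
        ((List.perm_append_comm.nodup_iff).1 hn) h3.symm
      obtain ⟨a2, b2, l2', g1, g2, g3, g4⟩ := ih k' (by omega) hP hn' he
      refine ⟨a2, b2, l2', g1, g2, g3, fun v hv => g4 (hs ?_)⟩
      simp at hv ⊢; tauto

theorem closure_cycle {a b : V} {l : List V} (h : SP G a b l) (hn : l.Nodup) (e : AS G b a) :
    ∃ a' b' l', RP G a' b' l' ∧ G.Adj b' a' ∧ l'.Nodup ∧ l ⊆ l' := by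
  obtain ⟨k, h⟩ := h
  rcases e with e | e
  · exact closureA k h hn e
  · obtain ⟨a', b', l', k', hk, hP, he, hs, hn'⟩ := cross h hn e.symm
    obtain ⟨a2, b2, l2', g1, g2, g3, g4⟩ := closureA k' hP hn' he
    exact ⟨a2, b2, l2', g1, g2, g3, fun v hv => g4 (hs hv)⟩

end LemB

section LemA
variable {V : Type} [Fintype V] {G : SimpleGraph V} [DecidableRel G.Adj]

theorem RP.dropg {a b : V} {l : List V} (h : RP G a b l) {m : ℕ} (hm : m < l.length) :
    RP G l[m] b (l.drop m) := by
  rw [List.drop_eq_getElem_cons hm]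
  by_cases h0 : m = 0
  · subst h0
    obtain ⟨t, rfl⟩ := h.head_eq
    simpa using h
  · have e : l = l.take m ++ l[m] :: l.drop (m + 1) := by
      rw [← List.drop_eq_getElem_cons hm, List.take_append_drop]
    have h' := h
    rw [e] at h'
    obtain ⟨p, _, h2, _⟩ := h'.split_cons (by
      intro hh
      rw [List.take_eq_nil_iff] at hh
      rcases hh with hh | hh
      · omega
      · simp [hh] at hm)
    exact h2

theorem RP.takeg {a b : V} {l : List V} (h : RP G a b l) {m : ℕ} (hm : m < l.length) :
    RP G a l[m] (l.take (m + 1)) := by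
  have h' := h.rev.dropg (m := l.length - 1 - m) (by simp; omega)
  have h'' := h'.rev
  have e1 : l.reverse[l.length - 1 - m]'(by simp; omega) = l[m] := by
    simp only [List.getElem_reverse]
    congr 1
    omega
  rw [e1] at h''
  have e2 : (l.reverse.drop (l.length - 1 - m)).reverse = l.take (m + 1) := by
    rw [List.drop_reverse, List.reverse_reverse]
    congr 1
    omega
  rwa [e2] at h''

theorem degree_index {l : List V} (hn : l.Nodup) (hall : ∀ v, v ∈ l) (x : V) :
    G.degree x = ((Finset.range l.length).filter (fun i => G.Adj x (l.getD i x))).card := by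
  classical
  rw [← G.card_neighborFinset_eq_degree]
  symm
  apply Finset.card_bij (fun i _ => l.getD i x)
  · intro i hi
    simp only [Finset.mem_filter] at hi
    simp only [mem_neighborFinset]
    exact hi.2
  · intro i hi j hj hij
    simp only [Finset.mem_filter, Finset.mem_range] at hi hj
    rw [List.getD_eq_getElem _ _ hi.1, List.getD_eq_getElem _ _ hj.1] at hij
    exact (List.Nodup.getElem_inj_iff hn).1 hij
  · intro v hv
    obtain ⟨i, hi, rfl⟩ := List.getElem_of_mem (hall v)
    refine ⟨i, ?_, ?_⟩
    · simp only [Finset.mem_filter, Finset.mem_range]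
      refine ⟨hi, ?_⟩
      rw [List.getD_eq_getElem _ _ hi]
      simpa using hv
    · rw [List.getD_eq_getElem _ _ hi]

theorem len_card {l : List V} (hn : l.Nodup) (hall : ∀ v, v ∈ l) :
    l.length = Fintype.card V := by
  classical
  rw [← List.toFinset_card_of_nodup hn, ← Finset.card_univ]
  congr 1
  ext v
  simp [hall v]

theorem lemA {x y : V} {l : List V} (h : RP G x y l) (hn : l.Nodup) (hall : ∀ v, v ∈ l)
    (e : G.Adj y x) (hx : Hv G x) (hy : Hv G y) : IsPancyclic G := by
  classical
  intro k hk3 hkn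
  by_contra hno
  have hlen := len_card hn hall
  rw [← hlen] at hkn
  set n := l.length with hnl
  have hx0 : l[0]'(by omega) = x := by
    obtain ⟨t, rfl⟩ := h.head_eq
    rfl
  have hy0 : l[n - 1]'(by omega) = y := by
    obtain ⟨t, ht⟩ := h.last_eq
    subst ht
    simp [hnl]
  have c1 : ∀ i j, 1 ≤ i → j + 3 = i + k → (hj : j + 2 ≤ n) → G.Adj x (l.getD i x) →
      ¬ G.Adj y (l.getD j y) := by
    intro i j hi hij hj ha hb
    rw [List.getD_eq_getElem _ _ (by omega)] at ha hb
    have p1 := h.takeg (m := j) (by omega)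
    have p2 := p1.dropg (m := i) (by simp; omega)
    have p3 := (p2.cons (a := x) (by simpa using ha)).snoc hb.symm
    refine hno (p3.hasCycle ?_ hk3 ?_ e)
    · rw [List.cons_append, List.nodup_cons, List.nodup_append]
      refine ⟨?_, ?_, by simp, ?_⟩
      · simp only [List.mem_append, List.mem_singleton, not_or]
        refine ⟨?_, e.ne.symm⟩
        intro hm
        have hm' := List.drop_subset_drop_left (l.take (j+1)) hi hm
        have := List.nodup_iff_getElem?_ne_getElem?.1 hn
        obtain ⟨t, ht⟩ := h.head_eq
        rw [ht] at hm' hn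
        simp at hm' hn
        exact hn.1 (List.mem_of_mem_take hm')
      · exact ((List.drop_sublist _ _).trans (List.take_sublist _ _)).nodup hn
      · rintro v hv w hw rfl
        simp at hw
        subst hw
        have hv' := List.mem_of_mem_drop hv
        obtain ⟨t, ht⟩ := h.last_eq
        have : l.take (j + 1) = t.take (j + 1) := by
          rw [ht, List.take_append_of_le_length]
          have := congrArg List.length ht
          simp at this
          omega
        rw [this] at hv'
        rw [ht, List.nodup_append] at hn
        exact hn.2.2 _ (List.mem_of_mem_take hv') _ (List.mem_singleton.2 rfl) rfl
    · simp
      omega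
  have c2 : ∀ i j, i ≤ n - 1 → j + (n + 1 - k) = i → G.Adj x (l.getD i x) →
      ¬ G.Adj y (l.getD j y) := by
    intro i j hi hij ha hb
    rw [List.getD_eq_getElem _ _ (by omega)] at ha hb
    have p1 := h.takeg (m := j) (by omega)
    have p2 := (h.dropg (m := i) (by omega)).rev
    refine hno ((p1.append hb.symm p2).hasCycle ?_ hk3 ?_ ha.symm)
    · have : (l.take (j + 1) ++ l.drop i).Nodup := by
        have hs : (l.take (j + 1) ++ l.drop i).Sublist l := by
          conv_rhs => rw [← List.take_append_drop (j + 1) l]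
          exact (List.append_sublist_append_left _).2 (List.drop_sublist_drop_left _ (by omega))
        exact hs.nodup hn
      exact ((List.Perm.append_left _ (List.reverse_perm _)).nodup_iff).2 this
    · simp
      omega
  set A := (Finset.range n).filter (fun i => G.Adj x (l.getD i x)) with hA
  set B := (Finset.range n).filter (fun i => G.Adj y (l.getD i y)) with hB
  have dA : G.degree x = A.card := degree_index hn hall x
  have dB : G.degree y = B.card := degree_index hn hall y
  let φ : ℕ → ℕ := fun i => if i ≤ n - k + 1 then i + k - 3 else i - (n + 1 - k)
  have hmem : ∀ i ∈ A.erase 1, 2 ≤ i ∧ i < n ∧ G.Adj x (l.getD i x) := by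
    intro i hi
    simp only [hA, Finset.mem_erase, Finset.mem_filter, Finset.mem_range] at hi
    refine ⟨?_, hi.2⟩
    rcases Nat.eq_zero_or_pos i with rfl | h0
    · exfalso
      have := hi.2.2
      rw [List.getD_eq_getElem _ _ (by omega), hx0] at this
      exact this.ne rfl
    · omega
  have hinj : Set.InjOn φ (A.erase 1) := by
    intro i hi j hj hij
    have h1 := hmem i hi
    have h2 := hmem j hj
    simp only [φ] at hij
    split_ifs at hij <;> omega
  have himg : (A.erase 1).image φ ⊆ (Finset.Ico 1 (n - 1)) \ (B.erase 0) := by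
    intro j hj
    rw [Finset.mem_image] at hj
    obtain ⟨i, hi, rfl⟩ := hj
    have h1 := hmem i hi
    simp only [Finset.mem_sdiff, Finset.mem_Ico, Finset.mem_erase, hB, Finset.mem_filter,
      Finset.mem_range]
    by_cases hc : i ≤ n - k + 1
    · have hφ : φ i = i + k - 3 := if_pos hc
      rw [hφ]
      refine ⟨by omega, fun hh => c1 i (i + k - 3) (by omega) (by omega) (by omega) h1.2.2 hh.2.2⟩
    · have hφ : φ i = i - (n + 1 - k) := if_neg hc
      rw [hφ]
      refine ⟨by omega, fun hh => c2 i _ (by omega) (by omega) h1.2.2 hh.2.2⟩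
  have hBsub : B.erase 0 ⊆ Finset.Ico 1 (n - 1) := by
    intro j hj
    simp only [Finset.mem_erase, hB, Finset.mem_filter, Finset.mem_range] at hj
    rw [Finset.mem_Ico]
    refine ⟨by omega, ?_⟩
    by_contra hjn
    have : j = n - 1 := by omega
    subst this
    have := hj.2.2
    rw [List.getD_eq_getElem _ _ (by omega), hy0] at this
    exact this.ne rfl
  have h1 := Finset.card_le_card himg
  rw [Finset.card_image_of_injOn hinj, Finset.card_sdiff_of_subset hBsub] at h1
  have h2 := Finset.card_le_card hBsub
  have h3 := Finset.pred_card_le_card_erase (s := A) (a := 1)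
  have h4 := Finset.pred_card_le_card_erase (s := B) (a := 0)
  rw [Nat.card_Ico] at h1 h2
  unfold Hv at hx hy
  omega

end LemA

section Ham
variable {V : Type} [Fintype V] {G : SimpleGraph V} [DecidableRel G.Adj]

/-- the list covers all heavy vertices -/
def Cov (G : SimpleGraph V) [DecidableRel G.Adj] (l : List V) : Prop := ∀ v, Hv G v → v ∈ l

/-- a real cycle of length `N` covering the heavy vertices -/
def Cyc (G : SimpleGraph V) [DecidableRel G.Adj] (N : ℕ) (l : List V) : Prop :=
  ∃ a b, RP G a b l ∧ G.Adj b a ∧ l.Nodup ∧ Cov G l ∧ l.length = N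

/-- no cycle of the closure covering the heavy vertices is longer than `N` -/
def Mx (G : SimpleGraph V) [DecidableRel G.Adj] (N : ℕ) : Prop :=
  ∀ a b l, SP G a b l → l.Nodup → AS G b a → Cov G l → l.length ≤ N

theorem Cyc.perm_aux {N : ℕ} {l l' : List V} {a b : V} (h : Cyc G N l) (hp : l.Perm l')
    (h1 : RP G a b l') (h2 : G.Adj b a) : Cyc G N l' := by
  obtain ⟨_, _, _, _, h3, h4, h5⟩ := h
  exact ⟨a, b, h1, h2, hp.nodup_iff.1 h3, fun v hv => hp.mem_iff.1 (h4 v hv),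
    hp.length_eq ▸ h5⟩

theorem Cyc.rot {N : ℕ} {l m : List V} (h : Cyc G N (l ++ m)) : Cyc G N (m ++ l) := by
  by_cases hl : l = []
  · subst hl; simpa using h
  by_cases hm : m = []
  · subst hm; simpa using h
  obtain ⟨a, b, h1, h2, h3⟩ := id h
  obtain ⟨p, q, h4, h5, h6⟩ := h1.split hl hm
  exact h.perm_aux List.perm_append_comm (h5.append h2 h4) h6

theorem Cyc.rev {N : ℕ} {l : List V} (h : Cyc G N l) : Cyc G N l.reverse := by
  obtain ⟨a, b, h1, h2, h3⟩ := id h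
  exact h.perm_aux (List.reverse_perm l).symm h1.rev h2.symm

theorem noLonger {N : ℕ} (hM : Mx G N) {l l' e : List V} {a b : V} (h : Cyc G N l)
    (h1 : SP G a b l') (h2 : AS G b a) (he : e ≠ []) (hen : e.Nodup) (hd : ∀ v ∈ e, v ∉ l)
    (hp : (e ++ l).Perm l') : False := by
  obtain ⟨_, _, _, _, h3, h4, h5⟩ := h
  have hnd : (e ++ l).Nodup := by
    rw [List.nodup_append]
    exact ⟨hen, h3, fun v hv w hw hvw => hd v hv (hvw ▸ hw)⟩
  have := hM a b l' h1 (hp.nodup_iff.1 hnd) h2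
    (fun v hv => hp.mem_iff.1 (List.mem_append_right _ (h4 v hv)))
  have hl := hp.length_eq
  rw [List.length_append] at hl
  have := List.length_pos_iff.2 he
  omega

theorem light_of_notMem {N : ℕ} {l : List V} (h : Cyc G N l) {d : V} (hd : d ∉ l) : ¬ Hv G d := by
  obtain ⟨_, _, _, _, h3, h4, h5⟩ := h
  exact fun hh => hd (h4 d hh)

/-- decomposition at two vertices -/
theorem Cyc.two {N : ℕ} {x1 x2 : V} {S1 S2 : List V} (h : Cyc G N (x1 :: S1 ++ x2 :: S2))
    (n1 : S1 ≠ []) (n2 : S2 ≠ []) : ∃ s1 t1 s2 t2, RP G s1 t1 S1 ∧ RP G s2 t2 S2 ∧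
      G.Adj x1 s1 ∧ G.Adj t1 x2 ∧ G.Adj x2 s2 ∧ G.Adj t2 x1 := by
  obtain ⟨a, b, h1, h2, h3⟩ := id h
  obtain ⟨p, h4, h5, h6⟩ := h1.split_cons (by simp)
  obtain ⟨s1, e1, h7, h8⟩ := h4.tail n1
  obtain ⟨s2, e2, h9, h10⟩ := h5.tail n2
  subst e1
  exact ⟨s1, p, s2, b, h7, h9, h8, h6, h10, h2⟩

theorem ear_nonempty {N : ℕ} (hM : Mx G N) {x1 x2 p q : V} {S1 S2 e : List V}
    (h : Cyc G N (x1 :: S1 ++ x2 :: S2)) (he : RP G p q e) (hen : e.Nodup)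
    (hd : ∀ v ∈ e, v ∉ x1 :: S1 ++ x2 :: S2) (a1 : G.Adj x1 p) (a2 : G.Adj q x2) : S1 ≠ [] := by
  rintro rfl
  obtain ⟨a, b, h1, h2, h3⟩ := id h
  obtain ⟨p', h4, h5, h6⟩ := h1.split_cons (by simp)
  have := h4.head
  subst this
  refine noLonger hM h ((he.append a2 h5).cons a1).sp (Or.inl h2) he.ne_nil hen hd ?_
  classical
  rw [List.perm_iff_count]; intro v
  simp only [List.count_append, List.count_cons, List.count_nil, List.cons_append]
  ring

theorem Cyc.swap {N : ℕ} {x1 x2 : V} {S1 S2 : List V} (h : Cyc G N (x1 :: S1 ++ x2 :: S2)) :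
    Cyc G N (x2 :: S2 ++ x1 :: S1) := h.rot

theorem Cyc.flip {N : ℕ} {x1 x2 : V} {S1 S2 : List V} (h : Cyc G N (x1 :: S1 ++ x2 :: S2)) :
    Cyc G N (x1 :: S2.reverse ++ x2 :: S1.reverse) := by
  have := h.rev
  simp only [List.reverse_append, List.reverse_cons, List.append_assoc] at this
  have h2 := Cyc.rot (l := S2.reverse ++ [x2] ++ S1.reverse) (m := [x1]) (by simpa using this)
  simpa using h2

theorem ear_cross {N : ℕ} (hM : Mx G N) {x1 x2 p q s1 t1 s2 t2 : V} {S1 S2 e : List V}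
    (h : Cyc G N (x1 :: S1 ++ x2 :: S2)) (he : RP G p q e) (hen : e.Nodup)
    (hd : ∀ v ∈ e, v ∉ x1 :: S1 ++ x2 :: S2) (a1 : G.Adj x1 p) (a2 : G.Adj q x2)
    (r1 : RP G s1 t1 S1) (r2 : RP G s2 t2 S2) (b1 : G.Adj t1 x2) (b2 : G.Adj t2 x1) :
    ¬ AS G s1 s2 := by
  intro hs
  refine noLonger hM h (((he.append a2 (r1.rev.cons b1.symm)).cons a1).sp.append hs r2.sp)
    (Or.inl b2) he.ne_nil hen hd ?_
  classical
  rw [List.perm_iff_count]; intro v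
  simp only [List.count_append, List.count_cons, List.count_reverse, List.cons_append]
  ring

theorem ins_one {N : ℕ} (hM : Mx G N) {x s p q : V} {T e : List V} (h : Cyc G N (x :: s :: T))
    (he : RP G p q e) (hen : e.Nodup) (hd : ∀ v ∈ e, v ∉ x :: s :: T) (a1 : G.Adj x p) :
    ¬ AS G q s := by
  intro hs
  obtain ⟨a, b, h1, h2, h3⟩ := id h
  have := h1.head
  subst this
  obtain ⟨s', _, h5, h6⟩ := h1.tail (by simp)
  have := h5.head
  subst this
  refine noLonger hM h ((he.cons a1).sp.append hs h5.sp) (Or.inl h2) he.ne_nil hen hd ?_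
  classical
  rw [List.perm_iff_count]; intro v
  simp only [List.count_append, List.count_cons, List.cons_append]
  ring

theorem ear_long {N : ℕ} (hM : Mx G N) (hP : PathC G) {x s p1 p2 : V} {T : List V}
    (h : Cyc G N (x :: s :: T)) (o1 : p1 ∉ x :: s :: T) (o2 : p2 ∉ x :: s :: T)
    (a1 : G.Adj x p1) (a2 : G.Adj p1 p2) (a3 : ¬ G.Adj x p2) : Hv G s := by
  obtain ⟨a, b, h1, h2, h3⟩ := id h
  obtain ⟨s', e, h5, h6⟩ := h1.tail (by simp)
  have := h5.head
  subst this
  have i1 := ins_one hM h (RP.single p1) (by simp) (by simpa using o1) a1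
  have i2 := ins_one hM h ((RP.single p2).cons a2) (by simpa using a2.ne)
    (by
      intro v hv
      simp only [List.mem_cons, List.not_mem_nil, or_false] at hv
      rcases hv with rfl | rfl
      · exact o1
      · exact o2) a1
  exact ((hP s' x p1 p2 h6.symm a1 a2 (fun hh => i1 (Or.inl hh.symm))
    (fun hh => i2 (Or.inl hh.symm)) a3).1).resolve_right (light_of_notMem h o1)

/-- facts about one outside vertex with two attachments -/
structure Att (G : SimpleGraph V) [DecidableRel G.Adj] (N : ℕ) (d x1 x2 : V) (S1 S2 : List V)
    (s1 t1 s2 t2 : V) : Prop where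
  cyc : Cyc G N (x1 :: S1 ++ x2 :: S2)
  out : d ∉ x1 :: S1 ++ x2 :: S2
  d1 : G.Adj d x1
  d2 : G.Adj d x2
  r1 : RP G s1 t1 S1
  r2 : RP G s2 t2 S2
  b1 : G.Adj x1 s1
  b2 : G.Adj t1 x2
  b3 : G.Adj x2 s2
  b4 : G.Adj t2 x1

theorem Att.swap {N : ℕ} {d x1 x2 s1 t1 s2 t2 : V} {S1 S2 : List V}
    (h : Att G N d x1 x2 S1 S2 s1 t1 s2 t2) : Att G N d x2 x1 S2 S1 s2 t2 s1 t1 :=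
  ⟨h.cyc.swap, fun hh => h.out (by simp at hh ⊢; tauto), h.d2, h.d1, h.r2, h.r1, h.b3, h.b4, h.b1, h.b2⟩

theorem Att.flip {N : ℕ} {d x1 x2 s1 t1 s2 t2 : V} {S1 S2 : List V}
    (h : Att G N d x1 x2 S1 S2 s1 t1 s2 t2) :
    Att G N d x1 x2 S2.reverse S1.reverse t2 s2 t1 s1 :=
  ⟨h.cyc.flip, fun hh => h.out (by simp at hh ⊢; tauto), h.d1, h.d2, h.r2.rev, h.r1.rev, h.b4.symm,
    h.b3.symm, h.b2.symm, h.b1.symm⟩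

theorem att_exists {N : ℕ} (hM : Mx G N) {d x1 x2 : V} {S1 S2 : List V}
    (h : Cyc G N (x1 :: S1 ++ x2 :: S2)) (o : d ∉ x1 :: S1 ++ x2 :: S2) (d1 : G.Adj d x1)
    (d2 : G.Adj d x2) : ∃ s1 t1 s2 t2, Att G N d x1 x2 S1 S2 s1 t1 s2 t2 := by
  have n1 := ear_nonempty hM h (RP.single d) (by simp) (by simpa using o) d1.symm d2
  have n2 := ear_nonempty hM h.swap (RP.single d) (by simp)
    (by intro v hv; simp at hv; subst hv; intro hh; exact o (by simp at hh ⊢; tauto)) d2.symm d1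
  obtain ⟨s1, t1, s2, t2, r1, r2, b1, b2, b3, b4⟩ := h.two n1 n2
  exact ⟨s1, t1, s2, t2, h, o, d1, d2, r1, r2, b1, b2, b3, b4⟩

theorem Att.nd1 {N : ℕ} (hM : Mx G N) {d x1 x2 s1 t1 s2 t2 : V} {S1 S2 : List V}
    (h : Att G N d x1 x2 S1 S2 s1 t1 s2 t2) : ¬ AS G d s1 := by
  obtain ⟨T, hT⟩ := h.r1.head_eq
  have hc := h.cyc
  have ho := h.out
  rw [hT] at hc ho
  exact ins_one hM (T := T ++ x2 :: S2) hc (RP.single d) (by simp) (by simpa using ho) h.d1.symm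

theorem Att.ncross {N : ℕ} (hM : Mx G N) {d x1 x2 s1 t1 s2 t2 : V} {S1 S2 : List V}
    (h : Att G N d x1 x2 S1 S2 s1 t1 s2 t2) : ¬ AS G s1 s2 :=
  ear_cross hM h.cyc (RP.single d) (by simp) (by simpa using h.out) h.d1.symm h.d2 h.r1 h.r2 h.b2
    h.b4

theorem Att.nodup {N : ℕ} {d x1 x2 s1 t1 s2 t2 : V} {S1 S2 : List V}
    (h : Att G N d x1 x2 S1 S2 s1 t1 s2 t2) : (x1 :: S1 ++ x2 :: S2).Nodup := by
  obtain ⟨_, _, _, _, h3, _⟩ := h.cyc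
  exact h3

theorem Att.pm {N : ℕ} (hM : Mx G N) (hC : ClawC G) {d x1 x2 s1 t1 s2 t2 : V} {S1 S2 : List V}
    (h : Att G N d x1 x2 S1 S2 s1 t1 s2 t2) : AS G t2 s1 := by
  have ld := light_of_notMem h.cyc h.out
  have n1 : ¬ AS G d s1 := h.nd1 hM
  have n2 : ¬ AS G d t2 := h.flip.nd1 hM
  by_contra hn
  have hne : t2 ≠ s1 := by
    rintro rfl
    have := h.nodup
    rw [List.nodup_append] at this
    exact this.2.2 t2 (List.mem_cons_of_mem _ h.r1.left_mem) t2
      (List.mem_cons_of_mem _ h.r2.right_mem) rfl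
  have hds : d ≠ s1 := by
    rintro rfl
    exact h.out (by simp [h.r1.left_mem])
  have hdt : d ≠ t2 := by
    rintro rfl
    exact h.out (by simp [h.r2.right_mem])
  have c1 := hC x1 d t2 s1 h.d1.symm h.b4.symm h.b1 hdt hds hne (fun e => n2 (Or.inl e))
    (fun e => n1 (Or.inl e)) (fun e => hn (Or.inl e))
  have c2 := hC x1 d s1 t2 h.d1.symm h.b1 h.b4.symm hds hdt hne.symm (fun e => n1 (Or.inl e))
    (fun e => n2 (Or.inl e)) (fun e => hn (Or.inl e.symm))
  exact hn (Or.inr ⟨hne, c1.resolve_left ld, c2.resolve_left ld⟩)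

theorem Att.four {N : ℕ} (hM : Mx G N) (hC : ClawC G) {d x1 x2 s1 t1 s2 t2 : V} {S1 S2 : List V}
    (h : Att G N d x1 x2 S1 S2 s1 t1 s2 t2) : ¬ AS G s1 x2 := by
  intro hs
  have h3 := h.swap.pm hM hC
  refine noLonger hM (e := [d]) h.cyc (SP.cons (Or.inl h.d2) (SP.cons hs.symm
    (h.r1.sp.append h3 (h.r2.sp.snoc (Or.inl h.b4))))) (Or.inl h.d1.symm) (by simp) (by simp)
    (by simpa using h.out) ?_
  classical
  rw [List.perm_iff_count]; intro v
  simp only [List.count_append, List.count_cons, List.cons_append, List.count_nil]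
  ring

theorem Att.adj {N : ℕ} (hM : Mx G N) (hC : ClawC G) (hP : PathC G) {d x1 x2 s1 t1 s2 t2 : V}
    {S1 S2 : List V} (h : Att G N d x1 x2 S1 S2 s1 t1 s2 t2) : G.Adj x1 x2 := by
  by_contra hn
  have ld := light_of_notMem h.cyc h.out
  have f1 := h.four hM hC
  have f2 := h.swap.four hM hC
  have n1 := h.nd1 hM
  have n2 := h.swap.nd1 hM
  have g1 := hP s1 x1 d x2 h.b1.symm h.d1.symm h.d2 (fun e => n1 (Or.inl e.symm))
    (fun e => f1 (Or.inl e)) hn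
  have g2 := hP s2 x2 d x1 h.b3.symm h.d2.symm h.d1 (fun e => n2 (Or.inl e.symm))
    (fun e => f2 (Or.inl e)) (fun e => hn e.symm)
  refine h.ncross hM (Or.inr ⟨?_, g1.1.resolve_right ld, g2.1.resolve_right ld⟩)
  rintro rfl
  exact f2 (Or.inl h.b1.symm)

theorem Att.pairA {N : ℕ} (hM : Mx G N) (hC : ClawC G) (hP : PathC G) {d x1 x2 s1 t1 s2 t2 : V}
    {S1 S2 : List V} (h : Att G N d x1 x2 S1 S2 s1 t1 s2 t2) :
    (Hv G s1 ∨ Hv G x2) ∧ (Hv G x1 ∨ Hv G s2) ∧ ¬ (Hv G s1 ∧ Hv G s2) ∧ ¬ (Hv G s1 ∧ Hv G x2) ∧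
      ¬ (Hv G x1 ∧ Hv G s2) := by
  have f1 := h.four hM hC
  have f2 := h.swap.four hM hC
  have f3 := h.ncross hM
  have ha := h.adj hM hC hP
  have g := hP s1 x1 x2 s2 h.b1.symm ha h.b3 (fun e => f1 (Or.inl e)) (fun e => f3 (Or.inl e))
    (fun e => f2 (Or.inl e.symm))
  have ne1 : s1 ≠ s2 := by rintro rfl; exact f2 (Or.inl h.b1.symm)
  have ne2 : s1 ≠ x2 := by rintro rfl; exact f3 (Or.inl h.b3)
  have ne3 : s2 ≠ x1 := by rintro rfl; exact f3 (Or.inl h.b1.symm)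
  exact ⟨g.1, g.2, fun e => f3 (Or.inr ⟨ne1, e⟩), fun e => f1 (Or.inr ⟨ne2, e⟩),
    fun e => f2 (Or.inr ⟨ne3, e.2, e.1⟩)⟩

theorem run_adj {s t d z : V} {L : List V} (hP : PathC G) (h : RP G s t L) (hd : ¬ Hv G d)
    (hdz : G.Adj d z) : G.Adj z s → (∀ v ∈ L, ¬ Hv G v ∧ ¬ G.Adj d v) →
    (∀ v ∈ L, v ≠ z) → G.Adj z t := by
  unfold RP at h
  generalize hk : 0 = k at h
  induction h with
  | single a => exact fun h _ _ => h
  | @real a b c l k e h ih =>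
    intro hz hL hne
    have hb : b ∈ l := h.left_mem
    refine ih hk ?_ (fun v hv => hL v (List.mem_cons_of_mem _ hv))
      (fun v hv => hne v (List.mem_cons_of_mem _ hv))
    by_contra hn
    have := (hP d z a b hdz hz e (hL a (by simp)).2 (hL b (by simp [hb])).2 hn).1
    rcases this with h1 | h1
    · exact hd h1
    · exact (hL a (by simp)).1 h1
  | star => omega

theorem Att.final {N : ℕ} (hM : Mx G N) (hC : ClawC G) (hP : PathC G) {d z z' s1 t1 s2 t2 : V}
    {S1 S2 : List V} (h : Att G N d z z' S1 S2 s1 t1 s2 t2) (hz' : Hv G z') (hs1 : ¬ Hv G s1) :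
    False := by
  have ld := light_of_notMem h.cyc h.out
  have hnd := h.nodup
  have key : ∀ v ∈ S1, ¬ Hv G v → ¬ G.Adj d v := by
    intro v hv hl hdv
    obtain ⟨T1, T2, rfl⟩ := List.append_of_mem hv
    have hc : Cyc G N (z :: T1 ++ v :: (T2 ++ z' :: S2)) := by simpa using h.cyc
    obtain ⟨s1', t1', s2', t2', h'⟩ := att_exists hM hc (by simpa using h.out) h.d1 hdv
    have e : s1' = s1 := by
      obtain ⟨t, ht⟩ := h'.r1.head_eq
      obtain ⟨t', ht'⟩ := h.r1.head_eq
      rw [ht] at ht'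
      simp at ht'
      exact ht'.1
    have := (h'.pairA hM hC hP).1
    rw [e] at this
    tauto
  obtain ⟨L, y, M, hL, hy, hlight⟩ := exists_first (p := fun v => Hv G v) (l := S1 ++ [z'])
    ⟨z', by simp, hz'⟩
  have hLne : L ≠ [] := by
    rintro rfl
    obtain ⟨t, rfl⟩ := h.r1.head_eq
    simp at hL
    exact hs1 (hL.1 ▸ hy)
  have hzS : ∀ v ∈ S1, v ≠ z := by
    rintro v hv rfl
    simp at hnd
    tauto
  rcases List.eq_nil_or_concat M with rfl | ⟨M', m, hM'⟩
  ·
    have := List.append_inj' hL (by simp)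
    obtain ⟨rfl, e⟩ := this
    have := run_adj hP h.r1 ld h.d1 h.b1 (fun v hv => ⟨hlight v hv, key v hv (hlight v hv)⟩) hzS
    exact h.flip.swap.four hM hC (Or.inl this.symm)
  · rw [hM'] at hL
    have : S1 ++ [z'] = (L ++ y :: M') ++ [m] := by rw [hL]; simp
    obtain ⟨rfl, e⟩ := List.append_inj' this (by simp)
    obtain ⟨q, g1, g2, g3⟩ := h.r1.split_cons hLne
    have hq := run_adj hP g1 ld h.d1 h.b1
      (fun v hv => ⟨hlight v hv, key v (by simp [hv]) (hlight v hv)⟩)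
      (fun v hv => hzS v (by simp [hv]))
    have h3 := h.pm hM hC
    have h4 := h.swap.pm hM hC
    have hyz : St G z' y := by
      refine ⟨?_, hz', hy⟩
      rintro rfl
      simp [List.nodup_append] at hnd
    refine noLonger hM (e := [d]) h.cyc (g1.sp.append (Or.inl hq.symm) (SP.cons (Or.inl h.d1.symm)
      (SP.cons (Or.inl h.d2) (SP.cons (Or.inr hyz) (g2.sp.append h4 h.r2.sp)))))
      h3 (by simp) (by simp)
      (by simpa using h.out) ?_
    classical
    rw [List.perm_iff_count]; intro v
    simp only [List.count_append, List.count_cons, List.cons_append, List.count_nil]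
    ring

end Ham

section Ham2
variable {V : Type} [Fintype V] {G : SimpleGraph V} [DecidableRel G.Adj]

theorem path_avoid (h2 : TwoConnected G) {a b c : V} (ha : a ≠ c) (hb : b ≠ c) :
    ∃ l, RP G a b l ∧ l.Nodup ∧ c ∉ l := by
  classical
  have hcon := (h2.2 c).preconnected ⟨a, ha⟩ ⟨b, hb⟩
  obtain ⟨p, hp⟩ := hcon.exists_isPath
  refine ⟨p.support.map (fun v => v.1), ?_, ?_, ?_⟩
  · have := RP.of_walk (p.map (Embedding.induce {u : V | u ≠ c}).toHom)
    rw [Walk.support_map] at this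
    exact this
  · exact hp.support_nodup.map Subtype.val_injective
  · simp

theorem heavy_list : ∀ (rest : List V) (y : V), (∀ v ∈ y :: rest, Hv G v) → (y :: rest).Nodup →
    ∃ b, b ∈ y :: rest ∧ SP G y b (y :: rest) := by
  intro rest
  induction rest with
  | nil => intro y _ _; exact ⟨y, by simp, (RP.single y).sp⟩
  | cons z rest ih =>
    intro y hh hn
    rw [List.nodup_cons] at hn
    obtain ⟨b, hb, hs⟩ := ih z (fun v hv => hh v (List.mem_cons_of_mem _ hv)) hn.2
    refine ⟨b, List.mem_cons_of_mem _ hb, hs.cons (Or.inr ⟨?_, hh y (by simp), hh z (by simp)⟩)⟩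
    rintro rfl
    exact hn.1 (by simp)

theorem exists_third (h : 3 ≤ Fintype.card V) (a b : V) : ∃ c, c ≠ a ∧ c ≠ b := by
  classical
  by_contra hn
  push Not at hn
  have : (Finset.univ : Finset V) ⊆ {a, b} := by
    intro c _
    by_cases hc : c = a
    · simp [hc]
    · simp [hn c hc]
  have := Finset.card_le_card this
  rw [Finset.card_univ] at this
  have := Finset.card_le_two (a := a) (b := b)
  omega

theorem nbr_avoid (h2 : TwoConnected G) {x c y : V} (hx : x ≠ c) (hy : y ≠ c) (hxy : x ≠ y) :
    ∃ a, G.Adj x a ∧ a ≠ c := by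
  obtain ⟨l, h, hn, hc⟩ := path_avoid h2 hx hy
  obtain ⟨t, rfl⟩ := h.head_eq
  by_cases ht : t = []
  · subst ht
    obtain ⟨t', ht'⟩ := h.last_eq
    cases t' <;> simp at ht'
    exact absurd ht' hxy
  · obtain ⟨q, _, h1, h2⟩ := h.tail ht
    refine ⟨q, h2, ?_⟩
    rintro rfl
    exact hc (List.mem_cons_of_mem _ h1.left_mem)

theorem cycle_through (h2 : TwoConnected G) (x : V) :
    ∃ a b l, RP G a b l ∧ G.Adj b a ∧ l.Nodup ∧ 3 ≤ l.length ∧ x ∈ l := by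
  obtain ⟨c, hc, _⟩ := exists_third h2.1 x x
  obtain ⟨y, hy1, hy2⟩ := exists_third h2.1 x c
  obtain ⟨a, ha, _⟩ := nbr_avoid h2 hc.symm hy2 hy1.symm
  obtain ⟨y', hy1', hy2'⟩ := exists_third h2.1 x a
  obtain ⟨b, hb, hba⟩ := nbr_avoid h2 ha.ne hy2' hy1'.symm
  obtain ⟨l, h, hn, hx⟩ := path_avoid h2 ha.ne.symm hb.ne.symm
  refine ⟨x, b, x :: l, h.cons ha, hb.symm, List.nodup_cons.2 ⟨hx, hn⟩, ?_, by simp⟩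
  obtain ⟨t, rfl⟩ := h.head_eq
  cases t with
  | nil =>
    exfalso
    have := h.right_mem
    simp at this
    exact hba this
  | cons z t => simp

theorem nodup_subset_length {l l' : List V} (h : l.Nodup) (hs : l ⊆ l') : l.length ≤ l'.length :=
  (h.subperm hs).length_le

theorem init_cycle (h2 : TwoConnected G) :
    ∃ a b l, RP G a b l ∧ G.Adj b a ∧ l.Nodup ∧ 3 ≤ l.length ∧ Cov G l := by
  classical
  by_cases hxy : ∃ x y, x ≠ y ∧ Hv G x ∧ Hv G y
  · obtain ⟨x, y, hne, hx, hy⟩ := hxy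
    have hz : ∃ z, z ∉ [x, y] ∧ G.Adj x z ∧ G.Adj y z := by
      by_contra hn
      have := deg_out (l := [x, y]) (by simpa using hne) (x := x) (y := y)
        (fun v hv hh => hn ⟨v, hv, hh⟩)
      simp only [List.length_cons, List.length_nil, List.countP_cons, List.countP_nil] at this
      unfold Hv at hx hy
      have e1 : decide (G.Adj x x) = false := by simp
      have e2 : decide (G.Adj y y) = false := by simp
      rw [e1, e2] at this
      simp only [Bool.false_eq_true, if_false] at this
      split_ifs at this <;> omega
    obtain ⟨z, hz, hxz, hyz⟩ := hz
    simp only [List.mem_cons, List.not_mem_nil, or_false, not_or] at hz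
    set rest := ((Finset.univ.filter (fun v => Hv G v)) \ {x, y, z}).toList with hrest
    have hr : ∀ v, v ∈ rest ↔ Hv G v ∧ v ≠ x ∧ v ≠ y ∧ v ≠ z := by
      intro v; simp [hrest]
    have hrn : rest.Nodup := Finset.nodup_toList _
    have hyn : (y :: rest).Nodup := by
      rw [List.nodup_cons]
      exact ⟨fun h => ((hr y).1 h).2.2.1 rfl, hrn⟩
    have hheavy : ∀ v ∈ y :: rest, Hv G v := by
      intro v hv
      rcases List.mem_cons.1 hv with rfl | hv
      · exact hy
      · exact ((hr v).1 hv).1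
    obtain ⟨b, hb, hs⟩ := heavy_list rest y hheavy hyn
    have hxn : x ∉ y :: rest := by
      intro h
      rcases List.mem_cons.1 h with h | h
      · exact hne h
      · exact ((hr x).1 h).2.1 rfl
    have hzn : z ∉ y :: rest := by
      intro h
      rcases List.mem_cons.1 h with h | h
      · exact hz.2 h
      · exact ((hr z).1 h).2.2.2 rfl
    have hnn : (x :: z :: y :: rest).Nodup := by
      rw [List.nodup_cons, List.nodup_cons]
      refine ⟨?_, hzn, hyn⟩
      intro h
      rcases List.mem_cons.1 h with h | h
      · exact hz.1 h.symm
      · exact hxn h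
    have hbx : b ≠ x := by rintro rfl; exact hxn hb
    obtain ⟨a', b', l', g1, g2, g3, g4⟩ := closure_cycle
      (SP.cons (Or.inl hxz) (SP.cons (Or.inl hyz.symm) hs)) hnn (Or.inr ⟨hbx, hheavy b hb, hx⟩)
    refine ⟨a', b', l', g1, g2, g3, ?_, ?_⟩
    · have := nodup_subset_length hnn g4
      simp at this
      omega
    · intro v hv
      apply g4
      simp only [List.mem_cons, hr]
      by_cases h1 : v = x
      · exact Or.inl h1
      by_cases h3 : v = y
      · tauto
      by_cases h4 : v = z
      · tauto
      tauto
  · have hcard := h2.1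
    obtain ⟨x0⟩ : Nonempty V := Fintype.card_pos_iff.1 (by omega)
    have hx : ∃ x, ∀ v, Hv G v → v = x := by
      by_cases h : ∃ x, Hv G x
      · obtain ⟨x, hx⟩ := h
        refine ⟨x, fun v hv => ?_⟩
        by_contra hne
        exact hxy ⟨v, x, hne, hv, hx⟩
      · exact ⟨x0, fun v hv => absurd ⟨v, hv⟩ h⟩
    obtain ⟨x, hx⟩ := hx
    obtain ⟨a, b, l, g1, g2, g3, g4, g5⟩ := cycle_through h2 x
    exact ⟨a, b, l, g1, g2, g3, g4, fun v hv => hx v hv ▸ g5⟩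

theorem max_cycle (h2 : TwoConnected G) : ∃ N l, 3 ≤ N ∧ Cyc G N l ∧ Mx G N := by
  classical
  obtain ⟨a, b, l, g1, g2, g3, g4, g5⟩ := init_cycle h2
  let P : ℕ → Prop := fun N => 3 ≤ N ∧ ∃ l, Cyc G N l
  have hbound : ∀ l : List V, l.Nodup → l.length ≤ Fintype.card V := fun l hl => hl.length_le_card
  have hP : P l.length := ⟨g4, l, a, b, g1, g2, g3, g5, rfl⟩
  have hs := Nat.findGreatest_spec (P := P) (hbound l g3) hP
  obtain ⟨h3, l0, hl0⟩ := hs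
  refine ⟨_, l0, h3, hl0, ?_⟩
  intro a' b' l' k1 k2 k3 k4
  obtain ⟨a2, b2, l2, m1, m2, m3, m4⟩ := closure_cycle k1 k2 k3
  have hle := nodup_subset_length k2 m4
  by_contra hlt
  push Not at hlt
  have : P l2.length := ⟨by omega, l2, a2, b2, m1, m2, m3, fun v hv => m4 (k4 v hv), rfl⟩
  have := Nat.le_findGreatest (hbound l2 m3) this
  omega

/-- first entry of a path into a set -/
theorem first_entry {a b : V} {P : V → Prop} {l : List V} (h : RP G a b l) (hn : l.Nodup) (ha : ¬ P a)
    (hb : P b) : ∃ q x l1, RP G a q l1 ∧ l1.Nodup ∧ (∀ v ∈ l1, ¬ P v) ∧ G.Adj q x ∧ P x ∧ x ∈ l := by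
  obtain ⟨l1, x, l2, rfl, hx, h1⟩ := exists_first (p := P) ⟨b, h.right_mem, hb⟩
  have hne : l1 ≠ [] := by
    rintro rfl
    have := h.head
    subst this
    exact ha hx
  obtain ⟨q, h3, h4, h5⟩ := h.split_cons hne
  exact ⟨q, x, l1, h3, (List.sublist_append_left _ _).nodup hn, h1, h5, hx, by simp⟩

/-- an ear of the vertex set of `l` -/
def Ear (G : SimpleGraph V) [DecidableRel G.Adj] (l : List V) (m : ℕ) : Prop :=
  ∃ x1 x2 p q e, x1 ∈ l ∧ x2 ∈ l ∧ x1 ≠ x2 ∧ RP G p q e ∧ e.Nodup ∧ (∀ v ∈ e, v ∉ l) ∧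
    G.Adj x1 p ∧ G.Adj q x2 ∧ e.length = m

theorem ear_exists (h2 : TwoConnected G) {l : List V} (hl : l.Nodup) (h3 : 3 ≤ l.length) {d : V}
    (hd : d ∉ l) : ∃ m, Ear G l m := by
  obtain ⟨x, y, z, l', rfl⟩ : ∃ x y z l', l = x :: y :: z :: l' := by
    match l, h3 with
    | x :: y :: z :: l', _ => exact ⟨x, y, z, l', rfl⟩
  have hxy : x ≠ y := by rintro rfl; simp at hl
  obtain ⟨l0, h0, hn0, _⟩ := path_avoid h2 (a := d) (b := x) (c := y) (by rintro rfl; simp at hd) hxy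
  obtain ⟨p, x1, _, g1, _, g3, g4, g5, _⟩ := first_entry (P := fun v => v ∈ x :: y :: z :: l') h0 hn0
    hd (by simp)
  have hp : p ∉ x :: y :: z :: l' := g3 p g1.right_mem
  obtain ⟨w, hw, hwx⟩ : ∃ w ∈ x :: y :: z :: l', w ≠ x1 := by
    by_cases h : x = x1
    · exact ⟨y, by simp, fun hh => hxy (h.trans hh.symm)⟩
    · exact ⟨x, by simp, h⟩
  obtain ⟨l2, k1, k2, k3⟩ := path_avoid h2 (a := p) (b := w) (c := x1) g4.ne hwx
  obtain ⟨q, x2, e, m1, m2, m3, m4, m5, m6⟩ := first_entry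
    (P := fun v => v ∈ x :: y :: z :: l') k1 k2 hp hw
  exact ⟨e.length, x1, x2, p, q, e, g5, m5, by rintro rfl; exact k3 m6, m1, m2, m3, g4.symm, m4, rfl⟩

theorem Cyc.at_two {N : ℕ} {l : List V} (h : Cyc G N l) {x1 x2 : V} (h1 : x1 ∈ l) (h2 : x2 ∈ l)
    (hne : x1 ≠ x2) : ∃ S1 S2, Cyc G N (x1 :: S1 ++ x2 :: S2) ∧
      ∀ v, v ∈ x1 :: S1 ++ x2 :: S2 ↔ v ∈ l := by
  obtain ⟨A, B, rfl⟩ := List.append_of_mem h1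
  have h' := h.rot
  have hm : x2 ∈ B ++ A := by
    simp at h2 ⊢
    rcases h2 with h2 | h2 | h2
    · exact Or.inr h2
    · exact absurd h2.symm hne
    · exact Or.inl h2
  obtain ⟨S1, S2, e⟩ := List.append_of_mem hm
  refine ⟨S1, S2, ?_, ?_⟩
  · have : x1 :: S1 ++ x2 :: S2 = x1 :: B ++ A := by simp [e]
    rw [this]; exact h'
  · intro v
    have : v ∈ x1 :: (B ++ A) ↔ v ∈ A ++ x1 :: B := by simp; tauto
    rw [← this, e]
    simp

theorem hamiltonian (h2 : TwoConnected G) (hC : ClawC G) (hP : PathC G) :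
    ∃ a b l, RP G a b l ∧ G.Adj b a ∧ l.Nodup ∧ ∀ v, v ∈ l := by
  classical
  obtain ⟨N, l, h3, hc, hM⟩ := max_cycle h2
  obtain ⟨a, b, g1, g2, g3, g4, g5⟩ := id hc
  by_cases hall : ∀ v, v ∈ l
  · exact ⟨a, b, l, g1, g2, g3, hall⟩
  exfalso
  push Not at hall
  obtain ⟨d0, hd0⟩ := hall
  have hear := ear_exists h2 g3 (by omega) hd0
  obtain ⟨x1, x2, p, q, e, hx1, hx2, hne, he, hen, hout, a1, a2, hlen⟩ := Nat.find_spec hear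
  have hmin : ∀ m, Ear G l m → e.length ≤ m := by
    intro m hm
    rw [hlen]
    exact Nat.find_min' hear hm
  obtain ⟨S1, S2, hcyc, hmem⟩ := hc.at_two hx1 hx2 hne
  have hout' : ∀ v ∈ e, v ∉ x1 :: S1 ++ x2 :: S2 := fun v hv hh => hout v hv ((hmem v).1 hh)
  by_cases hone : e.length = 1
  ·
    obtain ⟨d, rfl⟩ := List.length_eq_one_iff.1 hone
    have := he.head; subst this
    have := he.right_mem
    simp at this; subst this
    obtain ⟨s1, t1, s2, t2, h⟩ := att_exists hM hcyc (hout' _ (by simp)) a1.symm a2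
    have hp := h.pairA hM hC hP
    by_cases hs : Hv G s1
    · exact h.swap.final hM hC hP (by tauto) (by tauto)
    · exact h.final hM hC hP (by tauto) hs
  ·
    have heavy : ∀ x1 x2 p q e S1 S2, Cyc G N (x1 :: S1 ++ x2 :: S2) →
        (∀ v, v ∈ x1 :: S1 ++ x2 :: S2 ↔ v ∈ l) → RP G p q e → e.Nodup → (∀ v ∈ e, v ∉ l) →
        G.Adj x1 p → G.Adj q x2 → x1 ≠ x2 → (∀ m, Ear G l m → e.length ≤ m) → e.length ≠ 1 →
        ∀ s1 t1, RP G s1 t1 S1 → Hv G s1 := by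
      intro x1 x2 p q e S1 S2 hcyc hmem he hen hout a1 a2 hne hmin hone s1 t1 hr
      obtain ⟨e', rfl⟩ := he.head_eq
      have he' : e' ≠ [] := by
        rintro rfl
        simp at hone
      obtain ⟨p2, _, k1, k2⟩ := he.tail he'
      obtain ⟨e'', rfl⟩ := k1.head_eq
      obtain ⟨T, rfl⟩ := hr.head_eq
      refine ear_long hM hP (T := T ++ x2 :: S2) (p1 := p) (p2 := p2) (by simpa using hcyc)
        ?_ ?_ a1 k2 ?_
      · have := hout p (by simp)
        rw [← hmem] at this
        simpa using this
      · have := hout p2 (by simp)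
        rw [← hmem] at this
        simpa using this
      · intro hh
        have hx1 : x1 ∈ l := (hmem x1).1 (by simp)
        have hx2 : x2 ∈ l := (hmem x2).1 (by simp)
        have := hmin _ ⟨x1, x2, p2, q, _, hx1, hx2, hne, k1, (List.nodup_cons.1 hen).2,
          fun v hv => hout v (List.mem_cons_of_mem _ hv), hh, a2, rfl⟩
        simp at this
    have n1 := ear_nonempty hM hcyc he hen hout' a1 a2
    have n2 := ear_nonempty hM hcyc.swap he.rev (List.nodup_reverse.2 hen)
      (fun v hv hh => hout' v (by simpa using hv) (by simp at hh ⊢; tauto)) a2.symm a1.symm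
    obtain ⟨s1, t1, s2, t2, r1, r2, b1, b2, b3, b4⟩ := hcyc.two n1 n2
    have hh1 := heavy x1 x2 p q e S1 S2 hcyc hmem he hen hout a1 a2 hne hmin hone s1 t1 r1
    have hh2 := heavy x2 x1 q p e.reverse S2 S1 hcyc.swap
      (fun v => by rw [← hmem v]; simp; tauto) he.rev (List.nodup_reverse.2 hen)
      (fun v hv => hout v (by simpa using hv)) a2.symm a1.symm hne.symm
      (by simpa using hmin) (by simpa using hone) s2 t2 r2
    have hnc := ear_cross hM hcyc he hen hout' a1 a2 r1 r2 b2 b4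
    refine hnc (Or.inr ⟨?_, hh1, hh2⟩)
    rintro rfl
    obtain ⟨_, _, _, _, hnd, _⟩ := hcyc
    rw [List.nodup_append] at hnd
    exact hnd.2.2 s1 (List.mem_cons_of_mem _ r1.left_mem) s1 (List.mem_cons_of_mem _ r2.left_mem) rfl

end Ham2

section Bad
variable {V : Type} [Fintype V] {G : SimpleGraph V} [DecidableRel G.Adj]

/-- Hamilton cycle as a list -/
def Hm (G : SimpleGraph V) [DecidableRel G.Adj] (a b : V) (l : List V) : Prop :=
  RP G a b l ∧ G.Adj b a ∧ l.Nodup ∧ ∀ v, v ∈ l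

theorem Hm.perm {a b a' b' : V} {l l' : List V} (h : Hm G a b l) (h1 : RP G a' b' l')
    (h2 : G.Adj b' a') (hp : l.Perm l') : Hm G a' b' l' :=
  ⟨h1, h2, hp.nodup_iff.1 h.2.2.1, fun v => hp.mem_iff.1 (h.2.2.2 v)⟩

theorem Hm.rot {a b : V} {l m : List V} (h : Hm G a b (l ++ m)) (hl : l ≠ []) (hm : m ≠ []) :
    ∃ p q, RP G a p l ∧ RP G q b m ∧ G.Adj p q ∧ Hm G q p (m ++ l) := by
  obtain ⟨p, q, h1, h2, h3⟩ := h.1.split hl hm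
  exact ⟨p, q, h1, h2, h3, h.perm (h2.append h.2.1 h1) h3 List.perm_append_comm⟩

/-- no Hamilton cycle has two consecutive heavy vertices -/
def NC (G : SimpleGraph V) [DecidableRel G.Adj] : Prop :=
  ∀ a b l, Hm G a b l → ¬ (Hv G a ∧ Hv G b)

theorem nc_of (h : ¬ IsPancyclic G) : NC G :=
  fun _ _ _ hl hh => h (lemA hl.1 hl.2.2.1 hl.2.2.2 hl.2.1 hh.1 hh.2)

theorem Hm.nohh (hN : NC G) {a b p q : V} {l m : List V} (h : Hm G a b (l ++ p :: q :: m)) :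
    ¬ (Hv G p ∧ Hv G q) := by
  have h' : Hm G a b ((l ++ [p]) ++ (q :: m)) := by simpa using h
  obtain ⟨p', q', h1, h2, h3, h4⟩ := h'.rot (by simp) (by simp)
  have e1 := h1.last
  have e2 := h2.head
  subst e1; subst e2
  exact fun hh => hN _ _ _ h4 ⟨hh.2, hh.1⟩

/-- rotate a Hamilton cycle so that it starts at `x` -/
theorem Hm.start {a b : V} {l : List V} (h : Hm G a b l) (x : V) :
    ∃ b' T, Hm G x b' (x :: T) := by
  obtain ⟨A, B, rfl⟩ := List.append_of_mem (h.2.2.2 x)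
  by_cases hA : A = []
  · subst hA
    have := h.1.head
    subst this
    exact ⟨b, B, h⟩
  · obtain ⟨p, q, h1, h2, h3, h4⟩ := h.rot hA (by simp)
    have := h2.head
    subst this
    exact ⟨p, B ++ A, h4⟩

theorem Hm.crossing {a b u e0 : V} {l : List V} (h : Hm G a b l) (R : V → Prop) (hu : ¬ R u)
    (he : R e0) : ∃ a' b' l1 t e l2, Hm G a' b' (l1 ++ t :: e :: l2) ∧ ¬ R t ∧ R e := by
  obtain ⟨b', T, h'⟩ := h.start u
  have key : ∀ (T : List V) (u : V), ¬ R u → (u :: T).IsChain (fun p q => ¬ R p → ¬ R q) →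
      ∀ v ∈ u :: T, ¬ R v := by
    intro T
    induction T with
    | nil => intro u hu _ v hv; simp at hv; exact hv ▸ hu
    | cons z T ih =>
      intro u hu hc v hv
      rw [List.isChain_cons_cons] at hc
      rcases List.mem_cons.1 hv with rfl | hv
      · exact hu
      · exact ih z (hc.1 hu) hc.2 v hv
  by_cases hc : (u :: T).IsChain (fun p q => ¬ R p → ¬ R q)
  · exact absurd he (key T u hu hc e0 (h'.2.2.2 e0))
  · obtain ⟨l1, p, q, l2, e, hr⟩ := not_chain hc
    rw [e] at h'
    push Not at hr
    exact ⟨_, _, l1, p, q, l2, h', hr.1, hr.2⟩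

theorem almost_univ {a b w w' : V} {l : List V} (h : Hm G a b l)
    (hw : ∀ z, z ≠ w → z ≠ w' → G.Adj w z)
    (hn : 5 ≤ Fintype.card V ∨ ∀ z, z ≠ w → G.Adj w z) : IsPancyclic G := by
  intro k hk3 hkn
  obtain ⟨b', T, h'⟩ := h.start w
  obtain ⟨h1, h2, h3, h4⟩ := h'
  have hlen := len_card h3 h4
  have hlen' := hlen
  rw [List.length_cons] at hlen'
  by_cases hkk : k = Fintype.card V
  · exact h1.hasCycle h3 hk3 (by rw [hlen, hkk]) h2
  have hT : T ≠ [] := by rintro rfl; simp at hlen'; omega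
  obtain ⟨q, _, r1, r2⟩ := h1.tail hT
  have hwT := (List.nodup_cons.1 h3).1
  have hTn := (List.nodup_cons.1 h3).2
  have main : ∀ i, (hi : i + (k - 2) < T.length) → G.Adj w (T[i]'(by omega)) →
      G.Adj w (T[i + (k - 2)]) → HasCycleLength G k := by
    intro i hi a1 a2
    have p1 := r1.takeg (m := i + (k - 2)) hi
    have p2 := p1.dropg (m := i) (by simp; omega)
    have e : (T.take (i + (k - 2) + 1))[i]'(by simp; omega) = T[i]'(by omega) := by simp
    rw [e] at p2
    refine (p2.cons a1).hasCycle ?_ hk3 ?_ a2.symm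
    · rw [List.nodup_cons]
      exact ⟨fun hh => hwT (List.mem_of_mem_take (List.mem_of_mem_drop hh)),
        ((List.drop_sublist _ _).trans (List.take_sublist _ _)).nodup hTn⟩
    · simp
      omega
  have neW : ∀ i, (hi : i < T.length) → T[i] ≠ w := by
    intro i hi hh
    exact hwT (hh ▸ List.getElem_mem hi)
  rcases hn with hn | hn
  · by_contra hno
    have bad : ∀ i, (hi : i + (k - 2) < T.length) → (T[i]'(by omega)) = w' ∨
        T[i + (k - 2)] = w' := by
      intro i hi
      by_contra hb
      push Not at hb
      exact hno (main i hi (hw _ (neW _ _) hb.1) (hw _ (neW _ _) hb.2))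
    have inj : ∀ i j, (hi : i < T.length) → (hj : j < T.length) → T[i] = w' → T[j] = w' → i = j := by
      intro i j hi hj e1 e2
      exact (List.Nodup.getElem_inj_iff hTn).1 (e1.trans e2.symm)
    have b0 := bad 0 (by omega)
    have b1 := bad 1 (by omega)
    have hk : k = 3 ∧ T[1]'(by omega) = w' := by
      rcases b0 with b0 | b0 <;> rcases b1 with b1 | b1
      · have := inj _ _ _ _ b0 b1; omega
      · have := inj _ _ _ _ b0 b1; omega
      · have := inj _ _ _ _ b0 b1
        exact ⟨by omega, b1⟩
      · have := inj _ _ _ _ b0 b1; omega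
    obtain ⟨rfl, hk1⟩ := hk
    rcases bad 2 (by omega) with b2 | b2
    · have := inj _ _ _ _ hk1 b2; omega
    · have := inj _ _ _ _ hk1 b2; omega
  · exact main 0 (by omega) (hn _ (neW _ _)) (hn _ (neW _ _))

theorem bad_empty (hcon : G.Connected) (hnc : ¬ IsCycleGraph G) (hP : PathC G) {a b : V} {l : List V}
    (h : Hm G a b l) (hnp : ¬ IsPancyclic G) {u v w : V} (hu : ¬ Hv G u) (hv : ¬ Hv G v)
    (huv : u ≠ v) (nuv : ¬ G.Adj u v) (hwu : G.Adj w u) (hwv : G.Adj w v)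
    (hR : ∀ z, z ≠ u → z ≠ v → G.Adj u z ∨ G.Adj v z) : False := by
  classical
  have hun : G.neighborFinset u ∪ G.neighborFinset v = Finset.univ \ {u, v} := by
    ext z
    simp only [Finset.mem_union, mem_neighborFinset, Finset.mem_sdiff, Finset.mem_univ, true_and,
      Finset.mem_insert, Finset.mem_singleton, not_or]
    constructor
    · rintro (e | e)
      · exact ⟨e.ne.symm, by rintro rfl; exact nuv e⟩
      · exact ⟨by rintro rfl; exact nuv e.symm, e.ne.symm⟩
    · rintro ⟨e1, e2⟩
      exact hR z e1 e2
  have hcard := Finset.card_union_add_card_inter (G.neighborFinset u) (G.neighborFinset v)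
  rw [hun, Finset.card_sdiff_of_subset (Finset.subset_univ _), Finset.card_pair huv,
    Finset.card_univ, G.card_neighborFinset_eq_degree, G.card_neighborFinset_eq_degree] at hcard
  unfold Hv at hu hv
  have hle : (G.neighborFinset u ∩ G.neighborFinset v).card ≤ 2 := by omega
  have hadj : ∀ z, z ≠ w → ¬ (G.Adj u z ∧ G.Adj v z) → G.Adj w z := by
    intro z hz hc
    by_contra hn
    have h1 : z ≠ u := by rintro rfl; exact hn hwu
    have h2 : z ≠ v := by rintro rfl; exact hn hwv
    rcases hR z h1 h2 with e | e
    · have := (hP z u w v e.symm hwu.symm hwv (fun e => hn e.symm) (fun e' => hc ⟨e, e'.symm⟩) nuv).2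
      unfold Hv at this
      tauto
    · have := (hP z v w u e.symm hwv.symm hwu (fun e => hn e.symm) (fun e' => hc ⟨e'.symm, e⟩)
        (fun e => nuv e.symm)).2
      unfold Hv at this
      tauto
  by_cases hw' : ∃ w', w' ≠ w ∧ G.Adj u w' ∧ G.Adj v w'
  · obtain ⟨w', hne, hu', hv'⟩ := hw'
    have honly : ∀ z, G.Adj u z → G.Adj v z → z = w ∨ z = w' := by
      intro z z1 z2
      by_contra hn
      push Not at hn
      have hs : ({z, w, w'} : Finset V) ⊆ G.neighborFinset u ∩ G.neighborFinset v := by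
        intro y hy
        simp only [Finset.mem_insert, Finset.mem_singleton] at hy
        simp only [Finset.mem_inter, mem_neighborFinset]
        rcases hy with rfl | rfl | rfl
        · exact ⟨z1, z2⟩
        · exact ⟨hwu.symm, hwv.symm⟩
        · exact ⟨hu', hv'⟩
      have := Finset.card_le_card hs
      rw [Finset.card_eq_three.2 ⟨z, w, w', hn.1, hn.2, hne.symm, rfl⟩] at this
      omega
    have hall : ∀ z, z ≠ w → z ≠ w' → G.Adj w z := by
      intro z z1 z2
      refine hadj z z1 (fun hc => ?_)
      rcases honly z hc.1 hc.2 with e | e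
      · exact z1 e
      · exact z2 e
    by_cases hww : G.Adj w w'
    · refine hnp (almost_univ h hall (Or.inr (fun z hz => ?_)))
      by_cases e : z = w'
      · exact e ▸ hww
      · exact hall z hz e
    by_cases h5 : 5 ≤ Fintype.card V
    · exact hnp (almost_univ h hall (Or.inl h5))
    have four : ({u, v, w, w'} : Finset V) = Finset.univ := by
      apply Finset.eq_univ_of_card
      have hc4 : ({u, v, w, w'} : Finset V).card = 4 := by
        rw [Finset.card_insert_of_notMem, Finset.card_eq_three.2 ⟨v, w, w', hwv.ne.symm, hv'.ne,
          hne.symm, rfl⟩]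
        simp only [Finset.mem_insert, Finset.mem_singleton, not_or]
        exact ⟨huv, hwu.ne.symm, hu'.ne⟩
      have := Finset.card_le_univ ({u, v, w, w'} : Finset V)
      omega
    have mem4 : ∀ z, z = u ∨ z = v ∨ z = w ∨ z = w' := by
      intro z
      have : z ∈ ({u, v, w, w'} : Finset V) := by rw [four]; simp
      simpa using this
    have deg2 : ∀ x y z : V, y ≠ z → (∀ t, G.Adj x t ↔ t = y ∨ t = z) → G.degree x = 2 := by
      intro x y z hyz ht
      rw [← G.card_neighborFinset_eq_degree, Finset.card_eq_two]
      refine ⟨y, z, hyz, ?_⟩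
      ext t
      simp [ht]
    apply hnc
    refine ⟨hcon, fun z => ?_⟩
    rcases mem4 z with rfl | rfl | rfl | rfl
    · refine deg2 _ w w' hne.symm (fun t => ⟨fun ht => ?_, ?_⟩)
      · rcases mem4 t with rfl | rfl | rfl | rfl
        · exact absurd rfl ht.ne
        · exact absurd ht nuv
        · simp
        · simp
      · rintro (rfl | rfl)
        · exact hwu.symm
        · exact hu'
    · refine deg2 _ w w' hne.symm (fun t => ⟨fun ht => ?_, ?_⟩)
      · rcases mem4 t with rfl | rfl | rfl | rfl
        · exact absurd ht.symm nuv
        · exact absurd rfl ht.ne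
        · simp
        · simp
      · rintro (rfl | rfl)
        · exact hwv.symm
        · exact hv'
    · refine deg2 _ u v huv (fun t => ⟨fun ht => ?_, ?_⟩)
      · rcases mem4 t with rfl | rfl | rfl | rfl
        · simp
        · simp
        · exact absurd rfl ht.ne
        · exact absurd ht hww
      · rintro (rfl | rfl)
        · exact hwu
        · exact hwv
    · refine deg2 _ u v huv (fun t => ⟨fun ht => ?_, ?_⟩)
      · rcases mem4 t with rfl | rfl | rfl | rfl
        · simp
        · simp
        · exact absurd ht.symm hww
        · exact absurd rfl ht.ne
      · rintro (rfl | rfl)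
        · exact hu'.symm
        · exact hv'.symm
  · push Not at hw'
    have huniv : ∀ z, z ≠ w → G.Adj w z := fun z hz => hadj z hz (fun hc => hw' z hz hc.1 hc.2)
    exact hnp (almost_univ (w' := w) h (fun z hz _ => huniv z hz) (Or.inr huniv))

theorem bad_triple (hcon : G.Connected) (hnc : ¬ IsCycleGraph G) (hC : ClawC G) (hP : PathC G)
    {a b : V} {l : List V} (h : Hm G a b l) (hnp : ¬ IsPancyclic G) {u v w : V} (hu : ¬ Hv G u)
    (hv : ¬ Hv G v) (huv : u ≠ v) (nuv : ¬ G.Adj u v) (hwu : G.Adj w u) (hwv : G.Adj w v) :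
    Hv G w ∧ ∃ e, ¬ Hv G e ∧ e ≠ u ∧ e ≠ v ∧ ¬ G.Adj u e ∧ ¬ G.Adj v e := by
  have hN := nc_of hnp
  by_cases hR : ∀ z, z ≠ u → z ≠ v → G.Adj u z ∨ G.Adj v z
  · exact (bad_empty hcon hnc hP h hnp hu hv huv nuv hwu hwv hR).elim
  push Not at hR
  obtain ⟨e0, he0⟩ := hR
  obtain ⟨a', b', l1, t, e, l2, hh, ht, he⟩ := h.crossing (u := u) (e0 := e0)
    (fun z => z ≠ u ∧ z ≠ v ∧ ¬ G.Adj u z ∧ ¬ G.Adj v z) (fun hh => hh.1 rfl) he0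
  have hte : G.Adj t e := by
    have h1 : RP G a' b' ((l1 ++ [t]) ++ e :: l2) := by simpa using hh.1
    obtain ⟨p, k1, k2, k3⟩ := h1.split_cons (by simp)
    have := k1.last
    exact this ▸ k3
  have hnh := hh.nohh hN
  have key : ∀ u v : V, ¬ Hv G u → ¬ Hv G v → u ≠ v → ¬ G.Adj u v → G.Adj w u → G.Adj w v →
      e ≠ u → e ≠ v → ¬ G.Adj u e → ¬ G.Adj v e → G.Adj t u → ¬ Hv G e ∧ Hv G w := by
    intro u v hu hv huv nuv hwu hwv e1 e2 e3 e4 htu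
    have ntv : ¬ G.Adj t v := by
      intro htv
      have := hC t u v e htu htv hte huv e1.symm e2.symm nuv e3 e4
      tauto
    have htw : G.Adj t w := by
      by_contra hn
      have := (hP t u w v htu hwu.symm hwv hn ntv nuv).2
      tauto
    have new : ¬ G.Adj e w := by
      intro hew
      have := hC w u v e hwu hwv hew.symm huv e1.symm e2.symm nuv e3 e4
      tauto
    have := hP e t w v hte.symm htw hwv new (fun x => e4 x.symm) ntv
    tauto
  obtain ⟨e1, e2, e3, e4⟩ := he
  have htu : t ≠ u := by rintro rfl; exact e3 hte
  have htv : t ≠ v := by rintro rfl; exact e4 hte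
  have : G.Adj t u ∨ G.Adj t v := by
    by_contra hn
    push Not at hn
    exact ht ⟨htu, htv, fun x => hn.1 x.symm, fun x => hn.2 x.symm⟩
  rcases this with h1 | h1
  · have := key u v hu hv huv nuv hwu hwv e1 e2 e3 e4 h1
    exact ⟨this.2, e, this.1, e1, e2, e3, e4⟩
  · have := key v u hv hu huv.symm (fun x => nuv x.symm) hwv hwu e2 e1 e4 e3 h1
    exact ⟨this.2, e, this.1, e1, e2, e3, e4⟩

end Bad

section Cls
variable {V : Type} [Fintype V] {G : SimpleGraph V} [DecidableRel G.Adj]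

/-- standing assumptions of the second part -/
structure Ctx (G : SimpleGraph V) [DecidableRel G.Adj] : Prop where
  hC : ClawC G
  hP : PathC G
  hN : NC G
  hB : ∀ u v w, ¬ Hv G u → ¬ Hv G v → u ≠ v → ¬ G.Adj u v → G.Adj w u → G.Adj w v →
    Hv G w ∧ ∃ e, ¬ Hv G e ∧ e ≠ u ∧ e ≠ v ∧ ¬ G.Adj u e ∧ ¬ G.Adj v e

/-- equal or adjacent -/
def Cl (G : SimpleGraph V) (u v : V) : Prop := u = v ∨ G.Adj u v

theorem Cl.refl (u : V) : Cl G u u := Or.inl rfl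

theorem Cl.symm {u v : V} (h : Cl G u v) : Cl G v u :=
  h.imp (fun e => e.symm) (fun e => SimpleGraph.Adj.symm e)

theorem Cl.adj {u v : V} (h : Cl G u v) (hne : u ≠ v) : G.Adj u v := h.resolve_left hne

theorem Cl.trans (cx : Ctx G) {u v w : V} (hu : ¬ Hv G u) (hv : ¬ Hv G v) (hw : ¬ Hv G w)
    (h1 : Cl G u v) (h2 : Cl G v w) : Cl G u w := by
  rcases h1 with rfl | h1
  · exact h2
  rcases h2 with rfl | h2
  · exact Or.inr h1
  by_contra hn
  unfold Cl at hn
  push Not at hn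
  exact hv (cx.hB u w v hu hw hn.1 hn.2 h1.symm h2).1

theorem no3 (cx : Ctx G) {x u v w : V} (hu : ¬ Hv G u) (hv : ¬ Hv G v)
    (huv : ¬ Cl G u v) (huw : ¬ Cl G u w) (hvw : ¬ Cl G v w) (h1 : G.Adj x u) (h2 : G.Adj x v)
    (h3 : G.Adj x w) : False := by
  unfold Cl at huv huw hvw
  push Not at huv huw hvw
  have := cx.hC x u v w h1 h2 h3 huv.1 huw.1 hvw.1 huv.2 huw.2 hvw.2
  tauto

theorem complete (cx : Ctx G) {x u v p : V} (hu : ¬ Hv G u) (hv : ¬ Hv G v) (hp : ¬ Hv G p)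
    (huv : ¬ Cl G u v) (h1 : G.Adj x u) (h2 : G.Adj x v) (h : Cl G p u) : G.Adj x p := by
  rcases h with rfl | h
  · exact h1
  by_contra hn
  have hpv : ¬ G.Adj p v := fun e => huv (Cl.trans cx hu hp hv (Or.inr h.symm) (Or.inr e))
  have := (cx.hP p u x v h h1.symm h2 (fun e => hn e.symm) hpv (fun e => huv (Or.inr e))).2
  tauto

theorem adj_tr (cx : Ctx G) {x t u v v' w : V} (hu : ¬ Hv G u) (hv : ¬ Hv G v) (hv' : ¬ Hv G v')
    (hw : ¬ Hv G w) (huv : ¬ Cl G u v) (huw : ¬ Cl G u w) (hvw : ¬ Cl G v w) (h : Cl G v v')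
    (h1 : G.Adj x u) (h2 : G.Adj x v) (h3 : G.Adj t v') (h4 : G.Adj t w) : G.Adj x t := by
  have huv' : ¬ Cl G u v' := fun e => huv (Cl.trans cx hu hv' hv e h.symm)
  have hv'w : ¬ Cl G v' w := fun e => hvw (Cl.trans cx hv hv' hw h e)
  have hxv' : G.Adj x v' := complete cx hv hu hv' (fun e => huv e.symm) h2 h1 h.symm
  have htu : ¬ G.Adj u t := fun e => no3 cx hu hv' huv' huw hv'w e.symm h3 h4
  by_contra hn
  have := (cx.hP u x v' t h1.symm hxv' h3.symm (fun e => huv' (Or.inr e)) htu hn).1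
  tauto

theorem nonadj (cx : Ctx G) {x u v y : V} (hu : ¬ Hv G u) (hv : ¬ Hv G v) (huv : ¬ Cl G u v)
    (h1 : G.Adj x u) (h2 : G.Adj x v) (yu : y ≠ u) (yv : y ≠ v) (h3 : G.Adj x y) :
    G.Adj y u ∨ G.Adj y v := by
  by_contra hn
  push Not at hn
  unfold Cl at huv
  push Not at huv
  have := cx.hC x u v y h1 h2 h3 huv.1 yu.symm yv.symm huv.2 (fun e => hn.1 e.symm)
    (fun e => hn.2 e.symm)
  tauto

/-- no two consecutive heavy vertices in the list -/
def NH (G : SimpleGraph V) [DecidableRel G.Adj] (l : List V) : Prop :=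
  l.IsChain (fun p q => ¬ (Hv G p ∧ Hv G q))

theorem Hm.nh (cx : Ctx G) {a b : V} {l : List V} (h : Hm G a b l) : NH G l := by
  by_contra hn
  obtain ⟨l1, p, q, l2, rfl, hr⟩ := not_chain hn
  exact hr (h.nohh cx.hN)

theorem NH.left {l m : List V} (h : NH G (l ++ m)) : NH G l := List.IsChain.left_of_append h
theorem NH.right {l m : List V} (h : NH G (l ++ m)) : NH G m := List.IsChain.right_of_append h
theorem NH.tail {x : V} {m : List V} (h : NH G (x :: m)) : NH G m :=
  NH.right (l := [x]) h

theorem NH.prev_light {a p z : V} {l m : List V} (h : NH G (l ++ z :: m)) (hr : RP G a p l)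
    (hz : Hv G z) : ¬ Hv G p := by
  obtain ⟨t, rfl⟩ := hr.last_eq
  have : NH G (t ++ (p :: z :: m)) := by simpa using h
  have h2 := this.right
  unfold NH at h2
  rw [List.isChain_cons_cons] at h2
  exact fun hp => h2.1 ⟨hp, hz⟩

theorem NH.next_light {q b z : V} {m : List V} (h : NH G (z :: m)) (hr : RP G q b m)
    (hz : Hv G z) : ¬ Hv G q := by
  obtain ⟨t, rfl⟩ := hr.head_eq
  unfold NH at h
  rw [List.isChain_cons_cons] at h
  exact fun hq => h.1 ⟨hz, hq⟩

/-- the first light vertex with a property not shared by lights before it, reached through a heavy -/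
theorem first_new (cx : Ctx G) {w u : V} {rest : List V} (P : V → Prop)
    (hPc : ∀ p q, ¬ Hv G p → ¬ Hv G q → P p → G.Adj p q → P q)
    (hr : RP G w u rest) (hn : NH G rest) (hw : ¬ Hv G w) (hPw : P w)
    (hex : ∃ p ∈ rest, ¬ Hv G p ∧ ¬ P p) :
    ∃ F y r2 g h, rest = F ++ y :: r2 ∧ RP G w g F ∧ (∀ p ∈ F, ¬ Hv G p → P p) ∧ ¬ Hv G g ∧
      G.Adj g y ∧ Hv G y ∧ G.Adj y h ∧ RP G h u r2 ∧ ¬ Hv G h ∧ ¬ P h := by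
  obtain ⟨l1, h, l2, rfl, ⟨hl, hPh⟩, hfirst⟩ := exists_first (p := fun p => ¬ Hv G p ∧ ¬ P p) hex
  have hl1 : l1 ≠ [] := by
    rintro rfl
    have := hr.head
    subst this
    exact hPh hPw
  obtain ⟨y, k1, k2, k3⟩ := hr.split_cons hl1
  have hy : Hv G y := by
    by_contra hy
    have h1 := hfirst y k1.right_mem
    have : P y := by tauto
    exact hPh (hPc y h hy hl this k3)
  obtain ⟨F, rfl⟩ := k1.last_eq
  have hF : F ≠ [] := by
    rintro rfl
    have := k1.head
    subst this
    exact hw hy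
  obtain ⟨g, k4, k5, k6⟩ := k1.split_cons hF
  have hg : ¬ Hv G g := NH.prev_light (l := F) (m := h :: l2) (z := y) (by simpa using hn) k4 hy
  refine ⟨F, y, h :: l2, g, h, by simp, k4, ?_, hg, k6, hy, k3, k2, hl, hPh⟩
  intro p hp hpl
  have := hfirst p (by simp [hp])
  tauto

theorem Cl.closed (cx : Ctx G) {w : V} (hw : ¬ Hv G w) :
    ∀ p q, ¬ Hv G p → ¬ Hv G q → Cl G w p → G.Adj p q → Cl G w q :=
  fun _ _ hp hq h1 h2 => Cl.trans cx hw hp hq h1 (Or.inr h2)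

theorem flex (n : ℕ) : ∀ {a b : V} {l : List V}, l.length = n → RP G a b l → NH G l → l.Nodup →
    ¬ Hv G a → ¬ Hv G b → (∀ p ∈ l, ∀ q ∈ l, ¬ Hv G p → ¬ Hv G q → Cl G p q) →
    ∀ r, 1 ≤ r → r ≤ l.length → ∃ a' b' l', RP G a' b' l' ∧ l'.Sublist l ∧ ¬ Hv G a' ∧ ¬ Hv G b' ∧
      l'.length = r := by
  induction n using Nat.strong_induction_on with
  | _ n ih =>
    intro a b l hl h hn hnd ha hb hcl r hr1 hr
    by_cases hrl : r = l.length
    · exact ⟨a, b, l, h, List.Sublist.refl _, ha, hb, hrl.symm⟩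
    obtain ⟨l1, rfl⟩ := h.head_eq
    have hl1 : l1 ≠ [] := by
      rintro rfl
      simp at hr hrl
      omega
    obtain ⟨a2, _, k1, k2⟩ := h.tail hl1
    simp only [List.length_cons] at hl hr hrl
    by_cases ha2 : Hv G a2
    · obtain ⟨l2, rfl⟩ := k1.head_eq
      have hl2 : l2 ≠ [] := by
        rintro rfl
        have := k1.right_mem
        simp at this
        subst this
        exact hb ha2
      obtain ⟨a3, _, k3, k4⟩ := k1.tail hl2
      have ha3 : ¬ Hv G a3 := NH.next_light hn.tail k3 ha2
      have hne : a ≠ a3 := by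
        rintro rfl
        exact (List.nodup_cons.1 hnd).1 (List.mem_cons_of_mem _ k3.left_mem)
      have hadj : G.Adj a a3 := (hcl a (by simp) a3 (by simp [k3.left_mem]) ha ha3).adj hne
      have hsub : (a :: l2).Sublist (a :: a2 :: l2) :=
        List.Sublist.cons_cons _ (List.sublist_cons_self _ _)
      have hnh : NH G (a :: l2) := by
        obtain ⟨l3, rfl⟩ := k3.head_eq
        unfold NH
        rw [List.isChain_cons_cons]
        exact ⟨fun hh => ha hh.1, hn.tail.tail⟩
      simp only [List.length_cons] at hl hr hrl
      obtain ⟨a', b', l', g1, g2, g3⟩ := ih (l2.length + 1) (by omega) (by simp) (k3.cons hadj) hnh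
        (hsub.nodup hnd) ha hb (fun p hp q hq => hcl p (hsub.subset hp) q (hsub.subset hq)) r hr1
        (by simp; omega)
      exact ⟨a', b', l', g1, g2.trans hsub, g3⟩
    · have hsub : l1.Sublist (a :: l1) := List.sublist_cons_self _ _
      obtain ⟨a', b', l', g1, g2, g3⟩ := ih l1.length (by omega) rfl k1 hn.tail
        (hsub.nodup hnd) ha2 hb (fun p hp q hq => hcl p (hsub.subset hp) q (hsub.subset hq)) r hr1
        (by omega)
      exact ⟨a', b', l', g1, g2.trans hsub, g3⟩

theorem one_class (cx : Ctx G) (h3 : 3 ≤ Fintype.card V) {f b : V} {l : List V} (h : Hm G f b l)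
    (hf : ¬ Hv G f) (hcl : ∀ p q, ¬ Hv G p → ¬ Hv G q → Cl G p q) : IsPancyclic G := by
  have hlen := len_card h.2.2.1 h.2.2.2
  have hnh := h.nh cx
  have hl' : ∃ b' l', RP G f b' l' ∧ l'.Sublist l ∧ ¬ Hv G b' ∧ l.length ≤ l'.length + 1 ∧ NH G l' := by
    by_cases hb : Hv G b
    · obtain ⟨l', rfl⟩ := h.1.last_eq
      have hne : l' ≠ [] := by
        rintro rfl
        simp at hlen
        omega
      obtain ⟨p, k1, k2, k3⟩ := h.1.split_cons hne
      exact ⟨p, l', k1, List.sublist_append_left _ _, NH.prev_light hnh k1 hb, by simp, hnh.left⟩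
    · exact ⟨b, l, h.1, List.Sublist.refl _, hb, by omega, hnh⟩
  obtain ⟨b', l', g1, g2, g3, g4, g5⟩ := hl'
  intro k hk3 hkn
  by_cases hk : k = l.length
  · exact h.1.hasCycle h.2.2.1 hk3 hk.symm h.2.1
  obtain ⟨a2, b2, l2, m1, m2, m3, m4, m5⟩ := flex _ rfl g1 g5 (g2.nodup h.2.2.1) hf g3
    (fun p _ q _ => hcl p q) k (by omega) (by omega)
  have hnd := (m2.trans g2).nodup h.2.2.1
  refine m1.hasCycle hnd hk3 m5 ?_
  refine (hcl b2 a2 m4 m3).adj ?_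
  rintro rfl
  obtain ⟨t, rfl⟩ := m1.head_eq
  have ht : t ≠ [] := by
    rintro rfl
    simp at m5
    omega
  obtain ⟨q, _, k1, _⟩ := m1.tail ht
  exact (List.nodup_cons.1 hnd).1 k1.right_mem

end Cls

section Tri
variable {V : Type} [Fintype V] {G : SimpleGraph V} [DecidableRel G.Adj]

theorem twoOpt (cx : Ctx G) {x u t v p q : V} {l1 l2 : List V}
    (h : Hm G x u (x :: (l1 ++ t :: l2))) (h1 : RP G v p l1) (h2 : RP G q u l2)
    (hxv : G.Adj x v) (hpt : G.Adj p t) (htq : G.Adj t q) (hux : G.Adj u x)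
    (hx : Hv G x) (ht : Hv G t) (hxt : G.Adj x t) : ¬ G.Adj p u ∧ ¬ G.Adj v q := by
  constructor
  · intro e
    have k : RP G x t (x :: (l1 ++ (l2.reverse ++ [t]))) :=
      (h1.append e (h2.rev.snoc htq.symm)).cons hxv
    refine cx.hN _ _ _ (h.perm k hxt.symm ?_) ⟨hx, ht⟩
    classical
    rw [List.perm_iff_count]
    intro v
    simp only [List.count_append, List.count_cons, List.count_reverse, List.count_nil]
    ring
  · intro e
    have k : RP G x t (x :: (l2.reverse ++ (l1 ++ [t]))) :=
      (h2.rev.append e.symm (h1.snoc hpt)).cons hux.symm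
    refine cx.hN _ _ _ (h.perm k hxt.symm ?_) ⟨hx, ht⟩
    classical
    rw [List.perm_iff_count]
    intro v
    simp only [List.count_append, List.count_cons, List.count_reverse, List.count_nil]
    ring

/-- a segment of one class between two heavy vertices -/
structure Tri (G : SimpleGraph V) [DecidableRel G.Adj] (x t v g w u : V) (F rest : List V) :
    Prop where
  hm : Hm G x u (x :: (F ++ t :: rest))
  rF : RP G v g F
  rR : RP G w u rest
  xv : G.Adj x v
  gt : G.Adj g t
  tw : G.Adj t w
  ux : G.Adj u x
  hx : Hv G x
  ht : Hv G t
  lv : ¬ Hv G v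
  lg : ¬ Hv G g
  lw : ¬ Hv G w
  lu : ¬ Hv G u
  cF : ∀ p ∈ F, ¬ Hv G p → Cl G v p
  uv : ¬ Cl G u v
  vw : ¬ Cl G v w
  uw : ¬ Cl G u w

theorem Tri.xt (cx : Ctx G) {x t v g w u : V} {F rest : List V} (T : Tri G x t v g w u F rest) :
    G.Adj x t :=
  adj_tr cx T.lu T.lv T.lg T.lw T.uv T.uw T.vw (T.cF g T.rF.right_mem T.lg) T.ux.symm T.xv
    T.gt.symm T.tw

theorem Tri.pure (cx : Ctx G) {x t v g w u : V} {F rest : List V}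
    (T : Tri G x t v g w u F rest) : ∀ p ∈ F, ¬ Hv G p := by
  intro z hzF hz
  have hxt := T.xt cx
  obtain ⟨hm, rF, rR, xv, gt, tw, ux, hx, ht, lv, lg, lw, lu, cF, uv, vw, uw⟩ := T
  have hnh := hm.nh cx
  obtain ⟨F1, F2, rfl⟩ := List.append_of_mem hzF
  have hF1 : F1 ≠ [] := by
    rintro rfl
    have := rF.head
    subst this
    exact lv hz
  have hF2 : F2 ≠ [] := by
    rintro rfl
    have := rF.last
    subst this
    exact lg hz
  obtain ⟨p, k1, k2, pz⟩ := rF.split_cons hF1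
  obtain ⟨q, _, k3, zq⟩ := k2.tail hF2
  have hnhF : NH G (F1 ++ z :: F2) := hnh.tail.left
  have lp : ¬ Hv G p := hnhF.prev_light k1 hz
  have lq : ¬ Hv G q := hnhF.right.next_light k3 hz
  have cp : Cl G v p := cF p (by simp [k1.right_mem]) lp
  have cq : Cl G v q := cF q (by simp [k3.left_mem]) lq
  have cg : Cl G v g := cF g (by simp [k3.right_mem]) lg
  have hnd := hm.2.2.1
  have ndF : (F1 ++ z :: F2).Nodup := (List.nodup_append.1 (List.nodup_cons.1 hnd).2).1
  have dis := (List.nodup_append.1 ndF).2.2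
  have hvq : G.Adj v q := cq.adj (dis v k1.left_mem q (by simp [k3.left_mem]))
  have hpg : G.Adj p g :=
    (Cl.trans cx lp lv lg cp.symm cg).adj (dis p k1.right_mem g (by simp [k3.right_mem]))
  have hxz : ¬ G.Adj x z := by
    intro e
    have h' : Hm G x u (x :: (F1 ++ z :: (F2 ++ t :: rest))) := by simpa using hm
    exact (twoOpt cx h' k1 (k3.append gt (rR.cons tw)) xv pz zq ux hx hz e).2 hvq
  have htz : ¬ G.Adj t z := by
    intro e
    have k : RP G t g (t :: ((rest ++ x :: F1) ++ z :: F2)) :=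
      ((rR.append ux (k1.cons xv)).append pz (k3.cons zq)).cons tw
    have h' : Hm G t g (t :: ((rest ++ x :: F1) ++ z :: F2)) := by
      refine hm.perm k gt ?_
      classical
      rw [List.perm_iff_count]
      intro v
      simp only [List.count_append, List.count_cons, List.count_nil]
      ring
    exact (twoOpt cx h' (rR.append ux (k1.cons xv)) k3 tw pz zq gt ht hz e).1 hpg
  have hup : ¬ Cl G u p := fun e => uv (Cl.trans cx lu lp lv e cp.symm)
  have hpw : ¬ Cl G p w := fun e => vw (Cl.trans cx lv lp lw cp e)
  have hxp : G.Adj x p := complete cx lv lu lp (fun e => uv e.symm) xv ux.symm cp.symm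
  have htp : G.Adj t p := complete cx lg lw lp (fun e => vw (Cl.trans cx lv lg lw cg e)) gt.symm tw
    (Cl.trans cx lp lv lg cp.symm cg)
  have hzu : G.Adj z u := by
    by_contra hn
    have := (cx.hP z p x u pz.symm hxp.symm ux.symm (fun e => hxz e.symm) hn
      (fun e => hup (Or.inr e.symm))).2
    tauto
  have hzw : G.Adj z w := by
    by_contra hn
    have := (cx.hP z p t w pz.symm htp.symm tw (fun e => htz e.symm) hn
      (fun e => hpw (Or.inr e))).2
    tauto
  exact no3 cx lp lu (fun e => hup e.symm) hpw uw pz.symm hzu hzw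

theorem Tri.noback (cx : Ctx G) {x t v g w u : V} {F rest : List V}
    (T : Tri G x t v g w u F rest) : ∀ p ∈ rest, ¬ Hv G p → ¬ Cl G v p := by
  intro p0 hp0 lp0 cp0
  have hxt := T.xt cx
  obtain ⟨hm, rF, rR, xv, gt, tw, ux, hx, ht, lv, lg, lw, lu, cF, uv, vw, uw⟩ := T
  have hnh := hm.nh cx
  obtain ⟨r1, p, r2, rfl, ⟨lp, cp⟩, hfirst⟩ :=
    exists_first (p := fun p => ¬ Hv G p ∧ Cl G v p) ⟨p0, hp0, lp0, cp0⟩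
  have hr1 : r1 ≠ [] := by
    rintro rfl
    have := rR.head
    subst this
    exact vw cp
  obtain ⟨z, k1, k2, zp⟩ := rR.split_cons hr1
  have hz : Hv G z := by
    by_contra hz
    exact hfirst z k1.right_mem ⟨hz, Cl.trans cx lv lp hz cp (Or.inr zp.symm)⟩
  obtain ⟨r1', rfl⟩ := k1.last_eq
  have hr1' : r1' ≠ [] := by
    rintro rfl
    have := k1.head
    subst this
    exact lw hz
  obtain ⟨y0, k3, _, y0z⟩ := k1.split_cons hr1'
  have hnR : NH G (r1' ++ z :: (p :: r2)) := by
    have := hnh.tail.right.tail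
    simpa using this
  have ly0 : ¬ Hv G y0 := hnR.prev_light k3 hz
  have cy0 : ¬ Cl G v y0 := fun e => hfirst y0 (by simp [k3.right_mem]) ⟨ly0, e⟩
  have hzv : G.Adj z v := complete cx lp ly0 lv (fun e => cy0 (Cl.trans cx lv lp ly0 cp e)) zp
    y0z.symm cp
  have hnd := hm.2.2.1
  have hgp : G.Adj g p := by
    refine (Cl.trans cx lg lv lp (cF g rF.right_mem lg).symm cp).adj ?_
    exact (List.nodup_append.1 (List.nodup_cons.1 hnd).2).2.2 g rF.right_mem p (by simp)
  have k : RP G t x (t :: ((r1' ++ [z]) ++ (F ++ ((p :: r2) ++ [x])))) :=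
    (k1.append hzv (rF.append hgp (k2.snoc ux))).cons tw
  refine cx.hN _ _ _ (hm.perm k hxt ?_) ⟨ht, hx⟩
  classical
  rw [List.perm_iff_count]
  intro v
  simp only [List.count_append, List.count_cons, List.count_nil]
  ring

end Tri

section GetTri
variable {V : Type} [Fintype V] {G : SimpleGraph V} [DecidableRel G.Adj]

theorem get_tri (cx : Ctx G) (h3 : 3 ≤ Fintype.card V) {a b : V} {l : List V} (h : Hm G a b l)
    (hnp : ¬ IsPancyclic G) : ∃ x t v g w u F rest, Tri G x t v g w u F rest := by
  have hf : ∃ f, ¬ Hv G f := by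
    by_contra hn
    push Not at hn
    exact cx.hN _ _ _ h ⟨hn a, hn b⟩
  obtain ⟨f, lf⟩ := hf
  obtain ⟨b1, T, hT⟩ := h.start f
  have hex : ∃ p ∈ f :: T, ¬ Hv G p ∧ ¬ Cl G f p := by
    by_contra hn
    push Not at hn
    exact hnp (one_class cx h3 hT lf fun p q lp lq =>
      Cl.trans cx lp lf lq (hn p (hT.2.2.2 p) lp).symm (hn q (hT.2.2.2 q) lq))
  obtain ⟨G0, x, r2, u0, v0, e1, k1, k2, lu, ux, hx, xv, k3, lv, nfv⟩ :=
    first_new cx (Cl G f) (Cl.closed cx lf) hT.1 (hT.nh cx) lf (Cl.refl f) hex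
  have nuv : ¬ Cl G u0 v0 := fun e => nfv (Cl.trans cx lf lu lv (k2 u0 k1.right_mem lu) e)
  have rL : RP G v0 u0 (r2 ++ G0) := k3.append hT.2.1 k1
  have hmL : Hm G x u0 (x :: (r2 ++ G0)) := by
    refine hT.perm (rL.cons xv) ux ?_
    rw [e1]
    classical
    rw [List.perm_iff_count]
    intro v
    simp only [List.count_append, List.count_cons]
    ring
  obtain ⟨_, e0, le0, ne1, ne2, ne3, ne4⟩ := cx.hB u0 v0 x lu lv (fun e => nuv (Or.inl e))
    (fun e => nuv (Or.inr e)) ux.symm xv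
  have he0 : e0 ∈ r2 ++ G0 := by
    have := hmL.2.2.2 e0
    rcases List.mem_cons.1 this with rfl | h
    · exact absurd hx le0
    · exact h
  obtain ⟨l1, y, m, g, e, e2, k4, k5, lg, gy, hy, ye, k6, le, nPe⟩ :=
    first_new cx (fun p => Cl G u0 p ∨ Cl G v0 p)
      (fun p q lp lq hp hpq => hp.imp (fun c => Cl.closed cx lu p q lp lq c hpq)
        (fun c => Cl.closed cx lv p q lp lq c hpq)) rL (hmL.nh cx).tail lv (Or.inr (Cl.refl v0))
      ⟨e0, he0, le0, by
        rintro (c | c)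
        · exact c.elim (fun c => ne1 c.symm) ne3
        · exact c.elim (fun c => ne2 c.symm) ne4⟩
  have hmB : Hm G y e (y :: (l1.reverse ++ x :: m.reverse)) := by
    refine hmL.perm ((k4.rev.append xv.symm (k6.rev.cons ux.symm)).cons gy.symm) ye.symm ?_
    rw [e2]
    classical
    rw [List.perm_iff_count]
    intro v
    simp only [List.count_append, List.count_cons, List.count_reverse]
    ring
  obtain ⟨B, hB⟩ := k6.rev.head_eq
  have hBne : B ≠ [] := by
    rintro rfl
    have k7 := k6.rev
    rw [hB] at k7
    have := k7.right_mem
    simp at this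
    exact nPe (Or.inl (Or.inl this.symm))
  obtain ⟨b2, _, k8, k9⟩ := RP.tail (hB ▸ k6.rev) hBne
  have rA : RP G g u0 (l1.reverse ++ [x, u0]) :=
    k4.rev.append xv.symm ((RP.single u0).cons ux.symm)
  have eqB : l1.reverse ++ x :: m.reverse = (l1.reverse ++ [x, u0]) ++ B := by
    rw [hB]
    simp
  rw [eqB] at hmB
  have hnA : NH G (l1.reverse ++ [x, u0]) := (hmB.nh cx).tail.left
  have hex2 : ∃ p ∈ l1.reverse ++ [x, u0], ¬ Hv G p ∧ ¬ Cl G g p := by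
    by_cases c : Cl G g u0
    · refine ⟨v0, by simp [k4.left_mem], lv, fun c2 => nuv (Cl.trans cx lu lg lv c.symm c2)⟩
    · exact ⟨u0, by simp, lu, c⟩
  obtain ⟨G', z, r3, g', w, e3, j1, j2, lg', g'z, hz, zw, j3, lw, ngw⟩ :=
    first_new cx (Cl G g) (Cl.closed cx lg) rA hnA lg (Cl.refl g) hex2
  have Pg : Cl G u0 g ∨ Cl G v0 g := k5 g k4.right_mem lg
  have Pw : Cl G u0 w ∨ Cl G v0 w := by
    have hw : w ∈ l1.reverse ++ [x, u0] := by
      rw [e3]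
      simp [j3.left_mem]
    simp only [List.mem_append, List.mem_reverse, List.mem_cons, List.not_mem_nil, or_false] at hw
    rcases hw with hw | rfl | rfl
    · exact k5 w hw lw
    · exact absurd hx lw
    · exact Or.inl (Cl.refl _)
  have key : ∀ p, ¬ Hv G p → (Cl G u0 p ∨ Cl G v0 p) → ¬ Cl G e p := fun p lp hp c =>
    nPe (hp.imp (fun d => Cl.trans cx lu lp le d c.symm) (fun d => Cl.trans cx lv lp le d c.symm))
  refine ⟨y, z, g, g', w, e, G', r3 ++ B, ?_, j1, j3.append k9 k8, gy.symm, g'z, zw, ye.symm, hy, hz,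
    lg, lg', lw, le, j2, key g lg Pg, ngw, key w lw Pw⟩
  rw [e3] at hmB
  simpa using hmB

end GetTri

section EndGame
variable {V : Type} [Fintype V] {G : SimpleGraph V} [DecidableRel G.Adj]

theorem arc {x t v g b : V} {F m : List V} (h : RP G v g F) (hx : ∀ p ∈ F, G.Adj x p)
    (ht : ∀ p ∈ F, G.Adj t p) (hxt : G.Adj x t) (hm : RP G t b m) (a : ℕ) (ha : a ≤ F.length) :
    RP G x b (x :: (F.take a ++ m)) := by
  rcases Nat.eq_zero_or_pos a with rfl | ha0
  · simpa using hm.cons hxt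
  · obtain ⟨a, rfl⟩ : ∃ c, a = c + 1 := ⟨a - 1, by omega⟩
    have h1 := h.takeg (m := a) (by omega)
    exact (h1.append (ht _ (List.getElem_mem _)).symm hm).cons (hx v h.left_mem)

theorem arc_end {x t v g : V} {F : List V} (h : RP G v g F) (hx : ∀ p ∈ F, G.Adj x p)
    (ht : ∀ p ∈ F, G.Adj t p) (hxt : G.Adj x t) (a : ℕ) (ha : a ≤ F.length) :
    ∃ b, RP G x b (x :: F.take a) ∧ G.Adj b t := by
  rcases Nat.eq_zero_or_pos a with rfl | ha0
  · exact ⟨x, by simpa using RP.single x, hxt⟩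
  · obtain ⟨a, rfl⟩ : ∃ c, a = c + 1 := ⟨a - 1, by omega⟩
    have h1 := h.takeg (m := a) (by omega)
    exact ⟨_, h1.cons (hx v h.left_mem), (ht _ (List.getElem_mem _)).symm⟩

theorem tri_pan {x t y v g w g2 h u b : V} {F E D : List V} (rF : RP G v g F) (rE : RP G w g2 E)
    (rD : RP G h u D) (hxF : ∀ p ∈ F, G.Adj x p) (htF : ∀ p ∈ F, G.Adj t p)
    (htE : ∀ p ∈ E, G.Adj t p) (hyE : ∀ p ∈ E, G.Adj y p) (hyD : ∀ p ∈ D, G.Adj y p)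
    (hxD : ∀ p ∈ D, G.Adj x p) (hxt : G.Adj x t) (hty : G.Adj t y) (hyx : G.Adj y x)
    (hm : Hm G x b (x :: (F ++ t :: (E ++ y :: D)))) : IsPancyclic G := by
  intro k hk hkn
  have hlen := len_card hm.2.2.1 hm.2.2.2
  simp only [List.length_cons, List.length_append] at hlen
  obtain ⟨i, j, c, hi, hj, hc, hs⟩ : ∃ i j c, i ≤ F.length ∧ j ≤ E.length ∧ c ≤ D.length ∧
      i + j + c + 3 = k := by
    refine ⟨min (k - 3) F.length, min (k - 3 - min (k - 3) F.length) E.length,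
      k - 3 - min (k - 3) F.length - min (k - 3 - min (k - 3) F.length) E.length, ?_, ?_, ?_, ?_⟩ <;>
    omega
  obtain ⟨d, kd, hd⟩ := arc_end rD hyD hxD hyx c hc
  have k2 := arc rF hxF htF hxt (arc rE htE hyE hty kd j hj) i hi
  refine k2.hasCycle ?_ hk ?_ hd
  · refine List.Sublist.nodup ?_ hm.2.2.1
    refine List.Sublist.cons_cons _ (List.Sublist.append (List.take_sublist _ _) ?_)
    refine List.Sublist.cons_cons _ (List.Sublist.append (List.take_sublist _ _) ?_)
    exact List.Sublist.cons_cons _ (List.take_sublist _ _)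
  · simp only [List.length_cons, List.length_append, List.length_take]
    omega

theorem end_game (cx : Ctx G) (hnp : ¬ IsPancyclic G) {x t v g w u : V} {F rest : List V}
    (T : Tri G x t v g w u F rest) : False := by
  have hxt := T.xt cx
  have pF := T.pure cx
  have nbT := T.noback cx
  obtain ⟨hm, rF, rR, xv, gt, tw, ux, hx, ht, lv, lg, lw, lu, cF, uv, vw, uw⟩ := T
  have hnh := hm.nh cx
  have cg := cF g rF.right_mem lg
  obtain ⟨E, y, r2, g2, h, rfl, k1, cE, lg2, g2y, hy, yh, k2, lh, nwh⟩ :=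
    first_new cx (Cl G w) (Cl.closed cx lw) rR hnh.tail.right.tail lw (Cl.refl w)
      ⟨u, rR.right_mem, lu, fun e => uw e.symm⟩
  have nvh : ¬ Cl G v h := nbT h (by simp [k2.left_mem]) lh
  have cg2 := cE g2 k1.right_mem lg2
  have ngw : ¬ Cl G g w := fun e => vw (Cl.trans cx lv lg lw cg e)
  have ngh : ¬ Cl G g h := fun e => nvh (Cl.trans cx lv lg lh cg e)
  have ng2h : ¬ Cl G g2 h := fun e => nwh (Cl.trans cx lw lg2 lh cg2 e)
  have nug2 : ¬ Cl G u g2 := fun e => uw (Cl.trans cx lu lg2 lw e cg2.symm)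
  have nvg2 : ¬ Cl G v g2 := fun e => vw (Cl.trans cx lv lg2 lw e cg2.symm)
  have T2 : Tri G t y w g2 h g E (r2 ++ x :: F) := by
    refine ⟨?_, k1, k2.append ux (rF.cons xv), tw, g2y, yh, gt, ht, hy, lw, lg2, lh, lg, cE, ngw, nwh,
      ngh⟩
    refine hm.perm ((k1.append g2y ((k2.append ux (rF.cons xv)).cons yh)).cons tw) gt ?_
    classical
    rw [List.perm_iff_count]
    intro v
    simp only [List.count_append, List.count_cons]
    ring
  have hty := T2.xt cx
  have pE := T2.pure cx
  have nbT2 := T2.noback cx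
  by_cases hall : ∀ p ∈ r2, ¬ Hv G p → Cl G h p
  · have chu := hall u k2.right_mem lu
    have T3 : Tri G y x h u v g2 r2 (F ++ t :: E) := by
      have rr : RP G v g2 (F ++ t :: E) := rF.append gt (k1.cons tw)
      refine ⟨?_, k2, rr, yh, ux, xv, g2y, hy, hx, lh, lu, lv, lg2, hall, ng2h, fun e => nvh e.symm,
        fun e => nvg2 e.symm⟩
      refine hm.perm ((k2.append ux (rr.cons xv)).cons yh) g2y ?_
      classical
      rw [List.perm_iff_count]
      intro v
      simp only [List.count_append, List.count_cons]
      ring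
    have pD := T3.pure cx
    refine hnp (tri_pan rF k1 k2 ?_ ?_ ?_ ?_ ?_ ?_ hxt hty (T3.xt cx) hm)
    · intro p hp
      exact complete cx lv lu (pF p hp) (fun e => uv e.symm) xv ux.symm (cF p hp (pF p hp)).symm
    · intro p hp
      exact complete cx lg lw (pF p hp) ngw gt.symm tw
        (Cl.trans cx (pF p hp) lv lg (cF p hp (pF p hp)).symm cg)
    · intro p hp
      exact complete cx lw lg (pE p hp) (fun e => ngw e.symm) tw gt.symm (cE p hp (pE p hp)).symm
    · intro p hp
      exact complete cx lg2 lh (pE p hp) ng2h g2y.symm yh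
        (Cl.trans cx (pE p hp) lw lg2 (cE p hp (pE p hp)).symm cg2)
    · intro p hp
      exact complete cx lh lg2 (pD p hp) (fun e => ng2h e.symm) yh g2y.symm
        (hall p hp (pD p hp)).symm
    · intro p hp
      exact complete cx lu lv (pD p hp) uv ux.symm xv
        (Cl.trans cx (pD p hp) lh lu (hall p hp (pD p hp)).symm chu)
  · push Not at hall
    obtain ⟨D, y2, r3, g3, h2, rfl, j1, cD, lg3, g3y, hy2, yh2, j2, lh2, nhh2⟩ :=
      first_new cx (Cl G h) (Cl.closed cx lh) k2 hnh.tail.right.tail.right.tail lh (Cl.refl h) hall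
    have nwh2 : ¬ Cl G w h2 := nbT2 h2 (by simp [j2.left_mem]) lh2
    have ng2h2 : ¬ Cl G g2 h2 := fun e => nwh2 (Cl.trans cx lw lg2 lh2 cg2 e)
    have T3 : Tri G y y2 h g3 h2 g2 D (r3 ++ x :: (F ++ t :: E)) := by
      have rr : RP G h2 g2 (r3 ++ x :: (F ++ t :: E)) :=
        j2.append ux ((rF.append gt (k1.cons tw)).cons xv)
      refine ⟨?_, j1, rr, yh, g3y, yh2, g2y, hy, hy2, lh, lg3, lh2, lg2, cD, ng2h, nhh2, ng2h2⟩
      refine hm.perm ((j1.append g3y (rr.cons yh2)).cons yh) g2y ?_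
      classical
      rw [List.perm_iff_count]
      intro v
      simp only [List.count_append, List.count_cons]
      ring
    have pD := T3.pure cx
    have nbT3 := T3.noback cx
    have nhu : ¬ Cl G h u := nbT3 u (by simp [j2.right_mem]) lu
    have nxy : ¬ G.Adj x y := by
      intro e
      rcases nonadj cx lu lv uv ux.symm xv (fun c => lu (c ▸ hy)) (fun c => lv (c ▸ hy)) e with c | c
      · exact no3 cx lg2 lh ng2h (fun e => nug2 e.symm) nhu g2y.symm yh c
      · exact no3 cx lg2 lh ng2h (fun e => nvg2 e.symm) (fun e => nvh e.symm) g2y.symm yh c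
    have hnd := hm.2.2.1
    have hz : ∃ z, z ∉ [x, y, t, y2] ∧ G.Adj x z ∧ G.Adj y z := by
      by_contra hn
      push Not at hn
      have nd : [x, y, t, y2].Nodup := by
        have nd1 : [x, t, y, y2].Nodup := by
          refine List.Sublist.nodup ?_ hnd
          refine List.Sublist.cons_cons _ ?_
          refine List.Sublist.trans ?_ (List.sublist_append_right _ _)
          refine List.Sublist.cons_cons _ ?_
          refine List.Sublist.trans ?_ (List.sublist_append_right _ _)
          refine List.Sublist.cons_cons _ ?_
          refine List.Sublist.trans ?_ (List.sublist_append_right _ _)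
          simp
        simp at nd1 ⊢
        tauto
      have := deg_out nd (x := x) (y := y) (fun v hv hc => hn v hv hc.1 hc.2)
      have nyx : ¬ G.Adj y x := fun e => nxy e.symm
      have c1 : [x, y, t, y2].countP (fun v => decide (G.Adj x v)) ≤ 2 := by
        simp only [List.countP_cons, List.countP_nil, G.irrefl, nxy]
        simp
        split_ifs <;> omega
      have c2 : [x, y, t, y2].countP (fun v => decide (G.Adj y v)) ≤ 2 := by
        simp only [List.countP_cons, List.countP_nil, G.irrefl, nyx]
        simp
        split_ifs <;> omega
      unfold Hv at hx hy
      simp only [List.length_cons, List.length_nil] at this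
      omega
    obtain ⟨z, hzl, xz, yz⟩ := hz
    simp only [List.mem_cons, List.not_mem_nil, or_false, not_or] at hzl
    have hzH : Hv G z := by
      by_contra lz
      have a1 : Cl G u z ∨ Cl G v z := by
        by_contra hc
        push Not at hc
        exact no3 cx lu lv uv hc.1 hc.2 ux.symm xv xz
      have a2 : Cl G g2 z ∨ Cl G h z := by
        by_contra hc
        push Not at hc
        exact no3 cx lg2 lh ng2h hc.1 hc.2 g2y.symm yh yz
      rcases a1 with a1 | a1 <;> rcases a2 with a2 | a2
      · exact nug2 (Cl.trans cx lu lz lg2 a1 a2.symm)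
      · exact nhu (Cl.trans cx lh lz lu a2 a1.symm)
      · exact nvg2 (Cl.trans cx lv lz lg2 a1 a2.symm)
      · exact nvh (Cl.trans cx lv lz lh a1 a2.symm)
    have hz3 : z ∈ r3 := by
      have := hm.2.2.2 z
      simp only [List.mem_cons, List.mem_append] at this
      rcases this with c | c | c | c | c | c | c | c
      · exact absurd c hzl.1
      · exact absurd hzH (pF z c)
      · exact absurd c hzl.2.2.1
      · exact absurd hzH (pE z c)
      · exact absurd c hzl.2.1
      · exact absurd hzH (pD z c)
      · exact absurd c hzl.2.2.2
      · exact c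
    obtain ⟨q1, q2, rfl⟩ := List.append_of_mem hz3
    have hq1 : q1 ≠ [] := by
      rintro rfl
      have := j2.head
      subst this
      exact lh2 hzH
    have hq2 : q2 ≠ [] := by
      rintro rfl
      have := j2.last
      subst this
      exact lu hzH
    obtain ⟨p, i1, i2, pz⟩ := j2.split_cons hq1
    obtain ⟨q, _, i3, zq⟩ := i2.tail hq2
    have hn3 : NH G (q1 ++ z :: q2) := hnh.tail.right.tail.right.tail.right.tail
    have lp : ¬ Hv G p := hn3.prev_light i1 hzH
    have nvp : ¬ Cl G v p := nbT p (by simp [i1.right_mem]) lp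
    have nwp : ¬ Cl G w p := nbT2 p (by simp [i1.right_mem]) lp
    have nhp : ¬ Cl G h p := nbT3 p (by simp [i1.right_mem]) lp
    have ng2p : ¬ Cl G g2 p := fun e => nwp (Cl.trans cx lw lg2 lp cg2 e)
    have nup : ¬ Cl G u p := by
      have h' : Hm G x u (x :: ((F ++ t :: (E ++ y :: (D ++ y2 :: q1))) ++ z :: q2)) := by
        simpa using hm
      have rr : RP G v p (F ++ t :: (E ++ y :: (D ++ y2 :: q1))) :=
        rF.append gt ((k1.append g2y ((j1.append g3y (i1.cons yh2)).cons yh)).cons tw)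
      have a1 := (twoOpt cx h' rr i3 xv pz zq ux hx hzH xz).1
      have a2 : p ≠ u :=
        (List.nodup_append.1 (List.nodup_cons.1 h'.2.2.1).2).2.2 p rr.right_mem u
          (by simp [i3.right_mem])
      rintro (c | c)
      · exact a2 c.symm
      · exact a1 c.symm
    have nel : ∀ s, ¬ Hv G s → z ≠ s := fun s ls c => ls (c ▸ hzH)
    rcases nonadj cx lu lv uv ux.symm xv (nel u lu) (nel v lv) xz with a1 | a1 <;>
    rcases nonadj cx lg2 lh ng2h g2y.symm yh (nel g2 lg2) (nel h lh) yz with a2 | a2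
    · exact no3 cx lu lg2 nug2 nup ng2p a1 a2 pz.symm
    · exact no3 cx lu lh (fun e => nhu e.symm) nup nhp a1 a2 pz.symm
    · exact no3 cx lv lg2 nvg2 nvp ng2p a1 a2 pz.symm
    · exact no3 cx lv lh nvh nvp nhp a1 a2 pz.symm

end EndGame

theorem main_aux {V : Type} [Fintype V] (G : SimpleGraph V)
    [DecidableRel G.Adj] (h2 : TwoConnected G) (hnc : ¬ IsCycleGraph G)
    (hclaw : F1Heavy G claw) (hP4 : F1Heavy G (pathGraph 4)) :
    IsPancyclic G := by
  by_contra hnp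
  have hC := clawC_of hclaw
  have hP := pathC_of hP4
  obtain ⟨a, b, l, hm⟩ := hamiltonian h2 hC hP
  have hm : Hm G a b l := hm
  have hcon : G.Connected := by
    have hne : Nonempty V := ⟨a⟩
    refine ⟨fun p q => ?_⟩
    obtain ⟨b1, T, hT⟩ := hm.start p
    have hq := hT.2.2.2 q
    obtain ⟨l1, l2, e⟩ := List.append_of_mem hq
    rcases List.eq_nil_or_concat l1 with rfl | ⟨_, _, rfl⟩
    · simp at e
      rw [e.1]
    · have hr := hT.1
      rw [e] at hr
      obtain ⟨c, k1, _, k3⟩ := hr.split_cons (by simp)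
      obtain ⟨wk, _⟩ := (k1.snoc k3).exists_walk
      exact wk.reachable
  have cx : Ctx G := by
    refine ⟨hC, hP, nc_of hnp, ?_⟩
    intro u v w hu hv huv nuv hwu hwv
    exact bad_triple hcon hnc hC hP hm hnp hu hv huv nuv hwu hwv
  obtain ⟨x, t, v, g, w, u, F, rest, T⟩ := get_tri cx h2.1 hm hnp
  exact end_game cx hnp T

end PanP4

theorem pancyclic_of_claw_P4_f1_heavy {V : Type} [Fintype V] (G : SimpleGraph V)
    [DecidableRel G.Adj] (h2 : TwoConnected G) (hnc : ¬ IsCycleGraph G)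
    (hclaw : F1Heavy G claw) (hP4 : F1Heavy G (pathGraph 4)) :
    IsPancyclic G :=
  PanP4.main_aux G h2 hnc hclaw hP4
end

section
/- Let G be a 2-connected graph which is not a cycle. If G is both K_{1,3}-f_1-heavy and Z_1-f_1-heavy, then G is pancyclic. -/
open SimpleGraph

/-- Cyclic lists: `l` traverses a cycle of the relation `r`. -/
def CycL {V : Type} (r : V → V → Prop) (l : List V) : Prop :=
  l.Nodup ∧ 3 ≤ l.length ∧ l.IsChain r ∧ ∀ a ∈ l.getLast?, ∀ b ∈ l.head?, r a b

/-- Append characterisation for nonempty blocks. -/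
lemma cycL_append {V : Type} {r : V → V → Prop} {A B : List V} (hA : A ≠ []) (hB : B ≠ []) :
    CycL r (A ++ B) ↔ (A ++ B).Nodup ∧ 3 ≤ A.length + B.length ∧ A.IsChain r ∧ B.IsChain r ∧
      r (A.getLast hA) (B.head hB) ∧ r (B.getLast hB) (A.head hA) := by
  unfold CycL
  rw [List.isChain_append]
  simp only [List.length_append]
  have e1 : (A ++ B).getLast? = some (B.getLast hB) := by
    rw [List.getLast?_append, List.getLast?_eq_some_getLast hB]; rfl
  have e2 : (A ++ B).head? = some (A.head hA) := by
    rw [List.head?_append, List.head?_eq_some_head hA]; rfl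
  rw [e1, e2, List.getLast?_eq_some_getLast hA, List.head?_eq_some_head hB]
  simp only [Option.mem_def, Option.some.injEq, forall_eq']
  tauto

lemma CycL.rotate {V : Type} {r : V → V → Prop} {A B : List V} (h : CycL r (A ++ B)) :
    CycL r (B ++ A) := by
  by_cases hA : A = []
  · simpa [hA] using h
  by_cases hB : B = []
  · simpa [hB] using h
  rw [cycL_append hA hB] at h
  rw [cycL_append hB hA]
  obtain ⟨h1, h2, h3, h4, h5, h6⟩ := h
  exact ⟨(List.perm_append_comm.nodup_iff).1 h1, by omega, h4, h3, h6, h5⟩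

lemma CycL.reverse {V : Type} {r : V → V → Prop} (hr : ∀ a b, r a b → r b a) {l : List V}
    (h : CycL r l) : CycL r l.reverse := by
  obtain ⟨h1, h2, h3, h4⟩ := h
  refine ⟨by simpa using h1, by simpa using h2, ?_, ?_⟩
  · rw [List.isChain_reverse]
    exact h3.imp (fun a b => hr a b)
  · intro a ha b hb
    simp at ha hb
    exact hr _ _ (h4 b (by simpa using hb) a (by simpa using ha))

lemma CycL.hasCycle {V : Type} {G : SimpleGraph V} {l : List V} (h : CycL G.Adj l) :
    HasCycleLength G l.length := by
  obtain ⟨h1, h2, h3, h4⟩ := h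
  have hne : l ≠ [] := by rintro rfl; simp at h2
  have hadj : G.Adj (l.getLast hne) (l.head hne) :=
    h4 _ (List.getLast?_eq_some_getLast hne) _ (List.head?_eq_some_head hne)
  have hlen : (Walk.ofSupport l hne h3).length + 1 = l.length := by
    rw [← Walk.length_support, Walk.support_ofSupport]
  refine ⟨_, Walk.cons hadj (Walk.ofSupport l hne h3), ?_, ?_⟩
  · rw [Walk.isCycle_iff_isPath_tail_and_le_length]
    constructor
    · simp only [Walk.getVert_cons_succ, Walk.tail_cons, Walk.isPath_copy]
      rw [Walk.isPath_def, Walk.support_ofSupport]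
      exact h1
    · rw [Walk.length_cons, hlen]
      exact h2
  · simpa using hlen

/-- 2-connectedness in cut form. -/
lemma cutForm {V : Type} [Fintype V] {G : SimpleGraph V} (h2 : TwoConnected G) (v : V)
    (S : Set V) (hv : v ∉ S) (hS : S.Nonempty)
    (hc : ∀ a ∈ S, ∀ b, G.Adj a b → b ∈ S ∨ b = v) : ∀ b, b ∈ S ∨ b = v := by
  intro b
  by_contra! hb
  obtain ⟨s, hs⟩ := hS
  have hsv : s ≠ v := fun h => hv (h ▸ hs)
  obtain ⟨w⟩ := (h2.2 v).preconnected ⟨s, hsv⟩ ⟨b, hb.2⟩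
  have key : ∀ (x y : {u : V | u ≠ v}) (w : (G.induce {u : V | u ≠ v}).Walk x y),
      x.1 ∈ S → y.1 ∈ S := by
    intro x y w
    induction w with
    | nil => exact id
    | @cons a b c hab _ ih =>
      intro ha
      refine ih ((hc _ ha _ hab).resolve_right b.2)
  exact hb.1 (key _ _ w hs)

lemma connForm {V : Type} [Fintype V] {G : SimpleGraph V} (h2 : TwoConnected G)
    (S : Set V) (hS : S.Nonempty)
    (hc : ∀ a ∈ S, ∀ b, G.Adj a b → b ∈ S) : ∀ b, b ∈ S := by
  classical
  intro v
  by_contra hv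
  obtain ⟨s, hs⟩ := hS
  have h3 := h2.1
  have h := cutForm h2 v S hv ⟨s, hs⟩ (fun a ha b hb => Or.inl (hc a ha b hb))
  have : ∃ t, t ≠ s ∧ t ≠ v := by
    by_contra! hh
    have : (Finset.univ : Finset V) ⊆ {s, v} := by
      intro t _
      by_cases e : t = s
      · simp [e]
      · simp [hh t e]
    have := Finset.card_le_card this
    have h4 := Finset.card_le_two (a := s) (b := v)
    rw [Finset.card_univ] at this
    omega
  obtain ⟨t, ht1, ht2⟩ := this
  have := cutForm h2 s (S \ {s}) (by simp) ⟨t, (h t).resolve_right ht2, ht1⟩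
    (fun a ha b hb => by
      by_cases e : b = s
      · exact Or.inr e
      · exact Or.inl ⟨hc a ha.1 b hb, e⟩) v
  rcases this with h | h
  · exact hv h.1
  · exact hv (h ▸ hs)

lemma exists_third {V : Type} [Fintype V] (h3 : 3 ≤ Fintype.card V) (s v : V) :
    ∃ t, t ≠ s ∧ t ≠ v := by
  classical
  by_contra! hh
  have : (Finset.univ : Finset V) ⊆ {s, v} := by
    intro t _
    by_cases e : t = s
    · simp [e]
    · simp [hh t e]
  have := Finset.card_le_card this
  have h4 := Finset.card_le_two (a := s) (b := v)
  rw [Finset.card_univ] at this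
  omega

lemma two_nbrs {V : Type} [Fintype V] {G : SimpleGraph V} (h2 : TwoConnected G) (v c : V) :
    ∃ b, G.Adj v b ∧ b ≠ c := by
  by_contra! hh
  by_cases e : c = v
  · obtain ⟨t, ht, _⟩ := exists_third h2.1 v v
    have := connForm h2 {v} ⟨v, rfl⟩ (fun a ha b hb => by
      obtain rfl : a = v := ha
      have := hh b hb
      exact absurd (this.trans e) hb.ne') t
    exact ht this
  · obtain ⟨t, ht, ht'⟩ := exists_third h2.1 v c
    rcases cutForm h2 c {v} (by simpa using e) ⟨v, rfl⟩ (fun a ha b hb => by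
      obtain rfl : a = v := ha
      exact Or.inr (hh b hb)) t with h | h
    · exact ht h
    · exact ht' h

lemma conn_of_two {V : Type} [Fintype V] {G : SimpleGraph V} (h2 : TwoConnected G) :
    G.Connected := by
  have : Nonempty V := by
    have := h2.1
    exact Fintype.card_pos_iff.1 (by omega)
  refine ⟨fun a b => ?_⟩
  exact connForm h2 {x | G.Reachable a x} ⟨a, Reachable.refl _⟩
    (fun x hx y hy => hx.trans hy.reachable) b

/-- Heavy vertices. -/
def Heavy {V : Type} [Fintype V] (G : SimpleGraph V) [DecidableRel G.Adj] (v : V) : Prop :=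
  Fintype.card V + 1 ≤ 2 * G.degree v

lemma light_pair {V : Type} [Fintype V] {G : SimpleGraph V}
    [DecidableRel G.Adj]
    (hclaw : F1Heavy G claw) (hZ1 : F1Heavy G (Zgraph 1)) {u v w x : V}
    (hu : ¬ Heavy G u) (hv : ¬ Heavy G v) (huv : u ≠ v) (hn : ¬ G.Adj u v)
    (hwu : G.Adj w u) (hwv : G.Adj w v) (hwx : G.Adj w x) (hxu : x ≠ u) (hxv : x ≠ v) :
    G.Adj x u ∧ G.Adj x v := by
  have paw : ∀ {u v : V}, ¬ Heavy G u → ¬ Heavy G v → u ≠ v → ¬ G.Adj u v → G.Adj w u →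
      G.Adj w v → x ≠ u → x ≠ v → G.Adj x u → G.Adj x v := by
    intro u v hu hv huv hn hwu hwv hxu hxv h
    by_contra hx
    have hn' : ¬ G.Adj v u := fun h => hn h.symm
    have hx' : ¬ G.Adj v x := fun h => hx h.symm
    have i1 := hwu.symm
    have i2 := hwv.symm
    have i3 := hwx.symm
    have i4 := h.symm
    have i5 := hwu.ne
    have i6 := hwv.ne
    have i7 := hwx.ne
    let f : Zgraph 1 ↪g G :=
      { toFun := ![u, x, w, v]
        inj' := by
          intro a b
          fin_cases a <;> fin_cases b <;> simp <;> intro hh <;> simp_all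
        map_rel_iff' := by
          intro a b
          fin_cases a <;> fin_cases b <;> simp [Zgraph, SimpleGraph.fromRel_adj] <;> assumption }
    have a1 : (Zgraph 1).Adj 0 2 := by simp [Zgraph, SimpleGraph.fromRel_adj]
    have a2 : (Zgraph 1).Adj 2 3 := by simp [Zgraph, SimpleGraph.fromRel_adj]
    have hd : (Zgraph 1).dist 0 3 = 2 := by
      have hle : (Zgraph 1).dist 0 3 ≤ 2 :=
        SimpleGraph.dist_le (Walk.cons a1 (Walk.cons a2 Walk.nil))
      have h1 : (Zgraph 1).dist 0 3 ≠ 1 := by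
        rw [Ne, SimpleGraph.dist_eq_one_iff_adj]
        simp [Zgraph, SimpleGraph.fromRel_adj]
      have h0 : (Zgraph 1).dist 0 3 ≠ 0 := by
        intro h0
        have hr : (Zgraph 1).Reachable 0 3 :=
          ⟨(Walk.cons a1 (Walk.cons a2 Walk.nil))⟩
        have := hr.dist_eq_zero_iff.1 h0
        simp at this
      omega
    have := hZ1 f 0 3 hd
    have e0 : f 0 = u := rfl
    have e3 : f 3 = v := rfl
    rw [e0, e3] at this
    unfold Heavy at hu hv
    rcases max_choice (G.degree u) (G.degree v) with h | h <;> rw [h] at this <;> omega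
  by_cases h1 : G.Adj x u
  · exact ⟨h1, paw hu hv huv hn hwu hwv hxu hxv h1⟩
  by_cases h2 : G.Adj x v
  · exact ⟨paw hv hu huv.symm (fun h => hn h.symm) hwv hwu hxv hxu h2, h2⟩
  exfalso
  have hn' : ¬ G.Adj v u := fun h => hn h.symm
  have h1' : ¬ G.Adj u x := fun h => h1 h.symm
  have h2' : ¬ G.Adj v x := fun h => h2 h.symm
  have i1 := hwu.symm
  have i2 := hwv.symm
  have i3 := hwx.symm
  have i5 := hwu.ne
  have i6 := hwv.ne
  have i7 := hwx.ne
  let f : claw ↪g G :=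
    { toFun := ![w, u, v, x]
      inj' := by
        intro a b
        fin_cases a <;> fin_cases b <;> simp <;> intro hh <;> simp_all
      map_rel_iff' := by
        intro a b
        fin_cases a <;> fin_cases b <;> simp [claw, SimpleGraph.fromRel_adj] <;> assumption }
  have a1 : claw.Adj 1 0 := by simp [claw, SimpleGraph.fromRel_adj]
  have a2 : claw.Adj 0 2 := by simp [claw, SimpleGraph.fromRel_adj]
  have hd : claw.dist 1 2 = 2 := by
    have hle : claw.dist 1 2 ≤ 2 :=
      SimpleGraph.dist_le (Walk.cons a1 (Walk.cons a2 Walk.nil))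
    have h1 : claw.dist 1 2 ≠ 1 := by
      rw [Ne, SimpleGraph.dist_eq_one_iff_adj]
      simp [claw, SimpleGraph.fromRel_adj]
    have h0 : claw.dist 1 2 ≠ 0 := by
      intro h0
      have hr : claw.Reachable 1 2 :=
        ⟨(Walk.cons a1 (Walk.cons a2 Walk.nil))⟩
      have := hr.dist_eq_zero_iff.1 h0
      simp at this
    omega
  have := hclaw f 1 2 hd
  have e0 : f 1 = u := rfl
  have e3 : f 2 = v := rfl
  rw [e0, e3] at this
  unfold Heavy at hu hv
  rcases max_choice (G.degree u) (G.degree v) with h | h <;> rw [h] at this <;> omega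

/-- The key local property of light pairs at distance two. -/
def LightPair {V : Type} [Fintype V] (G : SimpleGraph V) [DecidableRel G.Adj] : Prop :=
  ∀ u v w x : V, ¬ Heavy G u → ¬ Heavy G v → u ≠ v → ¬ G.Adj u v → G.Adj w u → G.Adj w v →
    G.Adj w x → x ≠ u → x ≠ v → G.Adj x u ∧ G.Adj x v

/-- The light neighbours of a heavy vertex form a clique. -/
def LightClique {V : Type} [Fintype V] (G : SimpleGraph V) [DecidableRel G.Adj] : Prop :=
  ∀ u v w : V, ¬ Heavy G u → ¬ Heavy G v → Heavy G w → u ≠ v → G.Adj w u → G.Adj w v → G.Adj u v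

lemma lightClique {V : Type} [Fintype V] {G : SimpleGraph V} [DecidableRel G.Adj]
    (h2 : TwoConnected G) (h5 : 5 ≤ Fintype.card V) (LP : LightPair G) : LightClique G := by
  classical
  intro u v w hu hv hw huv hwu hwv
  by_contra hn
  -- the set `W`
  set W : Finset V := insert w ((G.neighborFinset w).erase u |>.erase v) with hW
  have hWc : W.card + 1 = G.degree w := by
    rw [hW, Finset.card_insert_of_notMem (by simp), Finset.card_erase_of_mem (by simp [huv.symm, hwv]),
      Finset.card_erase_of_mem (by simp [hwu]), G.card_neighborFinset_eq_degree]
    have : 2 ≤ G.degree w := by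
      rw [← G.card_neighborFinset_eq_degree]
      have : ({u, v} : Finset V) ⊆ G.neighborFinset w := by
        intro t ht
        simp at ht
        rcases ht with rfl | rfl <;> simpa
      have := Finset.card_le_card this
      rwa [Finset.card_pair huv] at this
    omega
  have hWu : W ⊆ G.neighborFinset u := by
    intro t ht
    simp [hW] at ht
    rcases ht with rfl | ⟨h1, h2, h3⟩
    · simpa using hwu.symm
    · simpa using (LP u v w t hu hv huv hn hwu hwv h3 h2 h1).1.symm
  have hWv : W ⊆ G.neighborFinset v := by
    intro t ht
    simp [hW] at ht
    rcases ht with rfl | ⟨h1, h2, h3⟩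
    · simpa using hwv.symm
    · simpa using (LP u v w t hu hv huv hn hwu hwv h3 h2 h1).2.symm
  unfold Heavy at hu hv hw
  have eu : W = G.neighborFinset u :=
    Finset.eq_of_subset_of_card_le hWu (by rw [G.card_neighborFinset_eq_degree]; omega)
  have ev : W = G.neighborFinset v :=
    Finset.eq_of_subset_of_card_le hWv (by rw [G.card_neighborFinset_eq_degree]; omega)
  have mu : ∀ t, t ∈ W ↔ G.Adj u t := by intro t; rw [eu]; simp
  have mv : ∀ t, t ∈ W ↔ G.Adj v t := by intro t; rw [ev]; simp
  have hall := connForm h2 {t | t ∈ W ∨ t = u ∨ t = v} ⟨u, by simp⟩ (by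
    intro a ha b hab
    by_cases e1 : b = u
    · simp [e1]
    by_cases e2 : b = v
    · simp [e2]
    left
    rcases ha with ha | rfl | rfl
    · rw [mu]
      exact (LP u v a b (by unfold Heavy; exact hu) (by unfold Heavy; exact hv) huv hn ((mu a).1 ha).symm ((mv a).1 ha).symm hab e1 e2).1.symm
    · exact (mu b).2 hab
    · exact (mv b).2 hab)
  have hsub : (Finset.univ : Finset V) ⊆ insert u (insert v W) := by
    intro t _
    have := hall t
    simp only [Set.mem_ofPred_eq] at this
    simp only [Finset.mem_insert]
    tauto
  have := Finset.card_le_card hsub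
  have h4 := Finset.card_insert_le u (insert v W)
  have h5 := Finset.card_insert_le v W
  have h6 : W.card = G.degree u := by rw [eu, G.card_neighborFinset_eq_degree]
  rw [Finset.card_univ] at this
  omega

lemma exists_heavy {V : Type} [Fintype V] {G : SimpleGraph V} [DecidableRel G.Adj]
    (h2 : TwoConnected G) (h5 : 5 ≤ Fintype.card V) (hnc : ¬ IsCycleGraph G)
    (LP : LightPair G) : ∃ w, Heavy G w := by
  classical
  by_contra! hl
  have : ∃ v, G.degree v ≠ 2 := by
    by_contra! h
    exact hnc ⟨conn_of_two h2, h⟩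
  obtain ⟨v, hv⟩ := this
  have hv3 : 3 ≤ G.degree v := by
    obtain ⟨a, ha, _⟩ := two_nbrs h2 v v
    obtain ⟨b, hb, hab⟩ := two_nbrs h2 v a
    have : ({a, b} : Finset V) ⊆ G.neighborFinset v := by
      intro t ht
      simp at ht
      rcases ht with rfl | rfl <;> simpa
    have := Finset.card_le_card this
    rw [Finset.card_pair hab.symm, G.card_neighborFinset_eq_degree] at this
    omega
  have hvl := hl v
  unfold Heavy at hvl
  -- a vertex at distance two
  have : ∃ a b, G.Adj v a ∧ G.Adj a b ∧ b ≠ v ∧ ¬ G.Adj v b := by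
    by_contra! h
    have hall := connForm h2 {t | t = v ∨ G.Adj v t} ⟨v, by simp⟩ (by
      rintro a ha b hab
      by_cases e : b = v
      · simp [e]
      right
      rcases ha with rfl | ha
      · exact hab
      · exact h a b ha hab e)
    have hsub : (Finset.univ : Finset V) ⊆ insert v (G.neighborFinset v) := by
      intro t _
      simpa using hall t
    have h1 := Finset.card_le_card hsub
    have h4 := Finset.card_insert_le v (G.neighborFinset v)
    rw [G.card_neighborFinset_eq_degree] at h4
    rw [Finset.card_univ] at h1
    omega
  obtain ⟨a, b, hva, hab, hbv, hnvb⟩ := this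
  -- common neighbours only see common neighbours
  have hM : ∀ m x, G.Adj v m → G.Adj b m → G.Adj m x → x ≠ v → x ≠ b → G.Adj x v ∧ G.Adj x b :=
    fun m x h1 h2 h3 h4 h5 => LP v b m x (hl v) (hl b) hbv.symm hnvb h1.symm h2.symm h3 h4 h5
  by_cases hr : ∃ r, G.Adj v r ∧ ¬ G.Adj b r
  · obtain ⟨r, hvr, hbr⟩ := hr
    have hrb : r ≠ b := by rintro rfl; exact hnvb hvr
    have hra : r ≠ a := by rintro rfl; exact hbr hab.symm
    have hnra : ¬ G.Adj r a := fun h =>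
      hbr (hM a r hva hab.symm h.symm hvr.ne' hrb).2.symm
    have : ∃ x, G.Adj v x ∧ x ≠ r ∧ x ≠ a := by
      by_contra! h
      have : G.neighborFinset v ⊆ {r, a} := by
        intro t ht
        simp at ht
        by_cases e : t = r
        · simp [e]
        · simp [h t ht e]
      have := Finset.card_le_card this
      rw [G.card_neighborFinset_eq_degree] at this
      have := Finset.card_le_two (a := r) (b := a)
      omega
    obtain ⟨x, hvx, hxr, hxa⟩ := this
    obtain ⟨h1, h3⟩ := LP r a v x (hl r) (hl a) hra hnra hvr hva hvx hxr hxa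
    have hxb : x ≠ b := by rintro rfl; exact hnvb hvx
    have := hM a x hva hab.symm h3.symm hvx.ne' hxb
    exact hbr (hM x r hvx this.2.symm h1 hvr.ne' hrb).2.symm
  · push Not at hr
    have hall := cutForm h2 b {t | t = v ∨ G.Adj v t} (by simp [hbv, hnvb]) ⟨v, by simp⟩ (by
      rintro c hc d hcd
      by_cases e : d = v
      · simp [e]
      by_cases e' : d = b
      · simp [e']
      left; right
      rcases hc with rfl | hc
      · exact hcd
      · exact (hM c d hc (hr c hc) hcd e e').1.symm)
    have hsub : (Finset.univ : Finset V) ⊆ insert b (insert v (G.neighborFinset v)) := by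
      intro t _
      have := hall t
      simp only [Set.mem_ofPred_eq] at this
      simp only [Finset.mem_insert, mem_neighborFinset]
      tauto
    have h1 := Finset.card_le_card hsub
    have h4 := Finset.card_insert_le v (G.neighborFinset v)
    have h6 := Finset.card_insert_le b (insert v (G.neighborFinset v))
    rw [G.card_neighborFinset_eq_degree] at h4
    rw [Finset.card_univ] at h1
    omega

lemma three_heavy {V : Type} [Fintype V] {G : SimpleGraph V} [DecidableRel G.Adj]
    [DecidablePred (Heavy G)] (LC : LightClique G) (hex : ∃ w, Heavy G w) :
    3 ≤ (Finset.univ.filter (Heavy G)).card := by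
  classical
  set H := Finset.univ.filter (Heavy G) with hH
  have mH : ∀ x, x ∈ H ↔ Heavy G x := by intro x; simp [hH]
  -- a general bound
  have key : ∀ w x, Heavy G w → ¬ Heavy G x → G.Adj w x → ∀ T : Finset V,
      (∀ t ∈ T, Heavy G t ∧ G.Adj x t) →
      (G.neighborFinset w \ H).card + T.card ≤ G.degree x + 1 := by
    intro w x hw hx hwx T hT
    have hxm : x ∈ G.neighborFinset w \ H := by simp [mH, hwx, hx]
    have hsub : ((G.neighborFinset w \ H).erase x) ∪ T ⊆ G.neighborFinset x := by
      intro t ht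
      simp only [Finset.mem_union, Finset.mem_erase, Finset.mem_sdiff, mem_neighborFinset, mH] at ht
      rw [mem_neighborFinset]
      rcases ht with ⟨h1, h2, h3⟩ | h
      · exact LC x t w hx h3 hw h1.symm hwx h2
      · exact (hT t h).2
    have hdis : Disjoint ((G.neighborFinset w \ H).erase x) T := by
      rw [Finset.disjoint_left]
      intro t ht ht'
      simp only [Finset.mem_erase, Finset.mem_sdiff, mH] at ht
      exact ht.2.2 (hT t ht').1
    have h1 := Finset.card_le_card hsub
    rw [Finset.card_union_of_disjoint hdis, Finset.card_erase_of_mem hxm,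
      G.card_neighborFinset_eq_degree] at h1
    have := Finset.card_pos.2 ⟨x, hxm⟩
    omega
  have low : ∀ w, Heavy G w → G.degree w + 1 ≤ (G.neighborFinset w \ H).card + H.card := by
    intro w hw
    have h1 : G.neighborFinset w ⊆ (G.neighborFinset w \ H) ∪ H.erase w := by
      intro t ht
      simp only [mem_neighborFinset] at ht
      simp only [Finset.mem_union, Finset.mem_sdiff, mem_neighborFinset, Finset.mem_erase]
      have := ht.ne'
      tauto
    have h2 := (Finset.card_le_card h1).trans (Finset.card_union_le _ _)
    rw [G.card_neighborFinset_eq_degree, Finset.card_erase_of_mem ((mH w).2 hw)] at h2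
    have := Finset.card_pos.2 ⟨w, (mH w).2 hw⟩
    omega
  by_contra hlt
  obtain ⟨w, hw⟩ := hex
  have hpos := Finset.card_pos.2 ⟨w, (mH w).2 hw⟩
  have hc : H.card = 1 ∨ H.card = 2 := by omega
  rcases hc with hc | hc
  · have hl := low w hw
    have hw' := hw
    unfold Heavy at hw'
    have : (G.neighborFinset w \ H).Nonempty := by
      rw [← Finset.card_pos]; omega
    obtain ⟨x, hx⟩ := this
    simp only [Finset.mem_sdiff, mem_neighborFinset, mH] at hx
    have := key w x hw hx.2 hx.1 {w} (by simp [hw, hx.1.symm])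
    have hxl := hx.2
    unfold Heavy at hxl
    simp at this
    omega
  · obtain ⟨w1, w2, hne, he⟩ := Finset.card_eq_two.1 hc
    have g1 : Heavy G w1 := by rw [← mH, he]; simp
    have g2 : Heavy G w2 := by rw [← mH, he]; simp
    have l1 := low w1 g1
    have l2 := low w2 g2
    have g1' := g1
    have g2' := g2
    unfold Heavy at g1' g2'
    by_cases hd : Disjoint (G.neighborFinset w1 \ H) (G.neighborFinset w2 \ H)
    · have hd2 : Disjoint ((G.neighborFinset w1 \ H) ∪ (G.neighborFinset w2 \ H)) H := by
        rw [Finset.disjoint_left]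
        intro t ht
        simp only [Finset.mem_union, Finset.mem_sdiff] at ht
        tauto
      have := Finset.card_le_univ (((G.neighborFinset w1 \ H) ∪ (G.neighborFinset w2 \ H)) ∪ H)
      rw [Finset.card_union_of_disjoint hd2, Finset.card_union_of_disjoint hd] at this
      omega
    · rw [Finset.not_disjoint_iff] at hd
      obtain ⟨x, hx1, hx2⟩ := hd
      simp only [Finset.mem_sdiff, mem_neighborFinset, mH] at hx1 hx2
      have := key w1 x g1 hx1.2 hx1.1 {w1, w2} (by simp [g1, g2, hx1.1.symm, hx2.1.symm])
      rw [Finset.card_pair hne] at this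
      have hxl := hx1.2
      unfold Heavy at hxl
      omega

/-- Rotation lemma: if `l` is cyclic for `r` but not for `s`, we can rotate so that the
failure is at the closing edge. -/
lemma exists_rot {V : Type} {r s : V → V → Prop} {l : List V} (h : CycL r l) (hs : ¬ CycL s l) :
    ∃ p : List V, CycL r p ∧ (∀ v, v ∈ p ↔ v ∈ l) ∧ p.length = l.length ∧
      ∃ a ∈ p.getLast?, ∃ b ∈ p.head?, ¬ s a b := by
  have hs' : ¬ (l.IsChain s ∧ ∀ a ∈ l.getLast?, ∀ b ∈ l.head?, s a b) :=
    fun hh => hs ⟨h.1, h.2.1, hh⟩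
  by_cases hc : l.IsChain s
  · have : ¬ ∀ a ∈ l.getLast?, ∀ b ∈ l.head?, s a b := fun hh => hs' ⟨hc, hh⟩
    push Not at this
    exact ⟨l, h, fun v => Iff.rfl, rfl, this⟩
  · rw [List.isChain_iff_getElem] at hc
    push Not at hc
    obtain ⟨i, hi, hn⟩ := hc
    have e : l.take (i+1) ++ l.drop (i+1) = l := List.take_append_drop _ _
    refine ⟨l.drop (i+1) ++ l.take (i+1), ?_, ?_, ?_, l[i], ?_, l[i+1], ?_, hn⟩
    · apply CycL.rotate
      rw [e]; exact h
    · intro v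
      conv_rhs => rw [← e]
      simp only [List.mem_append]
      tauto
    · simp; omega
    · rw [List.getLast?_append, List.getLast?_take]
      simp [show i < l.length by omega]
    · rw [List.head?_append, List.head?_drop]
      simp [hi]

lemma formPerm_rel {V : Type} [DecidableEq V] {r : V → V → Prop} {l : List V} (h : CycL r l) :
    ∀ v ∈ l, r v (l.formPerm v) := by
  intro v hv
  obtain ⟨h1, h2, h3, h4⟩ := h
  obtain ⟨i, hi, rfl⟩ := List.mem_iff_getElem.1 hv
  rw [List.formPerm_apply_getElem l h1 i hi]
  by_cases e : i + 1 < l.length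
  · rw [List.isChain_iff_getElem] at h3
    have := h3 i e
    simpa only [Nat.mod_eq_of_lt e] using this
  · have e' : i + 1 = l.length := by omega
    have : (i + 1) % l.length = 0 := by rw [e']; exact Nat.mod_self _
    simp only [this]
    apply h4
    · rw [List.getLast?_eq_getElem?]
      have : l.length - 1 = i := by omega
      rw [this]
      simp [hi]
    · rw [List.head?_eq_getElem?]
      simp [show 0 < l.length by omega]

lemma idx_deg {V : Type} [Fintype V] {G : SimpleGraph V} [DecidableRel G.Adj] {f : ℕ → V} {n : ℕ}
    (hs : ∀ v, ∃ i < n, f i = v) (x : V) :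
    G.degree x ≤ ((Finset.range n).filter (fun j => G.Adj x (f j))).card := by
  classical
  rw [← G.card_neighborFinset_eq_degree]
  refine (Finset.card_le_card (t := ((Finset.range n).filter (fun j => G.Adj x (f j))).image f) ?_).trans
    Finset.card_image_le
  intro t ht
  obtain ⟨i, hi, rfl⟩ := hs t
  simp at ht
  simp only [Finset.mem_image, Finset.mem_filter, Finset.mem_range]
  exact ⟨i, ⟨hi, ht⟩, rfl⟩

lemma seg_case1 {V : Type} {G : SimpleGraph V} {f : ℕ → V} {n : ℕ}
    (hinj : ∀ i < n, ∀ j < n, f i = f j → i = j)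
    (hadj : ∀ i, i + 1 < n → G.Adj (f i) (f (i+1))) {j m : ℕ} (hj : 1 ≤ j) (hm : 1 ≤ m)
    (hjm : j + m < n) (h1 : G.Adj (f 0) (f j)) (h2 : G.Adj (f (n-1)) (f (j+m-1)))
    (h3 : G.Adj (f 0) (f (n-1))) :
    CycL G.Adj ((([0] ++ List.range' j m) ++ [n-1]).map f) := by
  refine ⟨?_, by simp; omega, ?_, ?_⟩
  · rw [List.nodup_map_iff_inj_on]
    · intro a ha b hb hab
      simp at ha hb
      exact hinj a (by omega) b (by omega) hab
    · rw [List.nodup_append, List.nodup_append]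
      refine ⟨⟨by simp, List.nodup_range', ?_⟩, by simp, ?_⟩
      · intro a ha b hb
        simp at ha hb
        omega
      · intro a ha b hb
        simp at ha hb
        omega
  · rw [List.isChain_map, List.isChain_append, List.isChain_append]
    refine ⟨⟨by simp, ?_, ?_⟩, by simp, ?_⟩
    · rw [List.isChain_iff_getElem]
      intro i hi
      simp at hi ⊢
      have := hadj (j+i) (by omega)
      exact this
    · intro a ha b hb
      simp at ha
      rw [List.head?_range'] at hb
      simp at hb
      obtain ⟨_, rfl⟩ := hb
      rw [← ha]
      exact h1
    · intro a ha b hb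
      rw [List.getLast?_append, List.getLast?_range'] at ha
      simp [show m ≠ 0 by omega] at ha hb
      subst ha hb
      exact h2.symm
  · intro a ha b hb
    rw [List.map_append, List.getLast?_append] at ha
    simp at ha hb
    subst ha hb
    exact h3.symm

lemma seg_case2 {V : Type} {G : SimpleGraph V} {f : ℕ → V} {n : ℕ}
    (hinj : ∀ i < n, ∀ j < n, f i = f j → i = j)
    (hadj : ∀ i, i + 1 < n → G.Adj (f i) (f (i+1))) {j j' : ℕ} (hj : j' < j) (hjn : j < n)
    (h1 : G.Adj (f 0) (f j)) (h2 : G.Adj (f (n-1)) (f j')) (h3 : 3 ≤ (j' + 1) + (n - j)) :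
    CycL G.Adj ((List.range' 0 (j'+1) ++ (List.range' j (n-j)).reverse).map f) := by
  refine ⟨?_, by simp; omega, ?_, ?_⟩
  · rw [List.nodup_map_iff_inj_on]
    · intro a ha b hb hab
      simp at ha hb
      exact hinj a (by omega) b (by omega) hab
    · rw [List.nodup_append]
      refine ⟨List.nodup_range', by simpa using List.nodup_range', ?_⟩
      intro a ha b hb
      simp at ha hb
      omega
  · rw [List.isChain_map, List.isChain_append, List.isChain_reverse]
    refine ⟨?_, ?_, ?_⟩
    · rw [List.isChain_iff_getElem]
      intro i hi
      simp at hi ⊢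
      exact hadj i (by omega)
    · rw [List.isChain_iff_getElem]
      intro i hi
      simp at hi ⊢
      exact (hadj (j+i) (by omega)).symm
    · intro a ha b hb
      rw [List.getLast?_range'] at ha
      rw [List.head?_reverse, List.getLast?_range'] at hb
      simp [show n - j ≠ 0 by omega] at ha hb
      subst ha hb
      have : j + (n - j) - 1 = n - 1 := by omega
      rw [this]
      exact h2.symm
  · intro a ha b hb
    rw [List.map_append, List.getLast?_append, List.map_reverse, List.getLast?_reverse,
      List.head?_map, List.head?_range'] at ha
    rw [List.map_append, List.head?_append, List.head?_map, List.head?_range'] at hb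
    simp [show n - j ≠ 0 by omega] at ha hb
    subst ha hb
    exact h1.symm

lemma bondy {V : Type} [Fintype V] {G : SimpleGraph V} [DecidableRel G.Adj] {f : ℕ → V} {n : ℕ}
    (hn : n = Fintype.card V)
    (hs : ∀ v, ∃ i < n, f i = v)
    (hinj : ∀ i < n, ∀ j < n, f i = f j → i = j)
    (hadj : ∀ i, i + 1 < n → G.Adj (f i) (f (i+1)))
    (hx : Heavy G (f 0)) (hy : Heavy G (f (n-1))) (hxy : G.Adj (f 0) (f (n-1))) :
    IsPancyclic G := by
  classical
  intro k hk hkn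
  rw [← hn] at hkn
  unfold Heavy at hx hy
  rw [← hn] at hx hy
  have dx := idx_deg (G := G) hs (f 0)
  have dy := idx_deg (G := G) hs (f (n-1))
  set S := (Finset.Icc 1 (n-2)).filter (fun j => G.Adj (f 0) (f j)) with hS
  set T := (Finset.Icc 1 (n-2)).filter (fun j => G.Adj (f (n-1)) (f j)) with hT
  have cS : G.degree (f 0) ≤ S.card + 1 := by
    refine dx.trans ((Finset.card_le_card (t := insert (n-1) S) ?_).trans (Finset.card_insert_le _ _))
    intro j hj
    simp at hj
    by_cases e : j = n - 1
    · simp [e]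
    · have : j ≠ 0 := by rintro rfl; exact hj.2.ne rfl
      simp [hS, hj.2]
      omega
  have cT : G.degree (f (n-1)) ≤ T.card + 1 := by
    refine dy.trans ((Finset.card_le_card (t := insert 0 T) ?_).trans (Finset.card_insert_le _ _))
    intro j hj
    simp at hj
    by_cases e : j = 0
    · simp [e]
    · have : j ≠ n - 1 := by rintro rfl; exact hj.2.ne rfl
      simp [hT, hj.2]
      omega
  let φ : ℕ → ℕ := fun j => if j + k ≤ n + 1 then j + k - 3 else j + k - 1 - n
  have hφ : Set.InjOn φ S := by
    intro a ha b hb hab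
    simp [hS] at ha hb
    simp only [φ] at hab
    split_ifs at hab <;> omega
  have cφ : (S.image φ).card = S.card := Finset.card_image_of_injOn hφ
  have hsub : S.image φ ∪ T ⊆ Finset.Icc 1 (n-2) := by
    intro t ht
    simp only [Finset.mem_union, Finset.mem_image] at ht
    rcases ht with ⟨a, ha, rfl⟩ | ht
    · simp [hS] at ha
      simp only [φ, Finset.mem_Icc]
      split_ifs <;> omega
    · exact (Finset.mem_filter.1 ht).1
  have hnd : ¬ Disjoint (S.image φ) T := by
    intro hd
    have := Finset.card_le_card hsub
    rw [Finset.card_union_of_disjoint hd, cφ] at this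
    simp at this
    omega
  rw [Finset.not_disjoint_iff] at hnd
  obtain ⟨t, ht1, ht2⟩ := hnd
  obtain ⟨j, hj, rfl⟩ := Finset.mem_image.1 ht1
  simp [hS] at hj
  simp only [hT, Finset.mem_filter, Finset.mem_Icc] at ht2
  simp only [φ] at ht2
  split_ifs at ht2 with hc
  · have := seg_case1 (G := G) (m := k - 2) hinj hadj hj.1.1 (by omega) (by omega) hj.2
      (by rw [show j + (k-2) - 1 = j + k - 3 by omega]; exact ht2.2) hxy
    have := this.hasCycle
    simp at this
    rwa [show k - 2 + 1 + 1 = k by omega] at this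
  · have := seg_case2 (G := G) (j := j) (j' := j + k - 1 - n) hinj hadj (by omega) (by omega) hj.2 ht2.2 (by omega)
    have := this.hasCycle
    simp at this
    rwa [show j + k - 1 - n + 1 + (n - j) = k by omega] at this

/-- Convert a spanning cyclic list to an index function. -/
lemma to_fun {V : Type} [Fintype V] {r : V → V → Prop} {p : List V} (hnd : p.Nodup)
    (hc : p.IsChain r) (h3 : 3 ≤ p.length) (hall : ∀ v, v ∈ p) :
    ∃ f : ℕ → V, p.length = Fintype.card V ∧ (∀ v, ∃ i < p.length, f i = v) ∧
      (∀ i < p.length, ∀ j < p.length, f i = f j → i = j) ∧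
      (∀ i, i + 1 < p.length → r (f i) (f (i+1))) ∧ f 0 ∈ p.head? ∧ f (p.length - 1) ∈ p.getLast? ∧
      ∀ i (h : i < p.length), f i = p[i] := by
  classical
  have h0 : 0 < p.length := by omega
  let f : ℕ → V := fun i => if h : i < p.length then p[i] else p[0]
  have hf : ∀ i (h : i < p.length), f i = p[i] := fun i h => by simp only [f, h, dif_pos]
  refine ⟨f, ?_, ?_, ?_, ?_, ?_, ?_, hf⟩
  · rw [← List.toFinset_card_of_nodup hnd, ← Finset.card_univ]
    congr 1
    ext v; simp [hall v]
  · intro v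
    obtain ⟨i, hi, rfl⟩ := List.mem_iff_getElem.1 (hall v)
    exact ⟨i, hi, hf i hi⟩
  · intro i hi j hj hij
    rw [hf i hi, hf j hj] at hij
    exact (hnd.getElem_inj_iff).1 hij
  · intro i hi
    rw [hf i (by omega), hf (i+1) hi]
    exact List.isChain_iff_getElem.1 hc i hi
  · rw [hf 0 h0, List.head?_eq_getElem?]
    simp [h0]
  · rw [hf _ (by omega), List.getLast?_eq_getElem?]
    simp [h0]

/-- Removing one closure edge. -/
lemma swap_closing {V : Type} [Fintype V] {G H : SimpleGraph V} [DecidableRel G.Adj] (hGH : G ≤ H)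
    {f : ℕ → V} {n : ℕ} (hn : n = Fintype.card V) (h3 : 3 ≤ n)
    (hs : ∀ v, ∃ i < n, f i = v)
    (hinj : ∀ i < n, ∀ j < n, f i = f j → i = j)
    (hadj : ∀ i, i + 1 < n → H.Adj (f i) (f (i+1)))
    (hx : Heavy G (f 0)) (hy : Heavy G (f (n-1))) :
    ∃ l, CycL H.Adj l ∧ ∀ v, v ∈ l := by
  classical
  unfold Heavy at hx hy
  rw [← hn] at hx hy
  have dx := idx_deg (G := G) hs (f 0)
  have dy := idx_deg (G := G) hs (f (n-1))
  set S := (Finset.range n).filter (fun j => G.Adj (f 0) (f j)) with hS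
  set T := (Finset.range n).filter (fun j => G.Adj (f (n-1)) (f j)) with hT
  have cT : (T.image (· + 1)).card = T.card := Finset.card_image_of_injective _ (fun a b h => by simpa using h)
  have hsub : S ∪ T.image (· + 1) ⊆ Finset.Icc 1 (n-1) := by
    intro t ht
    simp only [Finset.mem_union, Finset.mem_image] at ht
    rcases ht with ht | ⟨a, ha, rfl⟩
    · simp [hS] at ht
      have : t ≠ 0 := by rintro rfl; exact ht.2.ne rfl
      simp; omega
    · simp [hT] at ha
      have : a ≠ n - 1 := by rintro rfl; exact ha.2.ne rfl
      simp; omega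
  have hnd : ¬ Disjoint S (T.image (· + 1)) := by
    intro hd
    have := Finset.card_le_card hsub
    rw [Finset.card_union_of_disjoint hd, cT] at this
    simp at this
    omega
  rw [Finset.not_disjoint_iff] at hnd
  obtain ⟨t, ht1, ht2⟩ := hnd
  obtain ⟨j, hj, rfl⟩ := Finset.mem_image.1 ht2
  simp [hS] at ht1
  simp [hT] at hj
  refine ⟨_, seg_case2 (G := H) (j := j+1) (j' := j) hinj hadj (by omega) ht1.1 (hGH ht1.2) (hGH hj.2) (by omega), ?_⟩
  intro v
  obtain ⟨i, hi, rfl⟩ := hs v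
  apply List.mem_map_of_mem
  simp
  omega

lemma ham_of_closure {V : Type} [Fintype V] {G G' : SimpleGraph V} [DecidableRel G.Adj]
    (hGG : G ≤ G') (hh : ∀ a b, G'.Adj a b → ¬ G.Adj a b → Heavy G a ∧ Heavy G b)
    (hham : ∃ l, CycL G'.Adj l ∧ ∀ v, v ∈ l) : ∃ l, CycL G.Adj l ∧ ∀ v, v ∈ l := by
  classical
  let P : Set (SimpleGraph V) := {H | G ≤ H ∧ H ≤ G' ∧ ∃ l, CycL H.Adj l ∧ ∀ v, v ∈ l}
  have hP : P.Nonempty := ⟨G', hGG, le_refl _, hham⟩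
  obtain ⟨H, hH, hmin⟩ := WellFounded.has_min (wellFounded_lt (α := SimpleGraph V)) P hP
  obtain ⟨h1, h2, l, hl, hall⟩ := hH
  by_cases e : H = G
  · subst e; exact ⟨l, hl, hall⟩
  exfalso
  have : ∃ x y, H.Adj x y ∧ ¬ G.Adj x y := by
    by_contra! hc
    exact e (le_antisymm (fun x y h => hc x y h) h1)
  obtain ⟨x, y, hxy, hnxy⟩ := this
  set H' := H.deleteEdges {s(x, y)} with hH'
  have hle : H' ≤ H := SimpleGraph.deleteEdges_le _
  have hlt : H' < H := by
    refine lt_of_le_of_ne hle (fun e => ?_)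
    have : H'.Adj x y := by rw [e]; exact hxy
    simp [hH'] at this
  have hG' : G ≤ H' := by
    intro a b hab
    simp only [hH', SimpleGraph.deleteEdges_adj]
    refine ⟨h1 hab, ?_⟩
    intro hc
    simp only [Set.mem_singleton_iff, Sym2.eq_iff] at hc
    rcases hc with ⟨rfl, rfl⟩ | ⟨rfl, rfl⟩
    · exact hnxy hab
    · exact hnxy hab.symm
  refine hmin H' ⟨hG', hle.trans h2, ?_⟩ hlt
  by_cases hcy : CycL H'.Adj l
  · exact ⟨l, hcy, hall⟩
  obtain ⟨p, hp, hpm, hplen, a, ha, b, hb, hnab⟩ := exists_rot hl hcy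
  have hpall : ∀ v, v ∈ p := fun v => (hpm v).2 (hall v)
  have hHab : H.Adj a b := hp.2.2.2 a ha b hb
  have heavy : Heavy G a ∧ Heavy G b := hh a b (h2 hHab) (fun h => hnab (hG' h))
  obtain ⟨f, f1, f2, f3, f4, f5, f6, _⟩ := to_fun hp.1 hp.2.2.1 hp.2.1 hpall
  have e0 : f 0 = b := Option.mem_unique f5 hb
  have e1 : f (p.length - 1) = a := Option.mem_unique f6 ha
  have h3 := hp.2.1
  refine swap_closing hG' f1 h3 f2 f3 ?_ (by rw [e0]; exact heavy.2) (by rw [e1]; exact heavy.1)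
  intro i hi
  have hi' := f4 i hi
  by_contra hc
  have k1 : s(a, b) = s(x, y) := by
    by_contra hne
    exact hnab (by simp only [hH', SimpleGraph.deleteEdges_adj]; exact ⟨hHab, hne⟩)
  have k2 : s(f i, f (i+1)) = s(x, y) := by
    by_contra hne
    exact hc (by simp only [hH', SimpleGraph.deleteEdges_adj]; exact ⟨hi', hne⟩)
  rw [← k1, ← e0, ← e1, Sym2.eq_iff] at k2
  rcases k2 with ⟨g1, g2⟩ | ⟨g1, g2⟩
  · have := f3 _ (by omega) _ (by omega) g1
    omega
  · have := f3 _ (by omega) _ (by omega) g1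
    have := f3 _ (by omega) _ (by omega) g2
    omega

/-- The partial closure: all heavy vertices are joined. -/
def heavyClosure {V : Type} [Fintype V] (G : SimpleGraph V) [DecidableRel G.Adj] :
    SimpleGraph V where
  Adj a b := G.Adj a b ∨ (a ≠ b ∧ Heavy G a ∧ Heavy G b)
  symm := ⟨fun _ _ h => h.elim (fun h => Or.inl h.symm) (fun h => Or.inr ⟨h.1.symm, h.2.2, h.2.1⟩)⟩
  loopless := ⟨fun _ h => h.elim (fun h => h.ne rfl) (fun h => h.1 rfl)⟩

lemma heavyClosure_light {V : Type} [Fintype V] {G : SimpleGraph V} [DecidableRel G.Adj] {a b : V}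
    (h : (heavyClosure G).Adj a b) (hl : ¬ Heavy G a ∨ ¬ Heavy G b) : G.Adj a b := by
  rcases h with h | h
  · exact h
  · tauto

/-- At an attachment vertex of a longest cycle, the successor is heavy. -/
lemma attach_heavy {V : Type} [Fintype V] {G : SimpleGraph V} [DecidableRel G.Adj]
    (LP : LightPair G) (LC : LightClique G) {l : List V} (hl : CycL (heavyClosure G).Adj l)
    (hK : ∀ v, Heavy G v → v ∈ l)
    (hmax : ∀ l', CycL (heavyClosure G).Adj l' → (∀ v, Heavy G v → v ∈ l') → l'.length ≤ l.length)
    {a h x : V} (ha : a ∈ l.getLast?) (hh : h ∈ l.head?) (hx : x ∉ l) (hxa : G.Adj x a) :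
    Heavy G h := by
  have hdec : ∃ m b, l = (h :: m) ++ [b, a] := by
    have h3 := hl.2.1
    cases l with
    | nil => simp at h3
    | cons c t =>
      simp at hh
      subst hh
      rcases t.eq_nil_or_concat with rfl | ⟨t', a', rfl⟩
      · simp at h3
      · rcases t'.eq_nil_or_concat with rfl | ⟨t'', b', rfl⟩
        · simp at h3
        · refine ⟨t'', b', ?_⟩
          have : a' = a := by
            simp only [List.concat_eq_append] at ha
            rw [← List.cons_append, List.getLast?_append] at ha
            simpa using ha
          subst this
          simp
  obtain ⟨m, b, rfl⟩ := hdec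
  have hxl : ¬ Heavy G x := fun hc => hx (hK x hc)
  by_contra hhl
  simp only [List.cons_append, List.mem_cons, List.mem_append, List.not_mem_nil, or_false,
    not_or] at hx
  obtain ⟨x1, x2, x3, x4⟩ := hx
  have hnd := hl.1
  obtain ⟨_, _, c1, c2⟩ := hl
  simp only [List.isChain_append] at c1
  obtain ⟨d1, d2, d3⟩ := c1
  have hba : (heavyClosure G).Adj b a := by simpa using d2
  have hah : (heavyClosure G).Adj a h := by
    apply c2
    · rw [List.getLast?_append]; simp
    · simp
  have hah' : G.Adj a h := heavyClosure_light hah (Or.inr hhl)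
  -- `x` not adjacent to `h`
  have n1 : ¬ G.Adj x h := by
    intro hc
    have : CycL (heavyClosure G).Adj (((h :: m) ++ [b, a]) ++ [x]) := by
      rw [cycL_append (by simp) (by simp)]
      refine ⟨?_, by simp, ?_, by simp, ?_, ?_⟩
      · rw [List.nodup_append]
        refine ⟨hnd, by simp, ?_⟩
        intro c hc d hd
        simp at hc hd
        subst hd
        rintro rfl
        tauto
      · rw [List.isChain_append]; exact ⟨d1, d2, d3⟩
      · simp; exact Or.inl hxa.symm
      · simp; exact Or.inl hc
    have := hmax _ this (fun v hv => List.mem_append_left _ (hK v hv))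
    simp at this
  have n2 : ¬ G.Adj x b := by
    intro hc
    have : CycL (heavyClosure G).Adj (((h :: m) ++ [b]) ++ [x, a]) := by
      rw [cycL_append (by simp) (by simp)]
      refine ⟨?_, by simp, ?_, ?_, ?_, ?_⟩
      · have : (x :: ((h :: m) ++ [b, a])).Nodup := by
          rw [List.nodup_cons]
          refine ⟨?_, hnd⟩
          simp
          tauto
        refine (List.Perm.nodup_iff ?_).1 this
        have e : ((h :: m) ++ [b]) ++ [x, a] = ((h :: m) ++ [b]) ++ x :: [a] := rfl
        rw [e]
        refine List.Perm.trans ?_ List.perm_middle.symm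
        simp
      · rw [List.isChain_append]
        refine ⟨d1, by simp, ?_⟩
        simpa using d3
      · simp; exact Or.inl hxa
      · simp; exact Or.inl hc.symm
      · simpa using hah
    have := hmax _ this (fun v hv => by
      have := hK v hv
      simp at this ⊢
      tauto)
    simp at this
  by_cases hal : Heavy G a
  · exact n1 (LC x h a hxl hhl hal x1 hxa.symm hah')
  · have hbh : b ≠ h := by
      rintro rfl
      simp at hnd
    have hba' : G.Adj a b := (heavyClosure_light hba (Or.inr hal)).symm
    exact n2 (LP x h a b hxl hhl x1 n1 hxa.symm hah' hba' (Ne.symm x3) hbh).1.symm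

lemma closure_ham {V : Type} [Fintype V] {G : SimpleGraph V} [DecidableRel G.Adj]
    [DecidablePred (Heavy G)] (h2 : TwoConnected G)
    (LP : LightPair G) (LC : LightClique G) (h3 : 3 ≤ (Finset.univ.filter (Heavy G)).card) :
    ∃ l, CycL (heavyClosure G).Adj l ∧ ∀ v, v ∈ l := by
  classical
  -- start
  have hstart : ∃ l : List V, CycL (heavyClosure G).Adj l ∧ ∀ v, Heavy G v → v ∈ l := by
    set K := (Finset.univ.filter (Heavy G)).toList with hKdef
    have mK : ∀ v, v ∈ K ↔ Heavy G v := by intro v; simp [hKdef]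
    have nd : K.Nodup := Finset.nodup_toList _
    have len : 3 ≤ K.length := by rw [hKdef, Finset.length_toList]; exact h3
    refine ⟨K, ⟨nd, len, ?_, ?_⟩, fun v => (mK v).2⟩
    · rw [List.isChain_iff_getElem]
      intro i hi
      refine Or.inr ⟨?_, (mK _).1 (List.getElem_mem _), (mK _).1 (List.getElem_mem _)⟩
      intro hc
      have := nd.getElem_inj_iff.1 hc
      omega
    · intro a ha b hb
      refine Or.inr ⟨?_, (mK _).1 (List.mem_of_getLast? ha), (mK _).1 (List.mem_of_head? hb)⟩
      rintro rfl
      rw [List.getLast?_eq_getElem?] at ha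
      rw [List.head?_eq_getElem?] at hb
      simp at ha hb
      obtain ⟨g1, g2⟩ := List.getElem?_eq_some_iff.1 ha
      obtain ⟨g3, g4⟩ := List.getElem?_eq_some_iff.1 hb
      have := nd.getElem_inj_iff.1 (g2.trans g4.symm)
      omega
  -- longest
  have hlong : ∃ l : List V, CycL (heavyClosure G).Adj l ∧ (∀ v, Heavy G v → v ∈ l) ∧
      ∀ l', CycL (heavyClosure G).Adj l' → (∀ v, Heavy G v → v ∈ l') → l'.length ≤ l.length := by
    let Q : ℕ → Prop := fun k => ∃ l : List V, CycL (heavyClosure G).Adj l ∧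
      (∀ v, Heavy G v → v ∈ l) ∧ l.length = k
    have hb : ∀ k, Q k → k ≤ Fintype.card V := by
      rintro k ⟨l, hl, _, rfl⟩
      exact hl.1.length_le_card
    obtain ⟨l0, hl0, hl0'⟩ := hstart
    have hQ : Q (Nat.findGreatest Q (Fintype.card V)) :=
      Nat.findGreatest_spec (m := l0.length) (hb _ ⟨l0, hl0, hl0', rfl⟩) ⟨l0, hl0, hl0', rfl⟩
    obtain ⟨l, h1, h2, h3⟩ := hQ
    refine ⟨l, h1, h2, fun l' g1 g2 => ?_⟩
    rw [h3]
    exact Nat.le_findGreatest (hb _ ⟨l', g1, g2, rfl⟩) ⟨l', g1, g2, rfl⟩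
  obtain ⟨l, hl, hK, hmax⟩ := hlong
  refine ⟨l, hl, ?_⟩
  by_contra! hoff
  obtain ⟨o, ho⟩ := hoff
  -- an off-vertex adjacent to the cycle
  have : ∃ x y, x ∉ l ∧ y ∈ l ∧ G.Adj x y := by
    by_contra! hc
    have := connForm h2 {v | v ∉ l} ⟨o, ho⟩ (fun a ha b hab hb => hc a b ha hb hab)
    have h0 : 0 < l.length := by have := hl.2.1; omega
    exact this l[0] (List.getElem_mem h0)
  obtain ⟨x, y, hx, hy, hxy⟩ := this
  let O : Set V := {v | v ∉ l}
  have : ∃ s z, ∃ hs : s ∈ O, (G.induce O).Reachable ⟨x, hx⟩ ⟨s, hs⟩ ∧ z ∈ l ∧ z ≠ y ∧ G.Adj s z := by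
    by_contra! hc
    have := cutForm h2 y {v | ∃ hv : v ∈ O, (G.induce O).Reachable ⟨x, hx⟩ ⟨v, hv⟩}
      (by rintro ⟨hv, _⟩; exact hv hy) ⟨x, hx, Reachable.refl _⟩ (by
        rintro a ⟨ha, hra⟩ b hab
        by_cases hb : b ∈ l
        · right
          by_contra hby
          exact hc a b ha hra hb hby hab
        · left
          refine ⟨hb, hra.trans ?_⟩
          apply Adj.reachable
          exact hab)
    have hlen := hl.2.1
    have h0 : 0 < l.length := by omega
    have h1 : 1 < l.length := by omega
    have e0 := (this l[0]).resolve_left (by rintro ⟨hv, _⟩; exact hv (List.getElem_mem h0))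
    have e1 := (this l[1]).resolve_left (by rintro ⟨hv, _⟩; exact hv (List.getElem_mem h1))
    have := hl.1.getElem_inj_iff.1 (e0.trans e1.symm)
    omega
  obtain ⟨s, z, hs, hreach, hz, hzy, hsz⟩ := this
  -- the path outside
  have hpath : ∃ P : List V, ∃ hne : P ≠ [], P.Nodup ∧ P.IsChain G.Adj ∧ (∀ v ∈ P, v ∉ l) ∧
      P.head hne = x ∧ P.getLast hne = s := by
    obtain ⟨p, hp⟩ := hreach.exists_isPath
    refine ⟨p.support.map Subtype.val,
      fun hc => p.support_ne_nil (List.map_eq_nil_iff.1 hc), ?_, ?_, ?_, ?_, ?_⟩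
    · exact (List.nodup_map_iff Subtype.val_injective).2 ((Walk.isPath_def p).1 hp)
    · rw [List.isChain_map]
      exact p.isChain_adj_support
    · intro v hv
      obtain ⟨w, _, rfl⟩ := List.mem_map.1 hv
      exact w.2
    · rw [List.head_map]; simp
    · rw [List.getLast_map]; simp
  obtain ⟨P, hPne, hPnd, hPc, hPo, hPx, hPs⟩ := hpath
  -- decompose the cycle
  have hdec : ∃ l1 l2, CycL (heavyClosure G).Adj ((l1 ++ [z]) ++ (l2 ++ [y])) ∧
      (∀ v, v ∈ (l1 ++ [z]) ++ (l2 ++ [y]) ↔ v ∈ l) ∧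
      ((l1 ++ [z]) ++ (l2 ++ [y])).length = l.length := by
    obtain ⟨s1, t1, e1⟩ := List.append_of_mem hy
    have hz' : z ∈ t1 ++ s1 := by
      rw [e1] at hz
      simp at hz ⊢
      tauto
    obtain ⟨l1, l2, e2⟩ := List.append_of_mem hz'
    have e3 : (l1 ++ [z]) ++ (l2 ++ [y]) = t1 ++ (s1 ++ [y]) := by
      rw [← List.append_assoc t1, e2]; simp
    rw [e1] at hl
    refine ⟨l1, l2, ?_, ?_, ?_⟩
    · rw [e3]
      apply CycL.rotate
      simpa using hl
    · intro v
      rw [e3, e1]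
      simp
      tauto
    · rw [e3, e1]
      simp
      omega
  obtain ⟨l1, l2, hcyc, hmem, hlen⟩ := hdec
  set A := l1 ++ [z] with hA
  set B := l2 ++ [y] with hB
  have hAne : A ≠ [] := by simp [hA]
  have hBne : B ≠ [] := by simp [hB]
  have lA : A.getLast hAne = z := by simp [hA]
  have lB : B.getLast hBne = y := by simp [hB]
  have hh1 : Heavy G (A.head hAne) := by
    refine attach_heavy LP LC hcyc (fun v hv => (hmem v).2 (hK v hv))
      (fun l' g1 g2 => by rw [hlen]; exact hmax l' g1 g2) (a := y) (x := x) ?_ ?_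
      (fun hc => hx ((hmem x).1 hc)) hxy
    · rw [List.getLast?_append, List.getLast?_eq_some_getLast hBne, lB]; rfl
    · rw [List.head?_append, List.head?_eq_some_head hAne]; rfl
  have hh2 : Heavy G (B.head hBne) := by
    refine attach_heavy LP LC hcyc.rotate
      (fun v hv => (List.perm_append_comm.mem_iff).1 ((hmem v).2 (hK v hv)))
      (fun l' g1 g2 => by
        rw [List.length_append, Nat.add_comm, ← List.length_append, hlen]; exact hmax l' g1 g2)
      (a := z) (x := s) ?_ ?_
      (fun hc => hs ((hmem s).1 ((List.perm_append_comm.mem_iff).1 hc))) hsz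
    · rw [List.getLast?_append, List.getLast?_eq_some_getLast hAne, lA]; rfl
    · rw [List.head?_append, List.head?_eq_some_head hBne]; rfl
  rw [cycL_append hAne hBne] at hcyc
  obtain ⟨c1, c2, c3, c4, c5, c6⟩ := hcyc
  have hne : A.head hAne ≠ B.head hBne := by
    intro hc
    exact (List.nodup_append.1 c1).2.2 _ (List.head_mem hAne) _ (List.head_mem hBne) hc
  have hArev : A.reverse ≠ [] := by simpa using hAne
  have hnew : CycL (heavyClosure G).Adj (P ++ (A.reverse ++ B)) := by
    rw [cycL_append hPne (by simp [hBne])]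
    refine ⟨?_, by simp; omega, hPc.imp (fun a b h => Or.inl h), ?_, ?_, ?_⟩
    · rw [List.nodup_append]
      refine ⟨hPnd, ?_, ?_⟩
      · refine (List.Perm.nodup_iff ?_).1 c1
        exact List.Perm.append_right _ (List.reverse_perm A).symm
      · intro a ha b hb hab
        subst hab
        apply hPo a ha
        rw [← hmem]
        simpa using hb
    · rw [List.isChain_append, List.isChain_reverse]
      refine ⟨c3.imp (fun a b h => h.symm), c4, ?_⟩
      intro a ha b hb
      rw [List.getLast?_reverse, List.head?_eq_some_head hAne] at ha
      rw [List.head?_eq_some_head hBne] at hb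
      simp only [Option.mem_def, Option.some.injEq] at ha hb
      subst ha hb
      exact Or.inr ⟨hne, hh1, hh2⟩
    · rw [hPs, List.head_append_of_ne_nil hArev, List.head_reverse, lA]
      exact Or.inl hsz
    · rw [hPx, List.getLast_append_of_ne_nil _ hBne, lB]
      exact Or.inl hxy.symm
  have hfin := hmax _ hnew (fun v hv => by
    have := (hmem v).2 (hK v hv)
    simp only [List.mem_append, List.mem_reverse] at this ⊢
    tauto)
  have hpos := List.length_pos_of_ne_nil hPne
  simp only [List.length_append, List.length_reverse] at hfin hlen
  omega

lemma no_sparse {V : Type} [Fintype V] {G : SimpleGraph V} [DecidableRel G.Adj]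
    (LP : LightPair G) (LC : LightClique G) (σ : Equiv.Perm V) (hσ : ∀ v, G.Adj v (σ v))
    (hno : ∀ v, ¬ (Heavy G v ∧ Heavy G (σ v))) (hcyc : ∀ a b, ∃ i : ℕ, (σ ^ i) a = b)
    (hss : ∀ v, σ (σ v) ≠ v) (hex : ∃ w, Heavy G w) : False := by
  classical
  have claim : ∀ w x y z, Heavy G w → ¬ Heavy G x → ¬ Heavy G y → ¬ Heavy G z → G.Adj w x →
      G.Adj x y → G.Adj y z → z ≠ x → G.Adj x z := by
    intro w x y z hw hx hy hz hwx hxy hyz hzx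
    by_contra hn
    have nex : ∀ {t}, ¬ Heavy G t → w ≠ t := by rintro t ht rfl; exact ht hw
    have hwz : ¬ G.Adj w z := fun h => hn (LC x z w hx hz hw hzx.symm hwx h)
    have hwy : ¬ G.Adj w y := fun h =>
      hwz (LP x z y w hx hz hzx.symm hn hxy.symm hyz h.symm (nex hx) (nex hz)).2
    have : ∃ x', ¬ Heavy G x' ∧ G.Adj w x' ∧ x' ≠ x := by
      by_cases e : σ w = x
      · refine ⟨σ.symm w, ?_, ?_, ?_⟩
        · intro h
          exact hno (σ.symm w) ⟨h, by simpa using hw⟩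
        · have := hσ (σ.symm w)
          simpa using this.symm
        · intro h
          apply hss (σ.symm w)
          rw [Equiv.apply_symm_apply, e, h]
      · exact ⟨σ w, fun h => hno w ⟨hw, h⟩, hσ w, e⟩
    obtain ⟨x', hx', hwx', hne⟩ := this
    have hxx' : G.Adj x x' := LC x x' w hx hx' hw hne.symm hwx hwx'
    have x'y : x' ≠ y := by rintro rfl; exact hwy hwx'
    have x'z : x' ≠ z := by rintro rfl; exact hwz hwx'
    by_cases h : G.Adj x' y
    · have h1 := (LP x z y x' hx hz hzx.symm hn hxy.symm hyz h.symm hne x'z).2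
      exact hwz (LP x z x' w hx hz hzx.symm hn hxx'.symm h1 hwx'.symm (nex hx) (nex hz)).2
    · exact hwy (LP x' y x w hx' hy x'y h hxx' hxy hwx.symm (nex hx') (nex hy)).2
  obtain ⟨w, hw⟩ := hex
  set x := σ w with hxdef
  have hx : ¬ Heavy G x := fun h => hno w ⟨hw, h⟩
  have hwx : G.Adj w x := hσ w
  have step : ∀ y z, ¬ Heavy G y → ¬ Heavy G z → (y = x ∨ G.Adj x y) → G.Adj y z →
      (z = x ∨ G.Adj x z) := by
    intro y z hy hz hxy hyz
    by_cases e : z = x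
    · exact Or.inl e
    right
    rcases hxy with rfl | hxy
    · exact hyz
    · exact claim w x y z hw hx hy hz hwx hxy hyz e
  have hall : ∀ i : ℕ, ¬ Heavy G ((σ ^ i) x) → ((σ ^ i) x = x ∨ G.Adj x ((σ ^ i) x)) := by
    intro i
    induction i using Nat.strong_induction_on with
    | _ i ih =>
      intro hi
      rcases i with _ | i
      · left; simp
      have e1 : (σ ^ (i+1)) x = σ ((σ ^ i) x) := by rw [pow_succ']; rfl
      rw [e1] at hi ⊢
      by_cases hl : Heavy G ((σ ^ i) x)
      · rcases i with _ | i
        · simp at hl; exact absurd hl hx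
        have e2 : (σ ^ (i+1)) x = σ ((σ ^ i) x) := by rw [pow_succ']; rfl
        rw [e2] at hl hi ⊢
        have hl' : ¬ Heavy G ((σ ^ i) x) := fun h => hno _ ⟨h, hl⟩
        refine step _ _ hl' hi (ih i (by omega) hl') ?_
        exact LC _ _ _ hl' hi hl (hss _).symm (hσ _).symm (hσ _)
      · exact step _ _ hl hi (ih i (by omega) hl) (hσ _)
  have hall' : ∀ v, ¬ Heavy G v → (v = x ∨ G.Adj x v) := by
    intro v hv
    obtain ⟨i, rfl⟩ := hcyc x v
    exact hall i hv
  set H := Finset.univ.filter (Heavy G) with hH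
  set L := Finset.univ.filter (fun v => ¬ Heavy G v) with hL
  have hHL : H.card + L.card = Fintype.card V := by
    rw [← Finset.card_univ]
    exact Finset.card_filter_add_card_filter_not _
  have himg : H.image σ ⊆ L := by
    intro t ht
    obtain ⟨v, hv, rfl⟩ := Finset.mem_image.1 ht
    simp [hH] at hv
    simp [hL]
    exact fun h => hno v ⟨hv, h⟩
  have hci : (H.image σ).card = H.card := Finset.card_image_of_injective _ σ.injective
  have hle := Finset.card_le_card himg
  have hxL : x ∈ L := by simp [hL, hx]
  have hxl' := hx
  unfold Heavy at hxl'
  have bound : ∀ T : Finset V, (∀ t ∈ T, Heavy G t ∧ G.Adj x t) →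
      L.card + T.card ≤ G.degree x + 1 := by
    intro T hT
    have hsub : L.erase x ∪ T ⊆ G.neighborFinset x := by
      intro t ht
      rw [mem_neighborFinset]
      simp only [Finset.mem_union, Finset.mem_erase, hL, Finset.mem_filter, Finset.mem_univ,
        true_and] at ht
      rcases ht with ⟨h1, h2⟩ | h
      · exact (hall' t h2).resolve_left h1
      · exact (hT t h).2
    have hdis : Disjoint (L.erase x) T := by
      rw [Finset.disjoint_left]
      intro t ht ht'
      simp [hL] at ht
      exact ht.2 (hT t ht').1
    have h1 := Finset.card_le_card hsub
    rw [Finset.card_union_of_disjoint hdis, Finset.card_erase_of_mem hxL,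
      G.card_neighborFinset_eq_degree] at h1
    have := Finset.card_pos.2 ⟨x, hxL⟩
    omega
  have b1 := bound {w} (by simp [hw, hwx.symm])
  simp at b1
  have heq : H.image σ = L := Finset.eq_of_subset_of_card_le himg (by omega)
  have hsx : Heavy G (σ x) := by
    by_contra hc
    have : σ x ∈ H.image σ := by rw [heq]; simp [hL, hc]
    obtain ⟨v, hv, hvx⟩ := Finset.mem_image.1 this
    have := σ.injective hvx
    subst this
    simp [hH] at hv
    exact hx hv
  have b2 := bound {w, σ x} (by simp [hw, hwx.symm, hsx, hσ x])
  rw [Finset.card_pair (hss w).symm] at b2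
  omega

lemma big_case {V : Type} [Fintype V] {G : SimpleGraph V} [DecidableRel G.Adj]
    (h2 : TwoConnected G) (h5 : 5 ≤ Fintype.card V) (hnc : ¬ IsCycleGraph G)
    (LP : LightPair G) : IsPancyclic G := by
  classical
  have LC := lightClique h2 h5 LP
  have hex := exists_heavy h2 h5 hnc LP
  have h3 := three_heavy LC hex
  obtain ⟨l, hl, hall⟩ := ham_of_closure (G := G) (G' := heavyClosure G) (fun a b h => Or.inl h)
    (fun a b h hn => by rcases h with h | h; exacts [absurd h hn, h.2]) (closure_ham h2 LP LC h3)
  by_cases hcy : CycL (fun a b => ¬ (Heavy G a ∧ Heavy G b)) l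
  · exfalso
    have hcyc : ∀ a b, ∃ i : ℕ, (l.formPerm ^ i) a = b := by
      intro a b
      obtain ⟨i, hi⟩ := (hl.1.isCycleOn_formPerm).exists_pow_eq' (Set.toFinite _) (hall a) (hall b)
      exact ⟨i, hi⟩
    refine no_sparse LP LC l.formPerm (fun v => formPerm_rel hl v (hall v))
      (fun v => formPerm_rel hcy v (hall v)) hcyc ?_ hex
    intro v hv
    -- then the orbit has at most two points
    have : ∀ i : ℕ, (l.formPerm ^ i) v = v ∨ (l.formPerm ^ i) v = l.formPerm v := by
      intro i
      induction i with
      | zero => simp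
      | succ i ih =>
        rw [pow_succ', Equiv.Perm.mul_apply]
        rcases ih with h | h
        · rw [h]; simp
        · rw [h, hv]; simp
    obtain ⟨t, ht1, ht2⟩ := exists_third h2.1 v (l.formPerm v)
    obtain ⟨i, rfl⟩ := hcyc v t
    rcases this i with h | h
    · exact ht1 h
    · exact ht2 h
  · obtain ⟨p, hp, hpm, _, a, ha, b, hb, hab⟩ := exists_rot hl hcy
    have hpall : ∀ v, v ∈ p := fun v => (hpm v).2 (hall v)
    have hab' := not_not.1 hab
    have hadj := hp.2.2.2 a ha b hb
    obtain ⟨f, f1, f2, f3, f4, f5, f6, _⟩ := to_fun hp.1 hp.2.2.1 hp.2.1 hpall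
    have e0 : f 0 = b := Option.mem_unique f5 hb
    have e1 : f (p.length - 1) = a := Option.mem_unique f6 ha
    exact bondy f1 f2 f3 f4 (by rw [e0]; exact hab'.2) (by rw [e1]; exact hab'.1)
      (by rw [e0, e1]; exact hadj.symm)

lemma small_case {V : Type} [Fintype V] {G : SimpleGraph V} [DecidableRel G.Adj]
    (h2 : TwoConnected G) (h5 : Fintype.card V < 5) (hnc : ¬ IsCycleGraph G) : IsPancyclic G := by
  classical
  have h3 := h2.1
  have tri : ∀ a b c, G.Adj a b → G.Adj b c → G.Adj c a → HasCycleLength G 3 := by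
    intro a b c hab hbc hca
    have : CycL G.Adj [a, b, c] := by
      refine ⟨?_, by simp, by simp [hab, hbc], by simpa using hca⟩
      simp [hab.ne, hbc.ne, hca.ne']
    exact this.hasCycle
  have quad : ∀ a b c d, G.Adj a b → G.Adj b c → G.Adj c d → G.Adj d a → a ≠ c → b ≠ d →
      HasCycleLength G 4 := by
    intro a b c d hab hbc hcd hda hac hbd
    have : CycL G.Adj [a, b, c, d] := by
      refine ⟨?_, by simp, by simp [hab, hbc, hcd], by simpa using hda⟩
      simp [hab.ne, hbc.ne, hda.ne', hac, hbd, hcd.ne]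
    exact this.hasCycle
  have hv : ∃ v, G.degree v ≠ 2 := by
    by_contra! h
    exact hnc ⟨conn_of_two h2, h⟩
  obtain ⟨v, hv⟩ := hv
  have hv3 : 3 ≤ G.degree v := by
    obtain ⟨a, ha, _⟩ := two_nbrs h2 v v
    obtain ⟨b, hb, hab⟩ := two_nbrs h2 v a
    have : ({a, b} : Finset V) ⊆ G.neighborFinset v := by
      intro t ht
      simp at ht
      rcases ht with rfl | rfl <;> simpa
    have := Finset.card_le_card this
    rw [Finset.card_pair hab.symm, G.card_neighborFinset_eq_degree] at this
    omega
  have hlt := G.degree_lt_card_verts v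
  have hd : G.degree v = 3 := by omega
  have hc : Fintype.card V = 4 := by omega
  rw [← G.card_neighborFinset_eq_degree, Finset.card_eq_three] at hd
  obtain ⟨a, b, c, hab, hac, hbc, he⟩ := hd
  have mem : ∀ t, G.Adj v t ↔ t = a ∨ t = b ∨ t = c := by
    intro t
    rw [← mem_neighborFinset, he]; simp
  have va := (mem a).2 (by simp)
  have vb := (mem b).2 (by simp)
  have vc := (mem c).2 (by simp)
  have all : ∀ t, t = v ∨ t = a ∨ t = b ∨ t = c := by
    have : (Finset.univ : Finset V) = insert v (G.neighborFinset v) := by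
      symm
      apply Finset.eq_univ_of_card
      rw [Finset.card_insert_of_notMem (by simp), he, Finset.card_eq_three.2 ⟨a, b, c, hab, hac, hbc, rfl⟩, hc]
    intro t
    have ht := Finset.mem_univ t
    rw [this, he] at ht
    simpa using ht
  have key : ∀ a b c, G.Adj v a → G.Adj v b → G.Adj v c → a ≠ c → G.Adj a b → G.Adj b c →
      IsPancyclic G := by
    intro a b c va vb vc hac h1 h2 k hk hk'
    have : k = 3 ∨ k = 4 := by omega
    rcases this with rfl | rfl
    · exact tri v a b va h1 vb.symm
    · exact quad v a b c va h1 h2 vc.symm vb.ne hac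
  have nb : ∀ t, ∃ s, G.Adj t s ∧ s ≠ v := fun t => two_nbrs h2 t v
  obtain ⟨a', ha', ha''⟩ := nb a
  obtain ⟨b', hb', hb''⟩ := nb b
  obtain ⟨c', hc', hc''⟩ := nb c
  have A : G.Adj a b ∨ G.Adj a c := by
    rcases all a' with rfl | rfl | rfl | rfl
    · exact absurd rfl ha''
    · exact absurd rfl ha'.ne
    · exact Or.inl ha'
    · exact Or.inr ha'
  have B : G.Adj a b ∨ G.Adj b c := by
    rcases all b' with rfl | rfl | rfl | rfl
    · exact absurd rfl hb''
    · exact Or.inl hb'.symm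
    · exact absurd rfl hb'.ne
    · exact Or.inr hb'
  have C : G.Adj a c ∨ G.Adj b c := by
    rcases all c' with rfl | rfl | rfl | rfl
    · exact absurd rfl hc''
    · exact Or.inl hc'.symm
    · exact Or.inr hc'.symm
    · exact absurd rfl hc'.ne
  by_cases i1 : G.Adj a b
  · by_cases i2 : G.Adj a c
    · exact key b a c vb va vc hbc i1.symm i2
    · exact key a b c va vb vc hac i1 (by tauto)
  · exact key a c b va vc vb hab (by tauto) (G.adj_comm _ _ |>.1 (by tauto))

theorem pancyclic_of_claw_Z1_f1_heavy {V : Type} [Fintype V] (G : SimpleGraph V)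
    [DecidableRel G.Adj] (h2 : TwoConnected G) (hnc : ¬ IsCycleGraph G)
    (hclaw : F1Heavy G claw) (hZ1 : F1Heavy G (Zgraph 1)) :
    IsPancyclic G := by
  by_cases h5 : 5 ≤ Fintype.card V
  · exact big_case h2 h5 hnc (fun u v w x hu hv huv hn hwu hwv hwx hxu hxv =>
      light_pair hclaw hZ1 hu hv huv hn hwu hwv hwx hxu hxv)
  · exact small_case h2 (by omega) hnc
end
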